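/- arXiv:1511.09073 — 2 statements merged into one kernel-verified Lean document; each statement's English description precedes it below -/
import Mathlib

section
/- Let L_10 = {S_10, K_6 ∪ K_4, G_1(10), G_2(10), K_5 ∪ K_5}. The maximum number of edges of a P-free 3-graph H on 10 vertices such that H is not contained in any member of L_10 equals 19; moreover such an H has 19 edges if and only if H is isomorphic to the comet Co(10). -/
/-- A 3-graph: a finite vertex set together with a finite set of edges
(intended to be 3-element subsets of the vertex set). -/
structure ThreeGraph where
  verts : Finset ℕ
  edges : Finset (Finset ℕ)

namespace ThreeGraph

/-- `G` is a genuine 3-uniform hypergraph: every edge is a 3-element subset of the vertex set. -/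
def IsValid (G : ThreeGraph) : Prop :=
  ∀ e ∈ G.edges, e.card = 3 ∧ e ⊆ G.verts

/-- `H.ContainsCopy F` means `F ⊆ H`: there is an injective map of the vertices of `F`
into those of `H` carrying every edge of `F` to an edge of `H`. -/
def ContainsCopy (H F : ThreeGraph) : Prop :=
  ∃ f : ℕ → ℕ, Set.InjOn f ↑F.verts ∧ (∀ v ∈ F.verts, f v ∈ H.verts) ∧
    ∀ e ∈ F.edges, e.image f ∈ H.edges

/-- `H.Free F` : `H` contains no copy of `F`. -/
def Free (H F : ThreeGraph) : Prop := ¬ H.ContainsCopy F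

/-- `IsoCopy F H` : `H` is isomorphic to `F`. -/
def IsoCopy (F H : ThreeGraph) : Prop :=
  ∃ f : ℕ → ℕ, Set.InjOn f ↑F.verts ∧ F.verts.image f = H.verts ∧
    F.edges.image (Finset.image f) = H.edges

/-- Connectivity: any two vertices are joined by a sequence of vertices in which
consecutive ones lie in a common edge. -/
def Connected (G : ThreeGraph) : Prop :=
  ∀ u ∈ G.verts, ∀ v ∈ G.verts,
    Relation.ReflTransGen (fun a b => ∃ e ∈ G.edges, a ∈ e ∧ b ∈ e) u v

/-- Shift all vertices by `k`. -/
def shiftBy (G : ThreeGraph) (k : ℕ) : ThreeGraph :=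
  ⟨G.verts.image (· + k), G.edges.image (Finset.image (· + k))⟩

/-- Vertex-disjoint union of two 3-graphs. -/
def dUnion (G H : ThreeGraph) : ThreeGraph :=
  ⟨G.verts ∪ (H.shiftBy (G.verts.sup id + 1)).verts,
   G.edges ∪ (H.shiftBy (G.verts.sup id + 1)).edges⟩

end ThreeGraph

/-- The loose 3-uniform path of length 3. -/
def pathP : ThreeGraph :=
  ⟨{0,1,2,3,4,5,6}, {{0,1,2},{2,3,4},{4,5,6}}⟩

/-- The triangle `C`. -/
def triangleC : ThreeGraph :=
  ⟨{0,1,2,3,4,5}, {{0,1,2},{2,3,4},{4,5,0}}⟩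

/-- The matching `M`: two disjoint edges. -/
def matchingM : ThreeGraph :=
  ⟨{0,1,2,3,4,5}, {{0,1,2},{3,4,5}}⟩

/-- `P_2`: two edges sharing exactly one vertex. -/
def pairP2 : ThreeGraph :=
  ⟨{0,1,2,3,4}, {{0,1,2},{2,3,4}}⟩

/-- The complete 3-graph `K_n`. -/
def KK (n : ℕ) : ThreeGraph :=
  ⟨Finset.range n, (Finset.range n).powersetCard 3⟩

/-- The full star `S_n` with center `0`. -/
def SS (n : ℕ) : ThreeGraph :=
  ⟨Finset.range n, ((Finset.range n).powersetCard 3).filter (fun e => 0 ∈ e)⟩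

/-- `G_1(n)` with `x,y,z,v = 0,1,2,3`. -/
def G1 (n : ℕ) : ThreeGraph :=
  ⟨Finset.range n,
   insert {0,1,2}
     (((Finset.range n).powersetCard 3).filter
       (fun h => 3 ∈ h ∧ (h ∩ ({0,1,2} : Finset ℕ)).Nonempty))⟩

/-- `G_2(n)` with `x,y,z = 0,1,2`. -/
def G2 (n : ℕ) : ThreeGraph :=
  ⟨Finset.range n,
   insert {0,1,2}
     (((Finset.range n).powersetCard 3).filter
       (fun h => (h ∩ ({0,1,2} : Finset ℕ)).card = 2))⟩

/-- `G_3(n)` with `x,y₁,y₂,z₁,z₂ = 0,1,2,3,4`. -/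
def G3 (n : ℕ) : ThreeGraph :=
  ⟨Finset.range n,
   ((({0,1,2,3,4} : Finset ℕ).powersetCard 3) \ {{1,2,3},{1,2,4}}) ∪
     ((Finset.range n \ ({0,1,2,3,4} : Finset ℕ)).biUnion (fun w => {{0,3,w},{0,4,w}}))⟩

/-- `K_5^{+t}`: `K_5` on `{0,…,4}` with `a,b = 0,1` and `t` pendant edges `{0,1,v}`. -/
def K5plus (t : ℕ) : ThreeGraph :=
  ⟨Finset.range (5 + t),
   ((Finset.range 5).powersetCard 3) ∪ ((Finset.Ico 5 (5 + t)).image (fun v => {0,1,v}))⟩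

/-- The comet `Co(n)`: a `K_4` on `{0,1,2,3}` and a full star on `{0} ∪ {4,…,n-1}`
with center `0`. -/
def comet (n : ℕ) : ThreeGraph :=
  ⟨Finset.range n,
   (({0,1,2,3} : Finset ℕ).powersetCard 3) ∪
     (((insert 0 (Finset.Ico 4 n)).powersetCard 3).filter (fun e => 0 ∈ e))⟩

/-- `W = V(H) \ U`. -/
def Wset (H : ThreeGraph) (U : Finset ℕ) : Finset ℕ := H.verts \ U

/-- `W_0`: the vertices of `W` lying in no edge of `H` entirely contained in `W`. -/
def W0set (H : ThreeGraph) (U : Finset ℕ) : Finset ℕ :=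
  (Wset H U).filter (fun v => ∀ e ∈ H.edges, e ⊆ Wset H U → v ∉ e)

/-- `W_1 = W \ W_0`. -/
def W1set (H : ThreeGraph) (U : Finset ℕ) : Finset ℕ :=
  Wset H U \ W0set H U

/-- `H_1`: the edges of `H` meeting both `U` and `W_1`. -/
def H1set (H : ThreeGraph) (U : Finset ℕ) : Finset (Finset ℕ) :=
  H.edges.filter (fun e => (e ∩ U).Nonempty ∧ (e ∩ W1set H U).Nonempty)

/-- `H[U]`: the edges of `H` entirely contained in `U`. -/
def HUset (H : ThreeGraph) (U : Finset ℕ) : Finset (Finset ℕ) :=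
  H.edges.filter (fun e => e ⊆ U)

/-- The family `L₁₀`. -/
def L10 : List ThreeGraph := [SS 10, (KK 6).dUnion (KK 4), G1 10, G2 10, (KK 5).dUnion (KK 5)]

/-! ### A verified exhaustive search with symmetry reduction -/

namespace Fifth

/-- Certificate trees for the search. -/
inductive CT where
  | cnt : CT
  | emb : ℕ → List ℕ → CT
  | br : ℕ → ℕ → ℕ → List ℕ → CT → CT → CT

/-- All increasing triples from `{0,…,9}`. -/
def T120 : List (ℕ × ℕ × ℕ) :=
  [(0,1,2), (0,1,3), (0,1,4), (0,1,5), (0,1,6), (0,1,7), (0,1,8), (0,1,9),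
   (0,2,3), (0,2,4), (0,2,5), (0,2,6), (0,2,7), (0,2,8), (0,2,9), (0,3,4),
   (0,3,5), (0,3,6), (0,3,7), (0,3,8), (0,3,9), (0,4,5), (0,4,6), (0,4,7),
   (0,4,8), (0,4,9), (0,5,6), (0,5,7), (0,5,8), (0,5,9), (0,6,7), (0,6,8),
   (0,6,9), (0,7,8), (0,7,9), (0,8,9), (1,2,3), (1,2,4), (1,2,5), (1,2,6),
   (1,2,7), (1,2,8), (1,2,9), (1,3,4), (1,3,5), (1,3,6), (1,3,7), (1,3,8),
   (1,3,9), (1,4,5), (1,4,6), (1,4,7), (1,4,8), (1,4,9), (1,5,6), (1,5,7),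
   (1,5,8), (1,5,9), (1,6,7), (1,6,8), (1,6,9), (1,7,8), (1,7,9), (1,8,9),
   (2,3,4), (2,3,5), (2,3,6), (2,3,7), (2,3,8), (2,3,9), (2,4,5), (2,4,6),
   (2,4,7), (2,4,8), (2,4,9), (2,5,6), (2,5,7), (2,5,8), (2,5,9), (2,6,7),
   (2,6,8), (2,6,9), (2,7,8), (2,7,9), (2,8,9), (3,4,5), (3,4,6), (3,4,7),
   (3,4,8), (3,4,9), (3,5,6), (3,5,7), (3,5,8), (3,5,9), (3,6,7), (3,6,8),
   (3,6,9), (3,7,8), (3,7,9), (3,8,9), (4,5,6), (4,5,7), (4,5,8), (4,5,9),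
   (4,6,7), (4,6,8), (4,6,9), (4,7,8), (4,7,9), (4,8,9), (5,6,7), (5,6,8),
   (5,6,9), (5,7,8), (5,7,9), (5,8,9), (6,7,8), (6,7,9), (6,8,9), (7,8,9)]

/-- Bit test. -/
def bit (M n : ℕ) : Bool := Nat.beq (Nat.land (Nat.shiftRight M n) 1) 1

/-- The code of a triple: the characteristic bit mask of its vertex set. -/
def code (t : ℕ × ℕ × ℕ) : ℕ := Nat.add (Nat.add (Nat.pow 2 t.1) (Nat.pow 2 t.2.1)) (Nat.pow 2 t.2.2)

/-- The transposition of `i` and `j`. -/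
def sw (i j x : ℕ) : ℕ := cond (Nat.beq x i) j (cond (Nat.beq x j) i x)

/-- The transposition acting on triples. -/
def sw3 (i j : ℕ) (t : ℕ × ℕ × ℕ) : ℕ × ℕ × ℕ := (sw i j t.1, sw i j t.2.1, sw i j t.2.2)

/-- Is `x` a coordinate of `t`? -/
def inT (x : ℕ) (t : ℕ × ℕ × ℕ) : Bool := Nat.beq x t.1 || (Nat.beq x t.2.1 || Nat.beq x t.2.2)

/-- The number of coordinates of `s` that are coordinates of `t`. -/
def ic (s t : ℕ × ℕ × ℕ) : ℕ :=
  Nat.add (Nat.add (cond (inT s.1 t) 1 0) (cond (inT s.2.1 t) 1 0)) (cond (inT s.2.2 t) 1 0)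

/-- `e, f, g` form a loose path with middle edge `f`. -/
def isPm (e f g : ℕ × ℕ × ℕ) : Bool :=
  Nat.beq (ic e f) 1 && (Nat.beq (ic f g) 1 && Nat.beq (ic e g) 0)

/-- `e, f, g` form a loose path in some order. -/
def isP (e f g : ℕ × ℕ × ℕ) : Bool := isPm e f g || (isPm f e g || isPm e g f)

/-- The mask of a list of triples. -/
def mkMask : List (ℕ × ℕ × ℕ) → ℕ
  | [] => 0
  | t :: l => Nat.lor (Nat.pow 2 (code t)) (mkMask l)

/-- Filter a list, evaluating it completely before passing it on. -/
def filt (keep : ℕ × ℕ × ℕ → Bool) (k : List (ℕ × ℕ × ℕ) → Bool) :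
    List (ℕ × ℕ × ℕ) → List (ℕ × ℕ × ℕ) → Bool
  | [], acc => k acc
  | t :: l, acc => cond (keep t) (filt keep k l (t :: acc)) (filt keep k l acc)

/-- Evaluate a number before passing it on. -/
def force (n : ℕ) (k : ℕ → Bool) : Bool := Nat.rec (k 0) (fun m _ => k (Nat.succ m)) n

/-- Lookup in a list. -/
def look : List ℕ → ℕ → ℕ
  | [], _ => 0
  | a :: l, i => Nat.rec a (fun j _ => look l j) i

/-- Do the triples agree after applying `cls`, up to order? -/
def match6 (cls : ℕ → ℕ) (s t : ℕ × ℕ × ℕ) : Bool :=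
  let q (x y z : ℕ) := Nat.beq (cls s.1) (cls x) && (Nat.beq (cls s.2.1) (cls y) && Nat.beq (cls s.2.2) (cls z))
  q t.1 t.2.1 t.2.2 || (q t.1 t.2.2 t.2.1 || (q t.2.1 t.1 t.2.2 ||
    (q t.2.1 t.2.2 t.1 || (q t.2.2 t.1 t.2.1 || q t.2.2 t.2.1 t.1))))

/-- The transposition of `i` and `j` leaves the state unchanged (`m` is the mask of `L`). -/
def swOK (In L : List (ℕ × ℕ × ℕ)) (m i j : ℕ) : Bool :=
  In.all (fun t => In.any (fun t' => match6 (fun x => x) (sw3 i j t) t')) &&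
  L.all (fun t => bit m (code (sw3 i j t)))

/-- The digits `0,…,9`. -/
def D10 : List ℕ := [0,1,2,3,4,5,6,7,8,9]

/-- All transpositions inside a class of `cls` leave the state unchanged. -/
def clsOK (cls : List ℕ) (In L : List (ℕ × ℕ × ℕ)) (m : ℕ) : Bool :=
  D10.all (fun i => D10.all (fun j => !(Nat.blt i j && Nat.beq (look cls i) (look cls j)) || swOK In L m i j))

/-- Membership tests for the six target families. -/
def fam (k x y z : ℕ) : Bool :=
  match k with
  | 0 => inT 0 (x, y, z)
  | 1 => (Nat.blt x 6 && (Nat.blt y 6 && Nat.blt z 6)) || (Nat.ble 6 x && (Nat.ble 6 y && Nat.ble 6 z))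
  | 2 => Nat.beq (ic (0,1,2) (x,y,z)) 3 || (inT 3 (x,y,z) && Nat.ble 1 (ic (0,1,2) (x,y,z)))
  | 3 => Nat.ble 2 (ic (0,1,2) (x,y,z))
  | 4 => (Nat.blt x 5 && (Nat.blt y 5 && Nat.blt z 5)) || (Nat.ble 5 x && (Nat.ble 5 y && Nat.ble 5 z))
  | 5 => (Nat.blt x 4 && (Nat.blt y 4 && Nat.blt z 4)) ||
      (inT 0 (x,y,z) && Nat.beq (ic (1,2,3) (x,y,z)) 0)
  | _ => false

/-- The list of ten labels is a permutation of `0,…,9`. -/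
def permOK (p : List ℕ) : Bool :=
  D10.all (fun i => Nat.blt (look p i) 10 &&
    D10.all (fun j => Nat.beq i j || !(Nat.beq (look p i) (look p j))))

/-- The certificate checker; `L` is the list of triples which may still be edges. -/
def chk : CT → List (ℕ × ℕ × ℕ) → List (ℕ × ℕ × ℕ) → Bool
  | .cnt, _, L => Nat.ble L.length 18
  | .emb k p, _, L => permOK p &&
      L.all (fun t => fam k (look p t.1) (look p t.2.1) (look p t.2.2))
  | .br a b c cls l r, In, L =>
      ((Nat.blt a b && (Nat.blt b c && Nat.blt c 10)) && force (mkMask L) (clsOK cls In L)) &&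
      (filt (fun t => !(In.any (fun f => isP (a,b,c) f t))) (chk l ((a,b,c) :: In)) L [] &&
       filt (fun t => !(match6 (look cls) (a,b,c) t)) (chk r In) L [])

/-- The certificate. -/
def cert : CT :=
(.br 0 1 2 [0,0,0,0,0,0,0,0,0,0]
(.br 0 3 4 [0,0,0,3,3,3,3,3,3,3]
(.br 1 3 5 [0,1,1,3,3,5,5,5,5,5]
(.br 2 3 6 [0,1,2,3,4,5,6,6,6,6]
(.br 2 4 5 [0,1,2,3,4,5,6,7,8,9]
(.br 1 4 6 [0,1,2,3,4,5,6,7,8,9]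
.cnt .cnt) (.br 1 4 6 [0,1,2,3,4,5,6,7,8,9]
.cnt (.br 0 5 6 [0,1,2,3,4,5,6,7,8,9]
.cnt (.br 7 8 9 [0,1,2,3,4,5,6,7,7,7]
.cnt (.br 1 2 4 [0,1,2,3,4,5,6,7,8,9]
(.br 0 2 5 [0,1,2,3,4,5,6,7,8,9]
.cnt (.br 0 1 6 [0,1,2,3,4,5,6,7,8,9]
.cnt .cnt)) (.br 0 2 5 [0,1,2,3,4,5,6,7,8,9]
(.br 0 1 6 [0,1,2,3,4,5,6,7,8,9]
.cnt .cnt) (.br 2 3 7 [0,1,2,3,4,5,6,7,7,7]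
(.emb 2 [0,1,2,3,4,5,6,7,8,9]) (.br 2 3 4 [0,1,2,3,4,5,6,7,8,9]
(.emb 2 [0,1,2,3,4,5,6,7,8,9]) (.br 0 3 7 [0,1,2,3,4,5,6,7,7,7]
(.br 2 3 5 [0,1,2,3,4,5,6,7,8,9]
.cnt .cnt) .cnt))))))))) (.br 1 4 6 [0,1,2,3,4,5,6,6,6,6]
(.br 2 4 5 [0,1,2,3,4,5,6,7,8,9]
.cnt (.br 0 5 6 [0,1,2,3,4,5,6,7,8,9]
.cnt (.br 7 8 9 [0,1,2,3,4,5,6,7,7,7]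
.cnt (.br 2 3 4 [0,1,2,3,4,5,6,7,8,9]
(.br 0 4 5 [0,1,2,3,4,5,6,7,8,9]
.cnt (.br 0 3 6 [0,1,2,3,4,5,6,7,8,9]
.cnt .cnt)) (.br 0 4 5 [0,1,2,3,4,5,6,7,8,9]
(.br 0 3 6 [0,1,2,3,4,5,6,7,8,9]
.cnt .cnt) (.br 1 4 7 [0,1,2,3,4,5,6,7,7,7]
(.emb 2 [0,3,4,1,2,5,6,7,8,9]) (.br 1 2 4 [0,1,2,3,4,5,6,7,8,9]
(.emb 2 [0,3,4,1,2,5,6,7,8,9]) (.br 0 1 7 [0,1,2,3,4,5,6,7,7,7]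
(.br 1 4 5 [0,1,2,3,4,5,6,7,8,9]
.cnt .cnt) .cnt)))))))) (.br 0 5 6 [0,1,2,3,4,5,6,6,6,6]
(.br 2 4 5 [0,1,2,3,4,5,6,7,8,9]
.cnt (.br 7 8 9 [0,1,2,3,4,5,6,7,7,7]
.cnt (.br 2 3 5 [0,1,2,3,4,5,6,7,8,9]
(.br 1 4 5 [0,1,2,3,4,5,6,7,8,9]
.cnt (.br 1 3 6 [0,1,2,3,4,5,6,7,8,9]
.cnt .cnt)) (.br 1 4 5 [0,1,2,3,4,5,6,7,8,9]
(.br 1 3 6 [0,1,2,3,4,5,6,7,8,9]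
.cnt .cnt) (.br 0 5 7 [0,1,2,3,4,5,6,7,7,7]
(.emb 2 [3,0,4,1,5,2,6,7,8,9]) (.br 0 2 5 [0,1,2,3,4,5,6,7,8,9]
(.emb 2 [3,0,4,1,5,2,6,7,8,9]) (.br 0 1 7 [0,1,2,3,4,5,6,7,7,7]
(.br 0 4 5 [0,1,2,3,4,5,6,7,8,9]
.cnt .cnt) .cnt))))))) (.br 6 7 8 [0,1,2,3,4,5,6,6,6,6]
(.br 6 7 9 [0,1,2,3,4,5,6,6,6,9]
(.emb 1 [0,1,2,3,4,5,6,7,8,9]) (.br 2 4 5 [0,1,2,3,4,5,6,7,8,9]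
(.emb 1 [0,1,2,3,4,5,6,7,8,9]) (.br 0 1 9 [0,1,2,3,4,5,6,7,8,9]
(.br 3 4 5 [0,1,2,3,4,5,6,7,8,9]
.cnt .cnt) (.br 3 4 5 [0,1,2,3,4,5,6,7,8,9]
(.emb 1 [0,1,2,3,4,5,6,7,8,9]) (.br 0 3 9 [0,1,2,3,4,5,6,7,8,9]
.cnt (.br 1 3 9 [0,1,2,3,4,5,6,7,8,9]
.cnt (.emb 1 [0,1,2,3,4,5,6,7,8,9]))))))) (.br 0 1 6 [0,1,2,3,4,5,6,6,6,6]
(.br 3 4 5 [0,1,2,3,4,5,6,7,8,9]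
.cnt (.br 1 2 4 [0,1,2,3,4,5,6,7,8,9]
(.br 0 2 5 [0,1,2,3,4,5,6,7,8,9]
.cnt (.br 0 4 5 [0,1,2,3,4,5,6,7,8,9]
.cnt (.br 0 1 7 [0,1,2,3,4,5,6,7,7,7]
(.br 0 2 3 [0,1,2,3,4,5,6,7,8,9]
.cnt .cnt) .cnt))) (.br 0 2 5 [0,1,2,3,4,5,6,7,8,9]
(.br 1 4 5 [0,1,2,3,4,5,6,7,8,9]
.cnt (.br 0 1 7 [0,1,2,3,4,5,6,7,7,7]
(.br 1 2 3 [0,1,2,3,4,5,6,7,8,9]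
.cnt .cnt) .cnt)) (.br 0 4 5 [0,1,2,3,4,5,6,7,8,9]
(.br 1 4 5 [0,1,2,3,4,5,6,7,8,9]
.cnt .cnt) (.br 0 3 7 [0,1,2,3,4,5,6,7,7,7]
(.emb 3 [0,1,3,2,4,5,6,7,8,9]) (.br 0 2 3 [0,1,2,3,4,5,2,7,8,9]
(.emb 3 [0,1,3,2,4,5,6,7,8,9]) .cnt)))))) (.br 0 3 6 [0,1,2,3,4,5,6,6,6,6]
(.br 1 2 5 [0,1,2,3,4,5,6,7,8,9]
.cnt (.br 0 2 5 [0,1,2,3,4,5,6,7,8,9]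
.cnt (.br 0 4 5 [0,1,2,3,4,5,6,7,8,9]
.cnt (.br 0 3 7 [0,1,2,3,4,5,6,7,7,7]
(.br 0 1 4 [0,1,2,3,4,5,6,7,8,9]
(.br 2 3 4 [0,1,2,3,4,5,6,7,8,9]
.cnt .cnt) (.br 2 3 4 [0,1,2,3,4,5,6,7,8,9]
.cnt .cnt)) .cnt)))) (.br 1 3 6 [0,1,2,3,4,5,6,6,6,6]
(.br 0 2 4 [0,1,2,3,4,5,6,7,8,9]
.cnt .cnt) (.emb 1 [0,1,2,3,4,5,6,7,8,9])))))))) (.br 5 6 7 [0,1,2,3,4,5,5,5,5,5]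
(.br 5 6 8 [0,1,2,3,4,5,5,5,8,8]
(.br 5 7 9 [0,1,2,3,4,5,5,7,7,9]
(.br 0 1 3 [0,1,1,3,3,5,6,7,8,9]
(.emb 4 [0,1,2,3,4,5,6,7,8,9]) .cnt) (.br 0 1 3 [0,1,1,3,3,5,6,7,8,9]
(.br 0 5 6 [0,1,2,3,4,5,5,7,8,9]
.cnt (.br 5 6 9 [0,1,2,3,4,5,5,7,8,9]
.cnt (.br 7 8 9 [0,1,2,3,4,5,6,7,7,9]
.cnt (.emb 1 [0,1,2,3,4,6,7,8,9,5])))) (.br 1 2 5 [0,1,1,3,4,5,5,7,8,9]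
.cnt (.br 3 4 5 [0,1,2,3,3,5,5,7,8,9]
.cnt (.br 7 8 9 [0,1,2,3,4,5,6,7,7,9]
.cnt (.br 1 2 7 [0,1,1,3,4,5,6,7,7,9]
.cnt (.br 3 4 7 [0,1,2,3,3,5,6,7,7,9]
.cnt .cnt))))))) (.br 5 8 9 [0,1,2,3,4,5,5,5,8,8]
.cnt (.br 1 2 5 [0,1,1,3,4,5,5,5,8,9]
(.br 3 4 5 [0,1,2,3,3,5,6,7,8,9]
.cnt .cnt) (.br 3 4 5 [0,1,2,3,3,5,5,5,8,9]
.cnt (.br 0 8 9 [0,1,2,3,4,5,6,7,8,8]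
(.emb 5 [0,4,5,6,7,1,2,3,8,9]) (.br 0 5 6 [0,1,2,3,4,5,5,5,8,9]
(.br 1 2 8 [0,1,1,3,4,5,6,7,8,8]
.cnt (.br 3 4 8 [0,1,2,3,3,5,6,7,8,8]
.cnt .cnt)) (.br 0 1 8 [0,1,1,3,4,5,6,7,8,8]
(.br 3 4 9 [0,1,2,3,3,5,6,7,8,9]
.cnt (.br 0 3 9 [0,1,2,3,3,5,6,7,8,9]
.cnt (.br 0 2 9 [0,1,2,3,4,5,6,7,8,9]
.cnt .cnt))) (.br 0 3 8 [0,1,2,3,3,5,6,7,8,8]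
.cnt .cnt)))))))) (.br 0 5 6 [0,1,2,3,4,5,5,5,5,5]
(.br 0 1 3 [0,1,1,3,3,5,6,7,8,9]
(.emb 0 [0,1,2,3,4,5,6,7,8,9]) (.br 1 2 7 [0,1,1,3,4,5,6,7,7,7]
(.br 3 4 8 [0,1,2,3,3,5,6,7,8,8]
.cnt (.br 1 2 8 [0,1,1,3,4,5,6,7,8,8]
.cnt (.br 3 4 7 [0,1,2,3,3,5,6,7,8,9]
.cnt (.emb 5 [0,1,2,4,5,6,7,3,8,9])))) (.br 0 3 5 [0,1,2,3,3,5,5,7,8,9]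
(.emb 0 [0,1,2,3,4,5,6,7,8,9]) (.br 3 4 7 [0,1,2,3,3,5,6,7,7,7]
(.br 3 4 8 [0,1,2,3,3,5,6,7,8,8]
.cnt (.emb 5 [0,4,5,1,2,6,7,3,8,9])) (.emb 0 [0,1,2,3,4,5,6,7,8,9]))))) (.br 1 2 5 [0,1,1,3,4,5,5,5,5,5]
(.br 0 3 6 [0,1,2,3,3,5,6,6,6,6]
(.br 0 4 7 [0,1,2,3,4,5,6,7,7,7]
.cnt (.br 0 1 5 [0,1,1,3,4,5,6,7,8,9]
.cnt .cnt)) (.br 3 4 6 [0,1,2,3,3,5,6,6,6,6]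
.cnt (.br 0 1 5 [0,1,1,3,4,5,6,7,8,9]
.cnt .cnt))) (.br 3 4 5 [0,1,2,3,3,5,5,5,5,5]
(.br 0 1 6 [0,1,1,3,4,5,6,6,6,6]
(.br 0 2 7 [0,1,2,3,4,5,6,7,7,7]
.cnt (.br 0 3 5 [0,1,2,3,3,5,6,7,8,9]
.cnt .cnt)) (.br 0 3 5 [0,1,2,3,3,5,6,7,8,9]
.cnt .cnt)) (.br 0 1 5 [0,1,1,3,4,5,5,5,5,5]
(.br 0 3 6 [0,1,2,3,3,5,6,6,6,6]
(.br 1 2 3 [0,1,2,3,4,5,6,7,8,9]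
(.br 0 2 7 [0,1,2,3,4,5,6,7,7,7]
(.emb 2 [3,0,1,2,4,5,6,7,8,9]) (.br 1 3 4 [0,1,2,3,4,5,6,7,8,9]
.cnt (.emb 2 [3,0,1,2,4,5,6,7,8,9]))) (.br 0 2 7 [0,1,2,3,4,5,6,7,7,7]
(.emb 0 [0,1,2,3,4,5,6,7,8,9]) (.br 1 3 4 [0,1,2,3,4,5,6,7,8,9]
(.emb 2 [3,0,4,1,2,5,6,7,8,9]) (.emb 0 [0,1,2,3,4,5,6,7,8,9])))) (.br 0 2 6 [0,1,2,3,4,5,6,6,6,6]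
(.br 1 2 3 [0,1,2,3,3,5,6,7,8,9]
(.br 0 1 7 [0,1,2,3,4,5,6,7,7,7]
(.br 1 2 4 [0,1,2,3,4,5,6,7,8,9]
.cnt .cnt) .cnt) .cnt) .cnt)) (.br 0 3 5 [0,1,2,3,3,5,5,5,5,5]
(.br 0 4 6 [0,1,2,3,4,5,6,6,6,6]
.cnt .cnt) .cnt))))))) (.br 3 4 5 [0,1,2,3,3,3,3,3,3,3]
(.br 3 6 7 [0,1,2,3,3,3,6,6,6,6]
(.br 4 6 8 [0,1,2,3,4,4,6,6,8,8]
(.br 0 1 9 [0,0,0,3,4,5,6,7,8,9]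
(.emb 1 [6,7,8,0,1,2,3,4,5,9]) (.br 5 6 9 [0,1,2,3,4,5,6,7,8,9]
(.br 5 7 8 [0,1,2,3,4,5,6,7,8,9]
.cnt (.br 4 7 9 [0,1,2,3,4,5,6,7,8,9]
.cnt .cnt)) (.br 4 7 9 [0,1,2,3,4,5,6,7,8,9]
(.br 5 7 8 [0,1,2,3,4,5,6,7,8,9]
.cnt .cnt) (.br 3 8 9 [0,1,2,3,4,5,6,7,8,9]
.cnt (.br 5 7 8 [0,1,2,3,4,5,6,7,8,9]
(.emb 1 [6,7,8,0,1,2,3,4,5,9]) (.br 3 4 9 [0,1,2,3,4,5,6,7,8,9]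
(.br 6 7 8 [0,1,2,3,4,5,6,7,8,9]
.cnt .cnt) (.br 6 7 8 [0,1,2,3,4,5,6,7,8,9]
(.emb 1 [6,7,8,0,1,2,3,4,5,9]) (.br 3 6 9 [0,1,2,3,4,5,6,7,8,9]
.cnt (.br 4 6 9 [0,1,2,3,4,5,6,7,8,9]
.cnt (.emb 1 [6,7,8,0,1,2,3,4,5,9])))))))))) (.br 0 1 8 [0,0,0,3,4,5,6,7,8,8]
(.br 0 2 9 [0,0,2,3,4,5,6,7,8,9]
.cnt (.br 4 5 8 [0,1,2,3,4,4,6,7,8,9]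
.cnt (.br 6 7 8 [0,1,2,3,4,5,6,6,8,9]
.cnt (.br 0 1 3 [0,0,2,3,4,5,6,7,8,9]
.cnt (.br 3 4 9 [0,1,2,3,4,4,6,7,8,9]
(.emb 1 [6,7,8,0,1,2,3,4,9,5]) (.br 3 4 6 [0,1,2,3,4,4,6,6,8,9]
(.br 0 1 9 [0,0,2,3,4,5,6,7,8,9]
.cnt .cnt) .cnt)))))) (.br 3 8 9 [0,1,2,3,4,5,6,7,8,8]
(.emb 5 [1,2,3,0,4,5,6,7,8,9]) (.br 0 1 3 [0,0,0,3,4,5,6,7,8,9]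
(.br 4 5 8 [0,1,2,3,4,4,6,7,8,8]
.cnt (.br 6 7 8 [0,1,2,3,4,5,6,6,8,8]
.cnt .cnt)) (.br 3 4 8 [0,1,2,3,4,4,6,7,8,8]
(.br 6 7 9 [0,1,2,3,4,5,6,6,8,9]
.cnt (.br 3 6 9 [0,1,2,3,4,5,6,6,8,9]
.cnt (.br 3 5 9 [0,1,2,3,4,5,6,7,8,9]
.cnt .cnt))) (.br 3 6 8 [0,1,2,3,4,5,6,6,8,8]
.cnt .cnt)))))) (.br 0 1 3 [0,0,0,3,3,3,6,7,8,9]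
(.br 3 4 6 [0,1,2,3,4,4,6,6,6,6]
(.br 3 5 7 [0,1,2,3,4,5,6,7,7,7]
.cnt (.br 0 2 4 [0,0,2,3,4,5,6,7,8,9]
.cnt .cnt)) (.br 0 2 4 [0,0,2,3,4,4,6,7,8,9]
.cnt (.br 0 2 3 [0,0,2,3,4,5,6,7,8,9]
.cnt .cnt))) (.br 0 1 6 [0,0,0,3,4,5,6,6,6,6]
(.br 3 4 7 [0,1,2,3,3,3,6,7,7,7]
(.br 0 2 8 [0,0,2,3,4,5,6,7,8,8]
.cnt (.br 3 5 8 [0,1,2,3,3,5,6,7,8,8]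
.cnt .cnt)) (.br 0 2 7 [0,0,2,3,4,5,6,7,7,7]
.cnt .cnt)) .cnt))) (.emb 3 [0,1,2,3,4,5,6,7,8,9]))) .cnt)

set_option maxRecDepth 100000 in
theorem chk_cert : chk cert [] T120 = true := by
  decide +kernel

/-! ### Soundness of the checker -/

/-- The triple `t` of labels is an edge of `H` under the labelling `φ`. -/
def X (H : ThreeGraph) (φ : ℕ → ℕ) (t : ℕ × ℕ × ℕ) : Prop :=
  ({φ t.1, φ t.2.1, φ t.2.2} : Finset ℕ) ∈ H.edges

/-- `φ` labels the vertices of `H` by `0,…,9`. -/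
structure Lab (H : ThreeGraph) (φ : ℕ → ℕ) : Prop where
  inj : ∀ x < 10, ∀ y < 10, φ x = φ y → x = y
  img : (Finset.range 10).image φ = H.verts

/-- The search state is consistent with `H` under the labelling `φ`. -/
structure Inv (H : ThreeGraph) (φ : ℕ → ℕ) (In L : List (ℕ × ℕ × ℕ)) : Prop where
  lab : Lab H φ
  insT : ∀ t ∈ In, t ∈ T120
  ins : ∀ t ∈ In, X H φ t
  sub : ∀ t ∈ L, t ∈ T120
  cd : ∀ t ∈ T120, X H φ t → t ∈ L

/-- The conclusion of the search. -/
def Concl (H : ThreeGraph) : Prop :=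
  H.edges.card ≤ 18 ∨ (∃ G ∈ L10, G.ContainsCopy H) ∨ (comet 10).ContainsCopy H

theorem mem_D10 {i : ℕ} (h : i < 10) : i ∈ D10 := by
  have : ∀ i < 10, i ∈ D10 := by decide
  exact this i h

theorem mem_T120 (a b c : ℕ) : (a, b, c) ∈ T120 ↔ a < b ∧ b < c ∧ c < 10 := by
  constructor
  · have h : ∀ t ∈ T120, t.1 < t.2.1 ∧ t.2.1 < t.2.2 ∧ t.2.2 < 10 := by decide +kernel
    exact fun hm => h _ hm
  · have h : ∀ c ∈ D10, ∀ b ∈ D10, ∀ a ∈ D10, a < b → b < c → (a, b, c) ∈ T120 := by decide +kernel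
    rintro ⟨h1, h2, h3⟩
    exact h c (mem_D10 h3) b (mem_D10 (by omega)) a (mem_D10 (by omega)) h1 h2

theorem code_inj {s t : ℕ × ℕ × ℕ} (hs : s ∈ T120) (ht : t ∈ T120) (h : code s = code t) : s = t := by
  have hn : (T120.map code).Nodup := by decide +kernel
  exact List.inj_on_of_nodup_map hn hs ht h

theorem X_perm1 {H φ} {a b c : ℕ} : X H φ (a, b, c) ↔ X H φ (b, a, c) := by
  unfold X
  have : ({φ a, φ b, φ c} : Finset ℕ) = {φ b, φ a, φ c} := by ext; simp; tauto
  simp only [this]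

theorem X_perm2 {H φ} {a b c : ℕ} : X H φ (a, b, c) ↔ X H φ (a, c, b) := by
  unfold X
  have : ({φ a, φ b, φ c} : Finset ℕ) = {φ a, φ c, φ b} := by ext; simp; tauto
  simp only [this]

theorem code_perm1 {a b c : ℕ} : code (a, b, c) = code (b, a, c) := by
  simp only [code, Nat.add_eq]; omega

theorem code_perm2 {a b c : ℕ} : code (a, b, c) = code (a, c, b) := by
  simp only [code, Nat.add_eq]; omega

/-- Sort a triple. -/
theorem sort3 {a b c : ℕ} (ha : a < 10) (hb : b < 10) (hc : c < 10) (hab : a ≠ b) (hac : a ≠ c)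
    (hbc : b ≠ c) : ∃ t ∈ T120, (∀ H φ, X H φ t ↔ X H φ (a, b, c)) ∧
      (∀ i j, code (sw3 i j t) = code (sw3 i j (a, b, c))) ∧ code t = code (a, b, c) ∧
      (∀ f : ℕ → ℕ, ({f t.1, f t.2.1, f t.2.2} : Finset ℕ) = {f a, f b, f c}) := by
  have key : ∀ x y z : ℕ, x < y → y < z → z < 10 →
      ((x, y, z) = (a, b, c) ∨ (x, y, z) = (a, c, b) ∨ (x, y, z) = (b, a, c) ∨
        (x, y, z) = (b, c, a) ∨ (x, y, z) = (c, a, b) ∨ (x, y, z) = (c, b, a)) →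
      ∃ t ∈ T120, (∀ H φ, X H φ t ↔ X H φ (a, b, c)) ∧
      (∀ i j, code (sw3 i j t) = code (sw3 i j (a, b, c))) ∧ code t = code (a, b, c) ∧
      (∀ f : ℕ → ℕ, ({f t.1, f t.2.1, f t.2.2} : Finset ℕ) = {f a, f b, f c}) := by
    intro x y z h1 h2 h3 h
    refine ⟨(x, y, z), (mem_T120 _ _ _).2 ⟨h1, h2, h3⟩, ?_⟩
    have hset : ∀ f : ℕ → ℕ, ({f x, f y, f z} : Finset ℕ) = {f a, f b, f c} := by
      intro f
      rcases h with h | h | h | h | h | h <;> (cases h; ext; simp; try tauto)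
    refine ⟨fun H φ => ?_, fun i j => ?_, ?_, hset⟩
    · unfold X; simp only [hset φ]
    · rcases h with h | h | h | h | h | h <;> (cases h; simp only [code, sw3, Nat.add_eq]; try omega)
    · rcases h with h | h | h | h | h | h <;> (cases h; simp only [code, Nat.add_eq]; try omega)
  rcases lt_or_gt_of_ne hab with h1 | h1 <;> rcases lt_or_gt_of_ne hac with h2 | h2 <;>
    rcases lt_or_gt_of_ne hbc with h3 | h3
  · exact key a b c (by omega) (by omega) (by omega) (by simp)
  · exact key a c b (by omega) (by omega) (by omega) (by simp)
  · omega
  · exact key c a b (by omega) (by omega) (by omega) (by simp)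
  · exact key b a c (by omega) (by omega) (by omega) (by simp)
  · omega
  · exact key b c a (by omega) (by omega) (by omega) (by simp)
  · exact key c b a (by omega) (by omega) (by omega) (by simp)

theorem bit_iff (M n : ℕ) : bit M n = true ↔ M.testBit n = true := by
  unfold bit Nat.testBit
  rw [Nat.beq_eq]
  change Nat.land (M >>> n) 1 = 1 ↔ _
  have : Nat.land (M >>> n) 1 = (M >>> n) % 2 := Nat.and_one_is_mod _
  rw [this]
  have h2 : 1 &&& (M >>> n) = (M >>> n) % 2 := by rw [Nat.and_comm]; exact Nat.and_one_is_mod _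
  rw [h2]
  simp

theorem bit_mk {L : List (ℕ × ℕ × ℕ)} {n : ℕ} (h : bit (mkMask L) n = true) : ∃ t ∈ L, code t = n := by
  rw [bit_iff] at h
  induction L with
  | nil => simp [mkMask] at h
  | cons t l ih =>
    have h' : ((2 ^ code t) ||| mkMask l).testBit n = true := h
    rw [Nat.testBit_or, Bool.or_eq_true, Nat.testBit_two_pow] at h'
    rcases h' with h' | h'
    · exact ⟨t, by simp, by simpa using h'⟩
    · obtain ⟨u, hu, hc⟩ := ih h'
      exact ⟨u, by simp [hu], hc⟩

theorem sw_eq (i j x : ℕ) : sw i j x = if x = i then j else if x = j then i else x := by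
  unfold sw
  rcases h1 : Nat.beq x i with _ | _ <;> rcases h2 : Nat.beq x j with _ | _ <;>
    simp_all [Nat.beq_eq, ← Bool.not_eq_true]

theorem sw_sw (i j x : ℕ) : sw i j (sw i j x) = x := by
  simp only [sw_eq]; split_ifs <;> omega

theorem sw_lt {i j x : ℕ} (hi : i < 10) (hj : j < 10) (hx : x < 10) : sw i j x < 10 := by
  simp only [sw_eq]; split_ifs <;> omega

theorem sw_inj {i j x y : ℕ} (h : sw i j x = sw i j y) : x = y := by
  rw [← sw_sw i j x, h, sw_sw]

theorem sw_comm (i j x : ℕ) : sw i j x = sw j i x := by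
  simp only [sw_eq]; split_ifs <;> omega

theorem Lab.sw {H φ} (h : Lab H φ) {i j : ℕ} (hi : i < 10) (hj : j < 10) :
    Lab H (fun x => φ (sw i j x)) := by
  refine ⟨fun x hx y hy e => sw_inj (h.inj _ (sw_lt hi hj hx) _ (sw_lt hi hj hy) e), ?_⟩
  rw [← h.img]
  ext v
  simp only [Finset.mem_image, Finset.mem_range]
  constructor
  · rintro ⟨x, hx, rfl⟩; exact ⟨_, sw_lt hi hj hx, rfl⟩
  · rintro ⟨x, hx, rfl⟩; exact ⟨Fifth.sw i j x, sw_lt hi hj hx, by rw [sw_sw]⟩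

theorem match6_spec {cls : ℕ → ℕ} {a b c x y z : ℕ} (h : match6 cls (a, b, c) (x, y, z) = true) :
    ∃ x' y' z', (∀ H φ, X H φ (x, y, z) ↔ X H φ (x', y', z')) ∧
      cls a = cls x' ∧ cls b = cls y' ∧ cls c = cls z' ∧
      ((x', y', z') = (x, y, z) ∨ (x', y', z') = (x, z, y) ∨ (x', y', z') = (y, x, z) ∨
        (x', y', z') = (y, z, x) ∨ (x', y', z') = (z, x, y) ∨ (x', y', z') = (z, y, x)) := by
  simp only [match6, Bool.or_eq_true, Bool.and_eq_true, Nat.beq_eq] at h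
  have hX : ∀ x' y' z', ((x', y', z') = (x, y, z) ∨ (x', y', z') = (x, z, y) ∨ (x', y', z') = (y, x, z) ∨
        (x', y', z') = (y, z, x) ∨ (x', y', z') = (z, x, y) ∨ (x', y', z') = (z, y, x)) →
      ∀ H φ, X H φ (x, y, z) ↔ X H φ (x', y', z') := by
    intro x' y' z' hh H φ
    have : ({φ x, φ y, φ z} : Finset ℕ) = {φ x', φ y', φ z'} := by
      rcases hh with hh | hh | hh | hh | hh | hh <;> (cases hh; ext; simp; try tauto)
    unfold X; simp only [this]
  rcases h with h | h | h | h | h | h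
  · exact ⟨x, y, z, hX _ _ _ (by simp), h.1, h.2.1, h.2.2, by simp⟩
  · exact ⟨x, z, y, hX _ _ _ (by simp), h.1, h.2.1, h.2.2, by simp⟩
  · exact ⟨y, x, z, hX _ _ _ (by simp), h.1, h.2.1, h.2.2, by simp⟩
  · exact ⟨y, z, x, hX _ _ _ (by simp), h.1, h.2.1, h.2.2, by simp⟩
  · exact ⟨z, x, y, hX _ _ _ (by simp), h.1, h.2.1, h.2.2, by simp⟩
  · exact ⟨z, y, x, hX _ _ _ (by simp), h.1, h.2.1, h.2.2, by simp⟩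

theorem Inv.sw {H φ In L} (h : Inv H φ In L) {i j : ℕ} (hi : i < 10) (hj : j < 10)
    (hok : swOK In L (mkMask L) i j = true) : Inv H (fun x => φ (sw i j x)) In L := by
  simp only [swOK, Bool.and_eq_true, List.all_eq_true, List.any_eq_true] at hok
  refine ⟨h.lab.sw hi hj, h.insT, ?_, h.sub, ?_⟩
  · intro t ht
    obtain ⟨⟨x, y, z⟩, ht', hm⟩ := hok.1 t ht
    obtain ⟨x', y', z', hX, h1, h2, h3, -⟩ := match6_spec hm
    have := (hX H φ).1 (h.ins _ ht')
    rw [← h1, ← h2, ← h3] at this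
    exact this
  · rintro ⟨a, b, c⟩ ht hx
    obtain ⟨h1, h2, h3⟩ := (mem_T120 _ _ _).1 ht
    have hx' : X H φ (Fifth.sw i j a, Fifth.sw i j b, Fifth.sw i j c) := hx
    obtain ⟨t', ht', hX, hc, -, -⟩ := sort3 (sw_lt hi hj (by omega : a < 10)) (sw_lt hi hj (by omega : b < 10))
      (sw_lt hi hj h3) (fun e => by have := sw_inj e; omega) (fun e => by have := sw_inj e; omega)
      (fun e => by have := sw_inj e; omega)
    have hL := h.cd t' ht' ((hX H φ).2 hx')
    obtain ⟨u, hu, hcu⟩ := bit_mk (hok.2 t' hL)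
    have : code (sw3 i j t') = code (a, b, c) := by
      rw [hc]; simp only [sw3, sw_sw]
    have := code_inj (h.sub u hu) ht (hcu.trans this)
    exact this ▸ hu

theorem force_eq (n : ℕ) (k : ℕ → Bool) : force n k = k n := by
  cases n <;> rfl

theorem filt_eq (keep : ℕ × ℕ × ℕ → Bool) (k : List (ℕ × ℕ × ℕ) → Bool) (L acc : List (ℕ × ℕ × ℕ)) :
    filt keep k L acc = k ((L.filter keep).reverse ++ acc) := by
  induction L generalizing acc with
  | nil => rfl
  | cons t l ih =>
    rw [filt]
    cases h : keep t <;> simp [ih, h]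

theorem clsOK_sw {cls In L m} (h : clsOK cls In L m = true) {i j : ℕ} (hi : i < 10) (hj : j < 10)
    (hlt : i < j) (hc : look cls i = look cls j) : swOK In L m i j = true := by
  simp only [clsOK, List.all_eq_true] at h
  have := h i (mem_D10 hi) j (mem_D10 hj)
  have h1 : Nat.blt i j = true := by simp [Nat.blt_eq, hlt]
  have h2 : Nat.beq (look cls i) (look cls j) = true := by simp [hc]
  simpa [h1, h2] using this

theorem Inv.cls {H φ In L cls} (h : Inv H φ In L) (hok : clsOK cls In L (mkMask L) = true) {i j : ℕ}
    (hi : i < 10) (hj : j < 10) (hc : look cls i = look cls j) :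
    Inv H (fun x => φ (Fifth.sw i j x)) In L := by
  rcases lt_trichotomy i j with hl | hl | hl
  · exact h.sw hi hj (clsOK_sw hok hi hj hl hc)
  · subst hl
    have : (fun x => φ (Fifth.sw i i x)) = φ := by
      funext x; simp only [sw_eq]; split_ifs with h <;> simp [h]
    rwa [this]
  · have := h.sw hj hi (clsOK_sw hok hj hi hl hc.symm)
    have he : (fun x => φ (Fifth.sw i j x)) = fun x => φ (Fifth.sw j i x) := by
      funext x; rw [sw_comm]
    rwa [he]

theorem cls_sw {cls : List ℕ} {i j : ℕ} (hc : look cls i = look cls j) (x : ℕ) :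
    look cls (sw i j x) = look cls x := by
  simp only [sw_eq]; split_ifs with h1 h2
  · rw [h1, hc]
  · rw [h2, hc]
  · rfl

/-- Orbit argument: if some triple in the orbit of `(a,b,c)` is an edge, we can relabel so that
`(a,b,c)` is an edge. -/
theorem orbit {H φ In L cls} (h : Inv H φ In L) (hok : clsOK cls In L (mkMask L) = true) {a b c x y z : ℕ}
    (ha : a < 10) (hb : b < 10) (hc : c < 10) (hab : a ≠ b) (hac : a ≠ c) (hbc : b ≠ c)
    (hx : x < 10) (hy : y < 10) (hz : z < 10) (hxy : x ≠ y) (hxz : x ≠ z) (hyz : y ≠ z)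
    (h1 : look cls a = look cls x) (h2 : look cls b = look cls y) (h3 : look cls c = look cls z)
    (hX : X H φ (x, y, z)) : ∃ ψ, Inv H ψ In L ∧ X H ψ (a, b, c) := by
  -- first move `x` to `a`
  obtain ⟨φ1, y1, z1, i1, hy1, hz1, hay1, haz1, hyz1, e2, e3, X1⟩ : ∃ φ1 y1 z1, Inv H φ1 In L ∧
      y1 < 10 ∧ z1 < 10 ∧ a ≠ y1 ∧ a ≠ z1 ∧ y1 ≠ z1 ∧ look cls b = look cls y1 ∧
      look cls c = look cls z1 ∧ X H φ1 (a, y1, z1) := by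
    have hs : sw a x x = a := by simp only [sw_eq]; split_ifs <;> omega
    refine ⟨_, sw a x y, sw a x z, h.cls hok ha hx h1, sw_lt ha hx hy, sw_lt ha hx hz, ?_, ?_, ?_,
      by rw [cls_sw h1, h2], by rw [cls_sw h1, h3], ?_⟩
    · intro e; exact hxy (sw_inj (hs.trans e))
    · intro e; exact hxz (sw_inj (hs.trans e))
    · intro e; exact hyz (sw_inj e)
    · have : sw a x a = x := by simp [sw_eq]
      simpa only [X, sw_sw, this] using hX
  obtain ⟨φ2, z2, i2, hz2, haz2, hbz2, e4, X2⟩ : ∃ φ2 z2, Inv H φ2 In L ∧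
      z2 < 10 ∧ a ≠ z2 ∧ b ≠ z2 ∧ look cls c = look cls z2 ∧ X H φ2 (a, b, z2) := by
    have hs : sw b y1 y1 = b := by simp only [sw_eq]; split_ifs <;> omega
    have hs2 : sw b y1 a = a := by simp only [sw_eq]; split_ifs <;> omega
    refine ⟨_, sw b y1 z1, i1.cls hok hb hy1 e2, sw_lt hb hy1 hz1, ?_, ?_,
      by rw [cls_sw e2, e3], ?_⟩
    · intro e; exact haz1 (sw_inj (hs2.trans e))
    · intro e; exact hyz1 (sw_inj (hs.trans e))
    · have : sw b y1 b = y1 := by simp [sw_eq]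
      simpa only [X, sw_sw, this, hs2] using X1
  have hs1 : sw c z2 a = a := by simp only [sw_eq]; split_ifs <;> omega
  have hs2 : sw c z2 b = b := by simp only [sw_eq]; split_ifs <;> omega
  have hs3 : sw c z2 c = z2 := by simp [sw_eq]
  refine ⟨_, i2.cls hok hc hz2 e4, ?_⟩
  simpa only [X, hs1, hs2, hs3] using X2

theorem inT_iff (x : ℕ) (t : ℕ × ℕ × ℕ) : inT x t = true ↔ x ∈ ({t.1, t.2.1, t.2.2} : Finset ℕ) := by
  simp only [inT, Bool.or_eq_true, Nat.beq_eq, Finset.mem_insert, Finset.mem_singleton]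

theorem ic_card {a b c : ℕ} (hab : a ≠ b) (hac : a ≠ c) (hbc : b ≠ c) (t : ℕ × ℕ × ℕ) :
    ic (a, b, c) t = (({a, b, c} : Finset ℕ) ∩ {t.1, t.2.1, t.2.2}).card := by
  have hcond : ∀ x, cond (inT x t) 1 0 = if x ∈ ({t.1, t.2.1, t.2.2} : Finset ℕ) then 1 else 0 := by
    intro x
    by_cases h : x ∈ ({t.1, t.2.1, t.2.2} : Finset ℕ)
    · rw [(inT_iff x t).2 h, if_pos h]; rfl
    · have : inT x t = false := by rw [← Bool.not_eq_true, inT_iff]; exact h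
      rw [this, if_neg h]; rfl
  rw [← Finset.filter_mem_eq_inter, Finset.card_filter, Finset.sum_insert (by simp [hab, hac]),
    Finset.sum_insert (by simp [hbc]), Finset.sum_singleton]
  simp only [ic, hcond, Nat.add_eq]
  omega

/-- A configuration of three edges giving a loose path. -/
theorem path_of {H : ThreeGraph} (hv : H.IsValid) {A B C : Finset ℕ} (hA : A ∈ H.edges)
    (hB : B ∈ H.edges) (hC : C ∈ H.edges) (hAB : (A ∩ B).card = 1) (hBC : (B ∩ C).card = 1)
    (hAC : (A ∩ C).card = 0) : H.ContainsCopy pathP := by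
  obtain ⟨c, hc⟩ := Finset.card_eq_one.1 hAB
  obtain ⟨e, he⟩ := Finset.card_eq_one.1 hBC
  have hAC' := Finset.card_eq_zero.1 hAC
  have hcm : c ∈ A ∩ B := by simp [hc]
  have hem : e ∈ B ∩ C := by simp [he]
  rw [Finset.mem_inter] at hcm hem
  have dAC : ∀ x, x ∈ A → x ∈ C → False := by
    intro x h1 h2
    have : x ∈ A ∩ C := Finset.mem_inter.2 ⟨h1, h2⟩
    simp [hAC'] at this
  have dAB : ∀ x, x ∈ A → x ∈ B → x = c := by
    intro x h1 h2
    have : x ∈ A ∩ B := Finset.mem_inter.2 ⟨h1, h2⟩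
    simpa [hc] using this
  have dBC : ∀ x, x ∈ B → x ∈ C → x = e := by
    intro x h1 h2
    have : x ∈ B ∩ C := Finset.mem_inter.2 ⟨h1, h2⟩
    simpa [he] using this
  have hce : c ≠ e := fun h => dAC c hcm.1 (h ▸ hem.2)
  have cA : (A.erase c).card = 2 := by rw [Finset.card_erase_of_mem hcm.1, (hv A hA).1]
  have cC : (C.erase e).card = 2 := by rw [Finset.card_erase_of_mem hem.2, (hv C hC).1]
  have cB : ((B.erase c).erase e).card = 1 := by
    rw [Finset.card_erase_of_mem (Finset.mem_erase.2 ⟨hce.symm, hem.1⟩),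
      Finset.card_erase_of_mem hcm.2, (hv B hB).1]
  obtain ⟨a, b, hab, eA⟩ := Finset.card_eq_two.1 cA
  obtain ⟨f, g, hfg, eC⟩ := Finset.card_eq_two.1 cC
  obtain ⟨d, eB⟩ := Finset.card_eq_one.1 cB
  have hA' : A = {a, b, c} := by
    rw [← Finset.insert_erase hcm.1, eA]; ext; simp; tauto
  have hB' : B = {c, d, e} := by
    rw [← Finset.insert_erase hcm.2, ← Finset.insert_erase (Finset.mem_erase.2 ⟨hce.symm, hem.1⟩), eB]
    ext; simp; tauto
  have hC' : C = {e, f, g} := by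
    rw [← Finset.insert_erase hem.2, eC]
  have ma : a ∈ A.erase c := by simp [eA]
  have mb : b ∈ A.erase c := by simp [eA]
  have mf : f ∈ C.erase e := by simp [eC]
  have mg : g ∈ C.erase e := by simp [eC]
  have md : d ∈ (B.erase c).erase e := by simp [eB]
  simp only [Finset.mem_erase] at ma mb mf mg md
  have nd : [a, b, c, d, e, f, g].Nodup := by
    have h1 : a ≠ d := fun h => md.2.1 (dAB d (h ▸ ma.2) md.2.2)
    have h2 : b ≠ d := fun h => md.2.1 (dAB d (h ▸ mb.2) md.2.2)
    have h3 : a ≠ e := fun h => dAC a ma.2 (h ▸ hem.2)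
    have h4 : b ≠ e := fun h => dAC b mb.2 (h ▸ hem.2)
    have h5 : a ≠ f := fun h => dAC a ma.2 (h ▸ mf.2)
    have h6 : b ≠ f := fun h => dAC b mb.2 (h ▸ mf.2)
    have h7 : a ≠ g := fun h => dAC a ma.2 (h ▸ mg.2)
    have h8 : b ≠ g := fun h => dAC b mb.2 (h ▸ mg.2)
    have h9 : c ≠ f := fun h => dAC c hcm.1 (h ▸ mf.2)
    have h10 : c ≠ g := fun h => dAC c hcm.1 (h ▸ mg.2)
    have h11 : d ≠ f := fun h => md.1 (dBC d md.2.2 (h ▸ mf.2))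
    have h12 : d ≠ g := fun h => md.1 (dBC d md.2.2 (h ▸ mg.2))
    simp [hab, hfg, hce, h1, h2, h3, h4, h5, h6, h7, h8, h9, h10, h11, h12, ma.1, mb.1,
      md.1, Ne.symm md.2.1, Ne.symm mf.1, Ne.symm mg.1]
  have inV : ∀ x, x ∈ A ∨ x ∈ B ∨ x ∈ C → x ∈ H.verts := by
    rintro x (h | h | h)
    · exact (hv A hA).2 h
    · exact (hv B hB).2 h
    · exact (hv C hC).2 h
  refine ⟨fun n => [a, b, c, d, e, f, g].getD n 0, ?_, ?_, ?_⟩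
  · intro x hx y hy hxy
    have hx7 : x < 7 := by simp [pathP] at hx; omega
    have hy7 : y < 7 := by simp [pathP] at hy; omega
    simp only at hxy
    rw [List.getD_eq_getElem _ _ (by simpa using hx7), List.getD_eq_getElem _ _ (by simpa using hy7)] at hxy
    exact (List.Nodup.getElem_inj_iff nd).1 hxy
  · intro x hx
    apply inV
    simp only [pathP, Finset.mem_insert, Finset.mem_singleton] at hx
    rcases hx with rfl | rfl | rfl | rfl | rfl | rfl | rfl <;> simp [ma.2, mb.2, hcm, md.2.2, hem, mf.2, mg.2]
  · intro E hE
    simp only [pathP, Finset.mem_insert, Finset.mem_singleton] at hE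
    rcases hE with rfl | rfl | rfl
    · simpa [Finset.image_insert, ← hA'] using hA
    · simpa [Finset.image_insert, ← hB'] using hB
    · simpa [Finset.image_insert, ← hC'] using hC

/-- The set of labels of a triple. -/
def st (t : ℕ × ℕ × ℕ) : Finset ℕ := {t.1, t.2.1, t.2.2}

theorem st_sub {t : ℕ × ℕ × ℕ} (h : t ∈ T120) : ∀ x ∈ st t, x < 10 := by
  obtain ⟨a, b, c⟩ := t
  obtain ⟨h1, h2, h3⟩ := (mem_T120 _ _ _).1 h
  intro x hx
  simp only [st, Finset.mem_insert, Finset.mem_singleton] at hx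
  omega

theorem X_iff {H φ t} : X H φ t ↔ (st t).image φ ∈ H.edges := by
  simp [X, st, Finset.image_insert]

theorem ic_eq {s t : ℕ × ℕ × ℕ} (hs : s ∈ T120) : ic s t = (st s ∩ st t).card := by
  obtain ⟨a, b, c⟩ := s
  obtain ⟨h1, h2, h3⟩ := (mem_T120 _ _ _).1 hs
  exact ic_card (by omega) (by omega) (by omega) t

theorem card_img {H φ} (hl : Lab H φ) {s t : ℕ × ℕ × ℕ} (hs : s ∈ T120) (ht : t ∈ T120) :
    ((st s).image φ ∩ (st t).image φ).card = ic s t := by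
  have hi : Set.InjOn φ ↑(st s ∪ st t) := by
    intro x hx y hy e
    simp only [Finset.coe_union, Set.mem_union, Finset.mem_coe] at hx hy
    refine hl.inj x ?_ y ?_ e
    · exact hx.elim (st_sub hs x) (st_sub ht x)
    · exact hy.elim (st_sub hs y) (st_sub ht y)
  rw [← Finset.image_inter_of_injOn _ _ (by simpa using hi), Finset.card_image_of_injOn, ic_eq hs]
  exact hi.mono (by intro x hx; simp at hx ⊢; exact Or.inl hx.1)

theorem isPm_false {H φ} (hv : H.IsValid) (hf : H.Free pathP) (hl : Lab H φ) {e f g : ℕ × ℕ × ℕ}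
    (he : e ∈ T120) (hf' : f ∈ T120) (hg : g ∈ T120) (Xe : X H φ e) (Xf : X H φ f) (Xg : X H φ g) :
    isPm e f g = false := by
  rw [← Bool.not_eq_true]
  intro h
  simp only [isPm, Bool.and_eq_true, Nat.beq_eq] at h
  refine hf (path_of hv (X_iff.1 Xe) (X_iff.1 Xf) (X_iff.1 Xg) ?_ ?_ ?_)
  · rw [card_img hl he hf', h.1]
  · rw [card_img hl hf' hg, h.2.1]
  · rw [card_img hl he hg, h.2.2]

theorem isP_false {H φ} (hv : H.IsValid) (hf : H.Free pathP) (hl : Lab H φ) {e f g : ℕ × ℕ × ℕ}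
    (he : e ∈ T120) (hf' : f ∈ T120) (hg : g ∈ T120) (Xe : X H φ e) (Xf : X H φ f) (Xg : X H φ g) :
    isP e f g = false := by
  simp only [isP, isPm_false hv hf hl he hf' hg Xe Xf Xg, isPm_false hv hf hl hf' he hg Xf Xe Xg,
    isPm_false hv hf hl he hg hf' Xe Xg Xf, Bool.or_false]

/-- Every edge comes from a triple. -/
theorem edge_triple {H φ} (hv : H.IsValid) (hl : Lab H φ) {E : Finset ℕ} (hE : E ∈ H.edges) :
    ∃ t ∈ T120, E = (st t).image φ := by
  obtain ⟨hc, hs⟩ := hv E hE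
  rw [← hl.img, Finset.subset_image_iff] at hs
  obtain ⟨S, hS, rfl⟩ := hs
  have hS' : ∀ x ∈ S, x < 10 := fun x hx => by simpa using hS hx
  have hcS : S.card = 3 := by
    rw [← hc]
    exact (Finset.card_image_of_injOn (fun x hx y hy e => hl.inj x (hS' x hx) y (hS' y hy) e)).symm
  obtain ⟨a, b, c, hab, hac, hbc, rfl⟩ := Finset.card_eq_three.1 hcS
  obtain ⟨t, ht, -, -, -, hset⟩ := sort3 (hS' a (by simp)) (hS' b (by simp)) (hS' c (by simp)) hab hac hbc
  refine ⟨t, ht, ?_⟩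
  have := hset (fun x => x)
  unfold st
  rw [this]

theorem card_le {H φ In L} (hv : H.IsValid) (h : Inv H φ In L) : H.edges.card ≤ L.length := by
  have : H.edges ⊆ (L.map (fun t => (st t).image φ)).toFinset := by
    intro E hE
    obtain ⟨t, ht, rfl⟩ := edge_triple hv h.lab hE
    simp only [List.mem_toFinset, List.mem_map]
    exact ⟨t, h.cd t ht (X_iff.2 hE), rfl⟩
  refine (Finset.card_le_card this).trans ((List.toFinset_card_le _).trans ?_)
  simp

/-- The six target graphs. -/
def tgt (k : ℕ) : ThreeGraph :=
  match k with
  | 0 => SS 10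
  | 1 => (KK 6).dUnion (KK 4)
  | 2 => G1 10
  | 3 => G2 10
  | 4 => (KK 5).dUnion (KK 5)
  | _ => comet 10

theorem dU_edges (m n : ℕ) (hm : (Finset.range m).sup id + 1 = m) (E : Finset ℕ) :
    E ∈ ((KK m).dUnion (KK n)).edges ↔ (E ⊆ Finset.range m ∧ E.card = 3) ∨
      ∃ F : Finset ℕ, (F ⊆ Finset.range n ∧ F.card = 3) ∧ F.image (· + m) = E := by
  simp only [ThreeGraph.dUnion, KK, ThreeGraph.shiftBy, hm, Finset.mem_union, Finset.mem_powersetCard,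
    Finset.mem_image]

theorem dU_mem {m n x y z : ℕ} (hm : (Finset.range m).sup id + 1 = m) (hx : x < m + n) (hy : y < m + n)
    (hz : z < m + n) (hxy : x ≠ y) (hxz : x ≠ z) (hyz : y ≠ z)
    (h : (x < m ∧ y < m ∧ z < m) ∨ (m ≤ x ∧ m ≤ y ∧ m ≤ z)) :
    ({x, y, z} : Finset ℕ) ∈ ((KK m).dUnion (KK n)).edges := by
  rw [dU_edges m n hm]
  rcases h with ⟨h1, h2, h3⟩ | ⟨h1, h2, h3⟩
  · left
    refine ⟨?_, Finset.card_eq_three.2 ⟨x, y, z, hxy, hxz, hyz, rfl⟩⟩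
    intro w hw
    simp only [Finset.mem_insert, Finset.mem_singleton] at hw
    rw [Finset.mem_range]; omega
  · right
    refine ⟨{x - m, y - m, z - m}, ⟨?_, Finset.card_eq_three.2 ⟨x - m, y - m, z - m, by omega, by omega, by omega, rfl⟩⟩, ?_⟩
    · intro w hw
      simp only [Finset.mem_insert, Finset.mem_singleton] at hw
      rw [Finset.mem_range]; omega
    · simp only [Finset.image_insert, Finset.image_singleton]
      rw [Nat.sub_add_cancel h1, Nat.sub_add_cancel h2, Nat.sub_add_cancel h3]

theorem tgt_verts (k : ℕ) : (tgt k).verts = Finset.range 10 := by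
  unfold tgt
  split
  · rfl
  · decide
  · rfl
  · rfl
  · decide
  · rfl

theorem fam_mem {k x y z : ℕ} (hx : x < 10) (hy : y < 10) (hz : z < 10) (hxy : x ≠ y) (hxz : x ≠ z)
    (hyz : y ≠ z) (h : fam k x y z = true) : ({x, y, z} : Finset ℕ) ∈ (tgt k).edges := by
  have hp : ({x, y, z} : Finset ℕ) ∈ (Finset.range 10).powersetCard 3 := by
    rw [Finset.mem_powersetCard]
    refine ⟨?_, Finset.card_eq_three.2 ⟨x, y, z, hxy, hxz, hyz, rfl⟩⟩
    intro w hw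
    simp only [Finset.mem_insert, Finset.mem_singleton] at hw
    rw [Finset.mem_range]; omega
  have c3 : ({x, y, z} : Finset ℕ).card = 3 := (Finset.mem_powersetCard.1 hp).2
  have hic := ic_card (a := 0) (b := 1) (c := 2) (by decide) (by decide) (by decide) (x, y, z)
  have hic' := ic_card (a := 1) (b := 2) (c := 3) (by decide) (by decide) (by decide) (x, y, z)
  simp only at hic hic'
  unfold fam at h
  split at h
  · rw [inT_iff] at h
    exact Finset.mem_filter.2 ⟨hp, h⟩
  · simp only [Bool.or_eq_true, Bool.and_eq_true, Nat.blt_eq, Nat.ble_eq] at h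
    exact dU_mem (by decide) hx hy hz hxy hxz hyz h
  · simp only [Bool.or_eq_true, Bool.and_eq_true, Nat.beq_eq, Nat.ble_eq, inT_iff, hic] at h
    refine Finset.mem_insert.2 ?_
    rcases h with h | h
    · left
      have h1 : ({0, 1, 2} : Finset ℕ) ∩ {x, y, z} = {0, 1, 2} :=
        Finset.eq_of_subset_of_card_le Finset.inter_subset_left (by rw [h]; decide)
      have h2 : ({0, 1, 2} : Finset ℕ) ⊆ {x, y, z} := by rw [← h1]; exact Finset.inter_subset_right
      exact (Finset.eq_of_subset_of_card_le h2 (by rw [c3]; decide)).symm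
    · right
      refine Finset.mem_filter.2 ⟨hp, h.1, ?_⟩
      rw [Finset.inter_comm]
      exact Finset.card_pos.1 h.2
  · simp only [Nat.ble_eq, hic] at h
    refine Finset.mem_insert.2 ?_
    by_cases h' : (({0, 1, 2} : Finset ℕ) ∩ {x, y, z}).card = 2
    · right
      refine Finset.mem_filter.2 ⟨hp, ?_⟩
      rw [Finset.inter_comm]; exact h'
    · left
      have h1 : ({0, 1, 2} : Finset ℕ) ∩ {x, y, z} = {0, 1, 2} :=
        Finset.eq_of_subset_of_card_le Finset.inter_subset_left (by
          have : ({0, 1, 2} : Finset ℕ).card = 3 := by decide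
          omega)
      have h2 : ({0, 1, 2} : Finset ℕ) ⊆ {x, y, z} := by rw [← h1]; exact Finset.inter_subset_right
      exact (Finset.eq_of_subset_of_card_le h2 (by rw [c3]; decide)).symm
  · simp only [Bool.or_eq_true, Bool.and_eq_true, Nat.blt_eq, Nat.ble_eq] at h
    exact dU_mem (by decide) hx hy hz hxy hxz hyz h
  · simp only [Bool.or_eq_true, Bool.and_eq_true, Nat.blt_eq, Nat.beq_eq, inT_iff, hic'] at h
    refine Finset.mem_union.2 ?_
    rcases h with h | h
    · left
      rw [Finset.mem_powersetCard]
      refine ⟨?_, c3⟩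
      intro w hw
      simp only [Finset.mem_insert, Finset.mem_singleton] at hw ⊢
      omega
    · right
      rw [Finset.mem_filter, Finset.mem_powersetCard]
      refine ⟨⟨?_, c3⟩, h.1⟩
      intro w hw
      have h0 := Finset.card_eq_zero.1 h.2
      have hw10 : w < 10 := Finset.mem_range.1 ((Finset.mem_powersetCard.1 hp).1 hw)
      have : w ∉ ({1, 2, 3} : Finset ℕ) := by
        intro h'
        have : w ∈ ({1, 2, 3} : Finset ℕ) ∩ {x, y, z} := Finset.mem_inter.2 ⟨h', hw⟩
        rw [h0] at this
        simp at this
      simp only [Finset.mem_insert, Finset.mem_singleton, Finset.mem_Ico] at this ⊢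
      omega
  · simp at h

theorem tgt_concl {H : ThreeGraph} (k : ℕ) (h : (tgt k).ContainsCopy H) : Concl H := by
  unfold tgt at h
  split at h
  · exact Or.inr (Or.inl ⟨_, by simp [L10], h⟩)
  · exact Or.inr (Or.inl ⟨_, by simp [L10], h⟩)
  · exact Or.inr (Or.inl ⟨_, by simp [L10], h⟩)
  · exact Or.inr (Or.inl ⟨_, by simp [L10], h⟩)
  · exact Or.inr (Or.inl ⟨_, by simp [L10], h⟩)
  · exact Or.inr (Or.inr h)

theorem emb_sound {H φ In L} (hv : H.IsValid) (h : Inv H φ In L) {k : ℕ} {p : List ℕ}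
    (hp : permOK p = true)
    (hL : ∀ t ∈ L, fam k (look p t.1) (look p t.2.1) (look p t.2.2) = true) : Concl H := by
  have hlt : ∀ i < 10, look p i < 10 := by
    intro i hi
    simp only [permOK, List.all_eq_true, Bool.and_eq_true, Nat.blt_eq] at hp
    exact (hp i (mem_D10 hi)).1
  have hinj : ∀ i < 10, ∀ j < 10, look p i = look p j → i = j := by
    intro i hi j hj e
    simp only [permOK, List.all_eq_true, Bool.and_eq_true] at hp
    have := (hp i (mem_D10 hi)).2 j (mem_D10 hj)
    simpa [e, Bool.or_eq_true, Nat.beq_eq] using this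
  have hi : Set.InjOn φ (Set.Iio 10) := fun x hx y hy e => h.lab.inj x hx y hy e
  set ψ := Function.invFunOn φ (Set.Iio 10) with hψ
  have hψφ : ∀ x < 10, ψ (φ x) = x := fun x hx => hi.leftInvOn_invFunOn hx
  have hV : ∀ v ∈ H.verts, ∃ x < 10, φ x = v := by
    intro v hv
    rw [← h.lab.img] at hv
    simpa using hv
  refine tgt_concl k ⟨fun v => look p (ψ v), ?_, ?_, ?_⟩
  · intro v hv w hw e
    obtain ⟨x, hx, rfl⟩ := hV v hv
    obtain ⟨y, hy, rfl⟩ := hV w hw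
    simp only [hψφ x hx, hψφ y hy] at e
    rw [hinj x hx y hy e]
  · intro v hv
    obtain ⟨x, hx, rfl⟩ := hV v hv
    rw [tgt_verts, Finset.mem_range]
    simp only [hψφ x hx]
    exact hlt x hx
  · intro E hE
    obtain ⟨⟨a, b, c⟩, ht, rfl⟩ := edge_triple hv h.lab hE
    have hm := hL _ (h.cd _ ht (X_iff.2 hE))
    obtain ⟨h1, h2, h3⟩ := (mem_T120 _ _ _).1 ht
    have ha : a < 10 := by omega
    have hb : b < 10 := by omega
    have := fam_mem (hlt a ha) (hlt b hb) (hlt c h3) (fun e => by have := hinj a ha b hb e; omega)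
      (fun e => by have := hinj a ha c h3 e; omega) (fun e => by have := hinj b hb c h3 e; omega) hm
    simpa only [st, Finset.image_insert, Finset.image_singleton, hψφ a ha, hψφ b hb, hψφ c h3] using this

theorem sound {H : ThreeGraph} (hv : H.IsValid) (hf : H.Free pathP) (T : CT) :
    ∀ In L φ, Inv H φ In L → chk T In L = true → Concl H := by
  induction T with
  | cnt =>
    intro In L φ h hc
    rw [chk, Nat.ble_eq] at hc
    exact Or.inl ((card_le hv h).trans hc)
  | emb k p =>
    intro In L φ h hc
    rw [chk, Bool.and_eq_true, List.all_eq_true] at hc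
    exact emb_sound hv h hc.1 hc.2
  | br a b c cls l r ihl ihr =>
    intro In L φ h hc
    simp only [chk, Bool.and_eq_true, Nat.blt_eq, force_eq, filt_eq, List.append_nil] at hc
    obtain ⟨⟨⟨h1, h2, h3⟩, hcls⟩, hl, hr⟩ := hc
    have hT : (a, b, c) ∈ T120 := (mem_T120 _ _ _).2 ⟨h1, h2, h3⟩
    have left : ∀ ψ, Inv H ψ In L → X H ψ (a, b, c) → Concl H := by
      intro ψ hψ hX
      refine ihl _ _ ψ ⟨hψ.lab, ?_, ?_, ?_, ?_⟩ hl
      · intro t ht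
        rcases List.mem_cons.1 ht with rfl | ht
        · exact hT
        · exact hψ.insT t ht
      · intro t ht
        rcases List.mem_cons.1 ht with rfl | ht
        · exact hX
        · exact hψ.ins t ht
      · intro t ht
        rw [List.mem_reverse, List.mem_filter] at ht
        exact hψ.sub t ht.1
      · intro t ht hXt
        rw [List.mem_reverse, List.mem_filter]
        refine ⟨hψ.cd t ht hXt, ?_⟩
        rw [Bool.not_eq_true', ← Bool.not_eq_true, List.any_eq_true]
        rintro ⟨f, hfm, hP⟩
        rw [isP_false hv hf hψ.lab hT (hψ.insT f hfm) ht hX (hψ.ins f hfm) hXt] at hP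
        exact Bool.false_ne_true hP
    by_contra hcon
    refine hcon (ihr _ _ φ ⟨h.lab, h.insT, h.ins, ?_, ?_⟩ hr)
    · intro t ht
      rw [List.mem_reverse, List.mem_filter] at ht
      exact h.sub t ht.1
    · rintro ⟨x, y, z⟩ ht hXt
      rw [List.mem_reverse, List.mem_filter]
      refine ⟨h.cd _ ht hXt, ?_⟩
      rw [Bool.not_eq_true', ← Bool.not_eq_true]
      intro hm
      obtain ⟨x', y', z', hX, e1, e2, e3, hperm⟩ := match6_spec hm
      obtain ⟨g1, g2, g3⟩ := (mem_T120 _ _ _).1 ht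
      have hd : x' < 10 ∧ y' < 10 ∧ z' < 10 ∧ x' ≠ y' ∧ x' ≠ z' ∧ y' ≠ z' := by
        simp only [Prod.mk.injEq] at hperm
        omega
      obtain ⟨d1, d2, d3, d4, d5, d6⟩ := hd
      obtain ⟨ψ, hψ, hXψ⟩ := orbit h hcls (by omega : a < 10) (by omega : b < 10) h3 (by omega) (by omega)
        (by omega) d1 d2 d3 d4 d5 d6 e1 e2 e3 ((hX H φ).1 hXt)
      exact hcon (left ψ hψ hXψ)

theorem main_concl {H : ThreeGraph} (hv : H.IsValid) (hc : H.verts.card = 10) (hf : H.Free pathP) :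
    Concl H := by
  have e : Fin 10 ≃ H.verts := (Finset.equivFinOfCardEq hc).symm
  set φ : ℕ → ℕ := fun n => if h : n < 10 then (e ⟨n, h⟩ : ℕ) else 0 with hφ
  have hφv : ∀ n (h : n < 10), φ n = e ⟨n, h⟩ := fun n h => by simp [hφ, h]
  refine sound hv hf cert [] T120 φ ⟨⟨?_, ?_⟩, by simp, by simp, fun t h => h, fun t h _ => h⟩ chk_cert
  · intro x hx y hy h
    rw [hφv x hx, hφv y hy] at h
    have := e.injective (Subtype.ext h)
    simpa using this
  · ext v
    simp only [Finset.mem_image, Finset.mem_range]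
    constructor
    · rintro ⟨x, hx, rfl⟩
      rw [hφv x hx]; exact (e ⟨x, hx⟩).2
    · intro hv
      refine ⟨e.symm ⟨v, hv⟩, (e.symm ⟨v, hv⟩).2, ?_⟩
      rw [hφv _ (e.symm ⟨v, hv⟩).2]
      simp

/-! ### The comet -/

theorem comet_card : (comet 10).edges.card = 19 := by decide +kernel

theorem comet_valid : (comet 10).IsValid := by
  unfold ThreeGraph.IsValid; decide +kernel

theorem comet_nopath : ∀ A ∈ (comet 10).edges, ∀ C ∈ (comet 10).edges, A ∩ C = ∅ →
    ∀ B ∈ (comet 10).edges, (A ∩ B).card = 1 → (B ∩ C).card = 1 → False := by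
  decide +kernel

theorem inter_image {f : ℕ → ℕ} {V A B : Finset ℕ} (hf : Set.InjOn f ↑V) (hA : A ⊆ V) (hB : B ⊆ V) :
    A.image f ∩ B.image f = (A ∩ B).image f := by
  refine (Finset.image_inter_of_injOn _ _ (hf.mono ?_)).symm
  intro x hx
  rcases hx with hx | hx
  · exact hA hx
  · exact hB hx

theorem card_inter_image {f : ℕ → ℕ} {V A B : Finset ℕ} (hf : Set.InjOn f ↑V) (hA : A ⊆ V) (hB : B ⊆ V) :
    (A.image f ∩ B.image f).card = (A ∩ B).card := by
  rw [inter_image hf hA hB]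
  exact Finset.card_image_of_injOn (hf.mono (fun x hx => hA (Finset.mem_inter.1 hx).1))

theorem comet_free : (comet 10).Free pathP := by
  rintro ⟨f, hf, -, he⟩
  have h1 : ({0,1,2} : Finset ℕ) ⊆ pathP.verts := by decide
  have h2 : ({2,3,4} : Finset ℕ) ⊆ pathP.verts := by decide
  have h3 : ({4,5,6} : Finset ℕ) ⊆ pathP.verts := by decide
  refine comet_nopath _ (he {0,1,2} (by decide)) _ (he {4,5,6} (by decide)) ?_ _
    (he {2,3,4} (by decide)) ?_ ?_
  · rw [inter_image hf h1 h3, show ({0,1,2} : Finset ℕ) ∩ {4,5,6} = ∅ by decide, Finset.image_empty]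
  · rw [card_inter_image hf h1 h2]; decide
  · rw [card_inter_image hf h2 h3]; decide

theorem comet_not_dU (m n : ℕ) (hm : (Finset.range m).sup id + 1 = m) (hm' : m < 10) (hn : n < 10) :
    ¬ ((KK m).dUnion (KK n)).ContainsCopy (comet 10) := by
  rintro ⟨f, hf, -, he⟩
  have hside : ∀ E ∈ (comet 10).edges, (∀ x ∈ E, f x < m) ∨ (∀ x ∈ E, m ≤ f x ∧ f x < m + n) := by
    intro E hE
    have := he E hE
    rw [dU_edges m n hm] at this
    rcases this with ⟨h, -⟩ | ⟨F, ⟨hF, -⟩, h⟩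
    · left
      intro x hx
      exact Finset.mem_range.1 (h (Finset.mem_image_of_mem f hx))
    · right
      intro x hx
      have hx' := Finset.mem_image_of_mem f hx
      rw [← h, Finset.mem_image] at hx'
      obtain ⟨y, hy, e⟩ := hx'
      have := Finset.mem_range.1 (hF hy)
      omega
  have hall : ∀ x ∈ Finset.range 10, ∃ E ∈ (comet 10).edges, 0 ∈ E ∧ x ∈ E := by decide +kernel
  have hf' : Set.InjOn f ↑(Finset.range 10) := hf
  by_cases h0 : f 0 < m
  · have : (Finset.range 10).card ≤ (Finset.range m).card := by
      refine Finset.card_le_card_of_injOn f ?_ hf'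
      intro x hx
      obtain ⟨E, hE, h0E, hxE⟩ := hall x hx
      rw [Finset.mem_coe, Finset.mem_range]
      rcases hside E hE with h | h
      · exact h x hxE
      · have := h 0 h0E; omega
    simp at this; omega
  · have : (Finset.range 10).card ≤ (Finset.Ico m (m + n)).card := by
      refine Finset.card_le_card_of_injOn f ?_ hf'
      intro x hx
      obtain ⟨E, hE, h0E, hxE⟩ := hall x hx
      rw [Finset.mem_coe, Finset.mem_Ico]
      rcases hside E hE with h | h
      · exact absurd (h 0 h0E) h0
      · exact h x hxE
    simp at this; omega

theorem comet_not : ∀ G ∈ L10, ¬ G.ContainsCopy (comet 10) := by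
  have s1 : ({1,2,3} : Finset ℕ) ⊆ (comet 10).verts := by decide
  have s2 : ({0,4,5} : Finset ℕ) ⊆ (comet 10).verts := by decide
  have s3 : ({0,6,7} : Finset ℕ) ⊆ (comet 10).verts := by decide
  have m1 : ({1,2,3} : Finset ℕ) ∈ (comet 10).edges := by decide +kernel
  have m2 : ({0,4,5} : Finset ℕ) ∈ (comet 10).edges := by decide +kernel
  have m3 : ({0,6,7} : Finset ℕ) ∈ (comet 10).edges := by decide +kernel
  have m4 : ({0,1,2} : Finset ℕ) ∈ (comet 10).edges := by decide +kernel
  have hd : ∀ f : ℕ → ℕ, Set.InjOn f ↑(comet 10).verts →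
      Finset.image f {1,2,3} ∩ Finset.image f {0,4,5} = ∅ := by
    intro f hf
    rw [inter_image hf s1 s2, show ({1,2,3} : Finset ℕ) ∩ {0,4,5} = ∅ by decide, Finset.image_empty]
  intro G hG
  simp only [L10, List.mem_cons, List.not_mem_nil, or_false] at hG
  rcases hG with rfl | rfl | rfl | rfl | rfl
  · rintro ⟨f, hf, -, he⟩
    have a1 := (Finset.mem_filter.1 (he _ m1)).2
    have a2 := (Finset.mem_filter.1 (he _ m2)).2
    have := Finset.mem_inter.2 ⟨a1, a2⟩
    rw [hd f hf] at this
    simp at this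
  · exact comet_not_dU 6 4 (by decide) (by decide) (by decide)
  · rintro ⟨f, hf, -, he⟩
    have hG : ∀ E ∈ (comet 10).edges, E.image f = {0,1,2} ∨
        (3 ∈ E.image f ∧ (E.image f ∩ {0,1,2}).Nonempty) := by
      intro E hE
      rcases Finset.mem_insert.1 (he E hE) with h | h
      · exact Or.inl h
      · exact Or.inr (Finset.mem_filter.1 h).2
    have hne : ∀ x ∈ (comet 10).verts, ∀ y ∈ (comet 10).verts, f x = f y → x = y :=
      fun x hx y hy e => hf hx hy e
    rcases hG _ m1 with h | ⟨h, -⟩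
    · rcases hG _ m2 with h' | ⟨-, w, hw⟩
      · have := hd f hf
        rw [h, h'] at this
        exact absurd this (by decide)
      · have hw' := Finset.mem_inter.1 hw
        rw [← h] at hw'
        have := Finset.mem_inter.2 ⟨hw'.2, hw'.1⟩
        rw [hd f hf] at this
        simp at this
    · rcases hG _ m2 with h' | ⟨h', -⟩
      · rcases hG _ m3 with h'' | ⟨h'', -⟩
        · have hc := card_inter_image hf s2 s3
          rw [h', h''] at hc
          exact absurd hc (by decide)
        · have hi := inter_image hf s1 s3
          have := Finset.mem_inter.2 ⟨h, h''⟩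
          rw [hi, show ({1,2,3} : Finset ℕ) ∩ {0,6,7} = ∅ by decide] at this
          simp at this
      · have := Finset.mem_inter.2 ⟨h, h'⟩
        rw [hd f hf] at this
        simp at this
  · rintro ⟨f, hf, -, he⟩
    have hG : ∀ E ∈ (comet 10).edges, 2 ≤ (E.image f ∩ {0,1,2}).card := by
      intro E hE
      rcases Finset.mem_insert.1 (he E hE) with h | h
      · rw [h]; decide
      · exact (Finset.mem_filter.1 h).2.ge
    have a1 := hG _ m1
    have a2 := hG _ m2
    have hdis : Disjoint (Finset.image f {1,2,3} ∩ {0,1,2}) (Finset.image f {0,4,5} ∩ {0,1,2}) := by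
      refine Disjoint.mono Finset.inter_subset_left Finset.inter_subset_left ?_
      exact Finset.disjoint_iff_inter_eq_empty.2 (hd f hf)
    have hsub : (Finset.image f {1,2,3} ∩ {0,1,2}) ∪ (Finset.image f {0,4,5} ∩ {0,1,2}) ⊆ ({0,1,2} : Finset ℕ) :=
      Finset.union_subset Finset.inter_subset_right Finset.inter_subset_right
    have := Finset.card_le_card hsub
    rw [Finset.card_union_of_disjoint hdis] at this
    have h3 : ({0,1,2} : Finset ℕ).card = 3 := by decide
    omega
  · exact comet_not_dU 5 5 (by decide) (by decide) (by decide)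

theorem image_injOn {f : ℕ → ℕ} {V : Finset ℕ} (hf : Set.InjOn f ↑V) {S : Finset (Finset ℕ)}
    (hS : ∀ E ∈ S, E ⊆ V) : Set.InjOn (Finset.image f) ↑S := by
  have key : ∀ A ∈ S, ∀ B ∈ S, A.image f = B.image f → A ⊆ B := by
    intro A hA B hB h x hx
    have := Finset.mem_image_of_mem f hx
    rw [h, Finset.mem_image] at this
    obtain ⟨y, hy, e⟩ := this
    have := hf (hS B hB hy) (hS A hA hx) e
    exact this ▸ hy
  intro A hA B hB h
  exact Finset.Subset.antisymm (key A hA B hB h) (key B hB A hA h.symm)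

theorem in_comet {H : ThreeGraph} (hv : H.IsValid) (hc : H.verts.card = 10)
    (h : (comet 10).ContainsCopy H) :
    H.edges.card ≤ 19 ∧ (H.edges.card = 19 → ThreeGraph.IsoCopy (comet 10) H) := by
  obtain ⟨f, hf, hV, hE⟩ := h
  have hinj := image_injOn hf (S := H.edges) (fun E h => (hv E h).2)
  have hsub : H.edges.image (Finset.image f) ⊆ (comet 10).edges := by
    intro E h
    obtain ⟨F, hF, rfl⟩ := Finset.mem_image.1 h
    exact hE F hF
  have hcard := Finset.card_image_of_injOn hinj
  refine ⟨?_, fun h19 => ?_⟩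
  · rw [← hcard, ← comet_card]; exact Finset.card_le_card hsub
  · have heq : H.edges.image (Finset.image f) = (comet 10).edges :=
      Finset.eq_of_subset_of_card_le hsub (by rw [hcard, h19, comet_card])
    have hVs : H.verts.image f ⊆ (comet 10).verts := by
      intro v h
      obtain ⟨w, hw, rfl⟩ := Finset.mem_image.1 h
      exact hV w hw
    have hVeq : H.verts.image f = (comet 10).verts :=
      Finset.eq_of_subset_of_card_le hVs (by
        rw [Finset.card_image_of_injOn hf, hc]; decide)
    set g := Function.invFunOn f (↑H.verts : Set ℕ) with hg
    have hgf : ∀ x ∈ H.verts, g (f x) = x := fun x hx => hf.leftInvOn_invFunOn hx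
    have himg : ∀ S ⊆ H.verts, (S.image f).image g = S := by
      intro S hS
      rw [Finset.image_image]
      conv_rhs => rw [← Finset.image_id (s := S)]
      exact Finset.image_congr (fun x hx => hgf x (hS hx))
    refine ⟨g, ?_, ?_, ?_⟩
    · rw [← hVeq]
      intro x hx y hy e
      obtain ⟨x', hx', rfl⟩ := Finset.mem_image.1 (Finset.mem_coe.1 hx)
      obtain ⟨y', hy', rfl⟩ := Finset.mem_image.1 (Finset.mem_coe.1 hy)
      rw [hgf x' hx', hgf y' hy'] at e
      rw [e]
    · rw [← hVeq]; exact himg _ (Finset.Subset.refl _)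
    · rw [← heq]
      ext S
      simp only [Finset.mem_image]
      constructor
      · rintro ⟨_, ⟨T, hT, rfl⟩, rfl⟩
        rw [himg T (hv T hT).2]; exact hT
      · intro hS
        exact ⟨_, ⟨S, hS, rfl⟩, himg S (hv S hS).2⟩

theorem iso_card {H : ThreeGraph} (h : ThreeGraph.IsoCopy (comet 10) H) : H.edges.card = 19 := by
  obtain ⟨f, hf, -, hE⟩ := h
  rw [← hE, Finset.card_image_of_injOn (image_injOn hf (fun E h => (comet_valid E h).2)), comet_card]

end Fifth

/-- The maximum number of edges of a `P`-free 3-graph on 10 vertices not contained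
in any member of `L₁₀` equals 19, attained exactly by the comet `Co(10)`. -/
theorem fifth_order_turan_ten :
    IsGreatest {m : ℕ | ∃ H : ThreeGraph, H.IsValid ∧ H.verts.card = 10 ∧
      H.Free pathP ∧ (∀ G ∈ L10, ¬ G.ContainsCopy H) ∧ H.edges.card = m} 19 ∧
    ∀ H : ThreeGraph, H.IsValid → H.verts.card = 10 → H.Free pathP →
      (∀ G ∈ L10, ¬ G.ContainsCopy H) →
      (H.edges.card = 19 ↔ ThreeGraph.IsoCopy (comet 10) H) := by
  have bound : ∀ H : ThreeGraph, H.IsValid → H.verts.card = 10 → H.Free pathP →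
      (∀ G ∈ L10, ¬ G.ContainsCopy H) →
      H.edges.card ≤ 19 ∧ (H.edges.card = 19 → ThreeGraph.IsoCopy (comet 10) H) := by
    intro H hv hc hf hL
    rcases Fifth.main_concl hv hc hf with h | ⟨G, hG, h⟩ | h
    · exact ⟨by omega, by omega⟩
    · exact absurd h (hL G hG)
    · exact Fifth.in_comet hv hc h
  refine ⟨⟨?_, ?_⟩, ?_⟩
  · exact ⟨comet 10, Fifth.comet_valid, by decide, Fifth.comet_free, Fifth.comet_not, Fifth.comet_card⟩
  · rintro m ⟨H, hv, hc, hf, hL, rfl⟩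
    exact (bound H hv hc hf hL).1
  · intro H hv hc hf hL
    exact ⟨(bound H hv hc hf hL).2, Fifth.iso_card⟩
end

section
/- Let L_11 = {S_11, K_6 ∪ K_5, G_1(11), G_2(11), Co(11), G_3(11)}. The maximum number of edges of a P-free 3-graph H on 11 vertices such that H is not contained in any member of L_11 equals 19; moreover such an H has 19 edges if and only if H is isomorphic to K_4 ∪ S_7. -/
/-- The family `L₁₁`. -/
def L11 : List ThreeGraph :=
  [SS 11, (KK 6).dUnion (KK 5), G1 11, G2 11, comet 11, G3 11]

/-! ### A kernel-friendly verified search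

The triples of `{0,…,10}` are numbered by their colex rank, and sets of triples are the binary
digits of natural numbers. -/

/-- colex rank of a triple `a < b < c` -/
def tPos (a b c : ℕ) : ℕ :=
  Nat.add (Nat.div (Nat.mul (Nat.mul c (Nat.sub c 1)) (Nat.sub c 2)) 6)
    (Nat.add (Nat.div (Nat.mul b (Nat.sub b 1)) 2) a)

/-- all triples -/
def tAll : ℕ := 46768052394588893382517914646921056628989841375231

/-- the triples through a vertex -/
def tV : ℕ → ℕ
  | 0 => 91703496866477505450394380548438725392990284983
  | 1 => 183406993731625782904984502410787752030506210651
  | 2 => 366813987457934653826751970077216709039114984045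
  | 3 => 733627974889284747737418766432639442968742781838
  | 4 => 1467255949544625368213288004113491904973998326768
  | 5 => 2934511895176003516778838436378910673831484980224
  | 6 => 5869023662405837069422952784507777940791856463872
  | 7 => 11738039049144510501195666669438424320280409145344
  | 8 => 23475013237705775669375368777871250682476029280256
  | 9 => 46676708542257041178125949917936078913254830637056
  | 10 => 46768052394587564154522129731048152821929561030656
  | _ => 0

/-- the list of chosen triples: for each its singleton mask, and the masks of the triples that
meet it in 0 and in 1 vertices -/
inductive InL where
  | nil : InL
  | cons (eb d0 d1 : ℕ) (tl : InL) : InL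

/-- stack of open search states (chosen triples, possible triples) -/
inductive Stk where
  | nil : Stk
  | cons (I : InL) (p : ℕ) (tl : Stk) : Stk

/-- set difference -/
def tDel (p q : ℕ) : ℕ := Nat.xor p (Nat.land p q)

/-- triples disjoint from `abc` -/
def tD0 (va vb vc : ℕ) : ℕ := Nat.xor tAll (Nat.lor va (Nat.lor vb vc))

/-- triples meeting `abc` in exactly one vertex -/
def tD1 (va vb vc : ℕ) : ℕ := tDel (Nat.xor va (Nat.xor vb vc)) (Nat.land va vb)

noncomputable section

/-- evaluate a numeral before passing it on -/
def force {α : Type} (x : ℕ) (f : ℕ → α) : α :=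
  Nat.rec (f 0) (fun n _ => f (Nat.succ n)) x

/-- evaluate a stack before passing it on -/
def forceS {α : Type} (x : Stk) (f : Stk → α) : α :=
  Stk.rec (f Stk.nil) (fun I p tl _ => f (Stk.cons I p tl)) x

/-- star of the common vertex of the new triple and the triple `eb'` -/
def tCom (va vb vc eb' : ℕ) : ℕ :=
  cond (Nat.beq (Nat.land va eb') 0) (cond (Nat.beq (Nat.land vb eb') 0) vc vb) va

/-- remove from `p` the triples excluded by the new triple together with an older one -/
def tStep (cf va vb vc eb d0 d1 eb' d0' d1' p : ℕ) : ℕ :=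
  cond (Nat.beq (Nat.land d0' eb) 0)
    (cond (Nat.beq (Nat.land d1' eb) 0) p
      (tDel p (Nat.lor (Nat.land d1 (Nat.lor d0' (tDel (Nat.land d1' cf) (tCom va vb vc eb'))))
        (Nat.land d0 d1'))))
    (tDel p (Nat.land d1 d1'))

/-- the same for all older triples -/
def forbAll (cf va vb vc eb d0 d1 : ℕ) (I : InL) : ℕ → ℕ :=
  InL.rec (fun p => p)
    (fun eb' d0' d1' _ ih p => force (tStep cf va vb vc eb d0 d1 eb' d0' d1' p) ih) I

/-- `p` has at most `n` binary digits 1 -/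
def few (n : ℕ) : ℕ → Bool :=
  Nat.rec (fun p => Nat.beq p 0)
    (fun _ ih p => Nat.rec true (fun m _ => ih (Nat.land (Nat.succ m) m)) p) n

/-- list lookup -/
def getT (l : List ℕ) : ℕ → ℕ :=
  List.rec (fun _ => 0) (fun t _ ih n => Nat.rec t (fun m _ => ih m) n) l

/-- choose the triple `abc` -/
def addE {α : Type} (cf pf a b c : ℕ) (I : InL) (p : ℕ) (k : InL → ℕ → α) : α :=
  force (tV a) fun va => force (tV b) fun vb => force (tV c) fun vc =>
  force (tD0 va vb vc) fun d0 => force (tD1 va vb vc) fun d1 =>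
  force (Nat.pow 2 (tPos a b c)) fun eb =>
  force (forbAll cf va vb vc eb d0 d1 I (tDel p (Nat.land d1 pf))) fun p' =>
  k (InL.cons eb d0 d1 I) p'

/-- `a < b < c < 11` -/
def tVal (a b c : ℕ) : Bool :=
  cond (Nat.ble (Nat.succ a) b) (cond (Nat.ble (Nat.succ b) c) (Nat.ble c 10) false) false

/-- one certificate digit: `0` closes the top state by counting, `k < 256` closes it by the
`k`-th target, and `a + 16 b + 256 c` branches on the triple `abc` -/
def step (cf pf : ℕ) (ts : List ℕ) (code : ℕ) (st : Stk) : Stk :=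
  Stk.rec Stk.nil (fun I p tl _ =>
    force code fun code => force (Nat.div code 256) fun c =>
    cond (Nat.beq c 0)
      (cond (Nat.beq code 0)
        (cond (few 18 p) tl (Stk.cons I p tl))
        (force (getT ts (Nat.pred code)) fun t =>
          cond (Nat.beq (Nat.lor p t) t) tl (Stk.cons I p tl)))
      (force (Nat.mod code 16) fun a => force (Nat.mod (Nat.div code 16) 16) fun b =>
        cond (tVal a b c)
          (addE cf pf a b c I p fun I' p' =>
            force (tDel p (Nat.pow 2 (tPos a b c))) fun q => Stk.cons I' p' (Stk.cons I q tl))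
          (Stk.cons I p tl))) st

/-- process the digits of one chunk -/
def runChunk (cf pf : ℕ) (ts : List ℕ) (n : ℕ) : ℕ → Stk → Stk :=
  Nat.rec (fun _ st => st)
    (fun _ ih ch st => force (Nat.div ch 4096) fun ch' =>
      forceS (step cf pf ts (Nat.mod ch 4096) st) (ih ch')) n

/-- process all chunks -/
def run (cf pf : ℕ) (ts : List ℕ) (l : List ℕ) : Stk → Stk :=
  List.rec (fun st => st) (fun ch _ ih st => forceS (runChunk cf pf ts 30 ch st) ih) l

/-- the empty stack -/
def Stk.isNil (st : Stk) : Bool := Stk.rec true (fun _ _ _ _ => false) st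

/-- initial state with chosen triples `012`, `abc` -/
def start2 (cf pf a b c : ℕ) : Stk :=
  addE cf pf 0 1 2 InL.nil tAll fun I p => addE cf pf a b c I p fun I p => Stk.cons I p Stk.nil

/-- initial state with chosen triples `012`, `abc`, `a'b'c'` -/
def start3 (cf pf a b c a' b' c' : ℕ) : Stk :=
  addE cf pf 0 1 2 InL.nil tAll fun I p => addE cf pf a b c I p fun I p =>
    addE cf pf a' b' c' I p fun I p => Stk.cons I p Stk.nil

/-- digit `i` of a permutation code -/
def pdig (d i : ℕ) : ℕ := Nat.mod (Nat.div d (Nat.pow 16 i)) 16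

/-- membership of a triple in the target of the given kind -/
def gB (kind x y z : ℕ) : Bool :=
  match kind with
  | 0 => x == 0 || y == 0 || z == 0
  | 1 => (x < 6 && y < 6 && z < 6) || (6 ≤ x && 6 ≤ y && 6 ≤ z)
  | 2 => (x < 3 && y < 3 && z < 3) || ((x == 3 || y == 3 || z == 3) && (x < 3 || y < 3 || z < 3))
  | 3 => (x < 3 && y < 3) || (x < 3 && z < 3) || (y < 3 && z < 3)
  | 4 => (x < 4 && y < 4 && z < 4) ||
      ((x == 0 || y == 0 || z == 0) && (x == 0 || 4 ≤ x) && (y == 0 || 4 ≤ y) && (z == 0 || 4 ≤ z))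
  | 5 => (x < 5 && y < 5 && z < 5 && (x == 0 || y == 0 || z == 0)) ||
      (x < 5 && y < 5 && z < 5 && (x == 3 || y == 3 || z == 3) && (x == 4 || y == 4 || z == 4)) ||
      ((x == 0 || y == 0 || z == 0) && (x == 3 || y == 3 || z == 3 || x == 4 || y == 4 || z == 4))
  | 6 => (x < 4 && y < 4 && z < 4) ||
      ((x == 4 || y == 4 || z == 4) && 4 ≤ x && 4 ≤ y && 4 ≤ z)
  | _ => false

/-- the triples in colex order -/
def trips : List (ℕ × ℕ × ℕ) :=
  (List.range 11).flatMap fun z => (List.range z).flatMap fun y =>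
    (List.range y).map fun x => (x, y, z)

/-- the mask `t` is contained in the copy of a target described by `d` -/
def okT (d t : ℕ) : Bool :=
  force (Nat.div d (Nat.pow 16 11)) fun kind =>
  ((List.range 11).all fun i => (List.range i).all fun j =>
      !(Nat.beq (pdig d i) (pdig d j))) &&
  ((List.range 11).all fun i => Nat.ble (pdig d i) 10) &&
  (trips.all fun e => cond (Nat.beq (Nat.land t (Nat.pow 2 (tPos e.1 e.2.1 e.2.2))) 0) true
      (force (pdig d e.1) fun x => force (pdig d e.2.1) fun y => force (pdig d e.2.2) fun z =>
        gB kind x y z))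

/-- all masks are contained in copies of targets -/
def okTs (ds ts : List ℕ) : Bool :=
  List.rec (fun ts => List.rec true (fun _ _ _ => false) ts)
    (fun d _ ih ts => List.rec false (fun t tl _ => cond (okT d t) (ih tl) false) ts) ds ts

end

/-! ### Soundness of the search -/

theorem force_eq {α : Type} (x : ℕ) (f : ℕ → α) : force x f = f x := by
  cases x <;> rfl

theorem forceS_eq {α : Type} (x : Stk) (f : Stk → α) : forceS x f = f x := by
  cases x <;> rfl

theorem tb_del (p q i : ℕ) : (tDel p q).testBit i = (p.testBit i && !q.testBit i) := by
  change (p ^^^ (p &&& q)).testBit i = _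
  rw [Nat.testBit_xor, Nat.testBit_and]
  cases p.testBit i <;> cases q.testBit i <;> rfl

theorem tb_land (p q i : ℕ) : (Nat.land p q).testBit i = (p.testBit i && q.testBit i) :=
  Nat.testBit_and p q i

theorem tb_lor (p q i : ℕ) : (Nat.lor p q).testBit i = (p.testBit i || q.testBit i) :=
  Nat.testBit_or p q i

theorem tb_xor (p q i : ℕ) : (Nat.xor p q).testBit i = (p.testBit i ^^ q.testBit i) :=
  Nat.testBit_xor p q i

theorem beq_land_pow (p k : ℕ) : Nat.beq (Nat.land p (Nat.pow 2 k)) 0 = !p.testBit k := by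
  change Nat.beq (p &&& 2 ^ k) 0 = _
  rw [Nat.and_two_pow]
  cases h : p.testBit k
  · simp
  · have : 2 ^ k ≠ 0 := by positivity
    cases hb : Nat.beq (2 ^ k) 0
    · simpa using hb
    · exact (this (Nat.eq_of_beq_eq_true hb)).elim

set_option maxRecDepth 100000 in
theorem tV_spec : ∀ i < 11, ∀ z < 11, ∀ y < z, ∀ x < y,
    (tV i).testBit (tPos x y z) = (i == x || i == y || i == z) := by
  decide +kernel

theorem tAll_spec : ∀ z < 11, ∀ y < z, ∀ x < y, tAll.testBit (tPos x y z) = true := by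
  decide +kernel

/-- a valid triple -/
def TV (a b c : ℕ) : Prop := a < b ∧ b < c ∧ c < 11

theorem tVal_spec {a b c : ℕ} (h : tVal a b c = true) : TV a b c := by
  unfold tVal at h
  cases h1 : Nat.ble (Nat.succ a) b <;> rw [h1] at h
  · simp at h
  cases h2 : Nat.ble (Nat.succ b) c <;> rw [h2] at h
  · simp at h
  have h1 := Nat.le_of_ble_eq_true h1
  have h2 := Nat.le_of_ble_eq_true h2
  have h3 := Nat.le_of_ble_eq_true h
  exact ⟨h1, h2, by omega⟩

theorem tV_mem {i x y z : ℕ} (hi : i < 11) (h : TV x y z) :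
    (tV i).testBit (tPos x y z) = decide (i ∈ ({x, y, z} : Finset ℕ)) := by
  rw [tV_spec i hi z h.2.2 y h.2.1 x h.1, Bool.eq_iff_iff]
  simp [or_assoc]

theorem card_three_inter {a b c : ℕ} (hab : a ≠ b) (hac : a ≠ c) (hbc : b ≠ c) (g : Finset ℕ) :
    (({a, b, c} : Finset ℕ) ∩ g).card =
      (if a ∈ g then 1 else 0) + (if b ∈ g then 1 else 0) + (if c ∈ g then 1 else 0) := by
  have : ({a, b, c} : Finset ℕ) ∩ g = ({a, b, c} : Finset ℕ).filter (· ∈ g) := by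
    ext; simp
  rw [this, Finset.card_filter, Finset.sum_insert (by simp [hab, hac]),
    Finset.sum_insert (by simp [hbc]), Finset.sum_singleton]
  ring

/-- the mask of the triples disjoint from `abc` -/
def mD0 (a b c : ℕ) : ℕ := tD0 (tV a) (tV b) (tV c)
/-- the mask of the triples meeting `abc` in one vertex -/
def mD1 (a b c : ℕ) : ℕ := tD1 (tV a) (tV b) (tV c)

theorem mD0_spec {a b c x y z : ℕ} (h : TV a b c) (h' : TV x y z) :
    (mD0 a b c).testBit (tPos x y z) =
      decide ((({a, b, c} : Finset ℕ) ∩ {x, y, z}).card = 0) := by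
  obtain ⟨h1, h2, h3⟩ := h
  unfold mD0 tD0
  rw [tb_xor, tb_lor, tb_lor, tAll_spec z h'.2.2 y h'.2.1 x h'.1, tV_mem (by omega) h',
    tV_mem (by omega) h', tV_mem (by omega) h', card_three_inter (by omega) (by omega) (by omega)]
  generalize ({x, y, z} : Finset ℕ) = g
  by_cases ha : a ∈ g <;> by_cases hb : b ∈ g <;> by_cases hc : c ∈ g <;> simp [ha, hb, hc]

theorem mD1_spec {a b c x y z : ℕ} (h : TV a b c) (h' : TV x y z) :
    (mD1 a b c).testBit (tPos x y z) =
      decide ((({a, b, c} : Finset ℕ) ∩ {x, y, z}).card = 1) := by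
  obtain ⟨h1, h2, h3⟩ := h
  unfold mD1 tD1
  rw [tb_del, tb_xor, tb_xor, tb_land, tV_mem (by omega) h',
    tV_mem (by omega) h', tV_mem (by omega) h', card_three_inter (by omega) (by omega) (by omega)]
  generalize ({x, y, z} : Finset ℕ) = g
  by_cases ha : a ∈ g <;> by_cases hb : b ∈ g <;> by_cases hc : c ∈ g <;> simp [ha, hb, hc]

/-- the standing assumptions on the edge set -/
structure Hyp (F : Finset (Finset ℕ)) (cf pf : ℕ) : Prop where
  uni : ∀ e ∈ F, e.card = 3 ∧ e ⊆ Finset.range 11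
  big : 19 ≤ F.card
  noP : ∀ e ∈ F, ∀ f ∈ F, ∀ g ∈ F, (e ∩ f).card = 1 → (f ∩ g).card = 1 → (e ∩ g).card = 0 → False
  noC : cf = 0 ∨ ∀ e ∈ F, ∀ f ∈ F, ∀ g ∈ F, (e ∩ f).card = 1 → (f ∩ g).card = 1 →
    (e ∩ g).card = 1 → ∃ v, v ∈ e ∧ v ∈ f ∧ v ∈ g
  noP2 : pf = 0 ∨ ∀ e ∈ F, ∀ f ∈ F, (e ∩ f).card ≠ 1

/-- all chosen triples are edges -/
def SatI (F : Finset (Finset ℕ)) : InL → Prop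
  | InL.nil => True
  | InL.cons eb d0 d1 tl => (∃ a b c, TV a b c ∧ ({a, b, c} : Finset ℕ) ∈ F ∧
      eb = Nat.pow 2 (tPos a b c) ∧ d0 = mD0 a b c ∧ d1 = mD1 a b c) ∧ SatI F tl

/-- all edges are possible triples -/
def SatP (F : Finset (Finset ℕ)) (p : ℕ) : Prop :=
  ∀ x y z, TV x y z → ({x, y, z} : Finset ℕ) ∈ F → p.testBit (tPos x y z) = true

theorem tStep_sound {F : Finset (Finset ℕ)} {cf pf : ℕ} (hF : Hyp F cf pf) {a b c a' b' c' p : ℕ}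
    (h : TV a b c) (h' : TV a' b' c') (he : ({a, b, c} : Finset ℕ) ∈ F)
    (he' : ({a', b', c'} : Finset ℕ) ∈ F) (hp : SatP F p) :
    SatP F (tStep cf (tV a) (tV b) (tV c) (Nat.pow 2 (tPos a b c)) (mD0 a b c) (mD1 a b c)
      (Nat.pow 2 (tPos a' b' c')) (mD0 a' b' c') (mD1 a' b' c') p) := by
  intro x y z hx hg
  have hpx := hp x y z hx hg
  unfold tStep tCom
  rw [beq_land_pow, beq_land_pow, beq_land_pow, beq_land_pow, mD0_spec h' h, mD1_spec h' h,
    tV_mem (by have := h.1; have := h.2.1; have := h.2.2; omega) h',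
    tV_mem (by have := h.1; have := h.2.1; have := h.2.2; omega) h']
  have P1 := hF.noP _ he _ he' _ hg
  have P2 := hF.noP _ he' _ he _ hg
  have P3 := hF.noP _ he _ hg _ he'
  have e0 := mD0_spec h hx
  have e1 := mD1_spec h hx
  have f0 := mD0_spec h' hx
  have f1 := mD1_spec h' hx
  have va := tV_mem (i := a) (by have := h.1; have := h.2.1; have := h.2.2; omega) hx
  have vb := tV_mem (i := b) (by have := h.1; have := h.2.1; have := h.2.2; omega) hx
  have vc := tV_mem (i := c) h.2.2 hx
  have cm1 := Finset.inter_comm ({a', b', c'} : Finset ℕ) {a, b, c}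
  have cm2 := Finset.inter_comm ({x, y, z} : Finset ℕ) {a', b', c'}
  rw [cm1] at P2 ⊢
  rw [cm2] at P3
  by_cases k0 : (({a, b, c} : Finset ℕ) ∩ {a', b', c'}).card = 0
  · simp only [k0, decide_true, Bool.not_true, cond_false, tb_del, tb_land, hpx, e1, f1]
    by_cases q1 : (({a, b, c} : Finset ℕ) ∩ {x, y, z}).card = 1
    · by_cases q2 : (({a', b', c'} : Finset ℕ) ∩ {x, y, z}).card = 1
      · exact (P3 q1 q2 k0).elim
      · simp [q2]
    · simp [q1]
  by_cases k1 : (({a, b, c} : Finset ℕ) ∩ {a', b', c'}).card = 1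
  · simp only [k1, one_ne_zero, decide_false, Bool.not_false, cond_true, decide_true, Bool.not_true,
      cond_false, tb_del, tb_land, tb_lor, hpx, e0, e1, f0, f1, Bool.true_and]
    have P1 := P1 k1
    have P2 := P2 k1
    by_cases q1 : (({a, b, c} : Finset ℕ) ∩ {x, y, z}).card = 1
    · by_cases q2 : (({a', b', c'} : Finset ℕ) ∩ {x, y, z}).card = 1
      · rcases hF.noC with hc | hc
        · subst hc
          simp [q1, q2]
        · obtain ⟨v, hv1, hv2, hv3⟩ := hc _ he _ he' _ hg k1 q2 q1
          have huniq : ∀ w, w ∈ ({a, b, c} : Finset ℕ) → w ∈ ({a', b', c'} : Finset ℕ) → w = v := by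
            intro w hw1 hw2
            exact Finset.card_le_one.1 k1.le w (by simp only [Finset.mem_inter]; exact ⟨hw1, hw2⟩) v
              (by simp only [Finset.mem_inter]; exact ⟨hv1, hv2⟩)
          have key : (bif !decide (a ∈ ({a', b', c'} : Finset ℕ)) then
              bif !decide (b ∈ ({a', b', c'} : Finset ℕ)) then tV c else tV b else tV a).testBit
                (tPos x y z) = true := by
            by_cases m1 : a ∈ ({a', b', c'} : Finset ℕ)
            · have := huniq a (by simp) m1
              simp only [m1, decide_true, Bool.not_true, cond_false, va]
              rw [this]; simpa using hv3
            by_cases m2 : b ∈ ({a', b', c'} : Finset ℕ)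
            · have := huniq b (by simp) m2
              simp only [m1, m2, decide_true, decide_false, Bool.not_true, Bool.not_false, cond_false,
                cond_true, vb]
              rw [this]; simpa using hv3
            · have : v = c := by
                simp only [Finset.mem_insert, Finset.mem_singleton] at hv1
                rcases hv1 with h | h | h
                · rw [← h] at m1; exact (m1 hv2).elim
                · rw [← h] at m2; exact (m2 hv2).elim
                · exact h
              simp only [m1, m2, decide_false, Bool.not_false, cond_true, vc]
              rw [← this]; simpa using hv3
          rw [key]
          simp [q1, q2]
      · have q3 : (({a', b', c'} : Finset ℕ) ∩ {x, y, z}).card ≠ 0 := fun h => P2 q1 h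
        simp [q1, q2, q3]
    · by_cases q2 : (({a', b', c'} : Finset ℕ) ∩ {x, y, z}).card = 1
      · have q3 : (({a, b, c} : Finset ℕ) ∩ {x, y, z}).card ≠ 0 := fun h => P1 q2 h
        simp [q1, q2, q3]
      · simp [q1, q2]
  · simp [k0, k1, hpx]

theorem forbAll_sound {F : Finset (Finset ℕ)} {cf pf : ℕ} (hF : Hyp F cf pf) {a b c : ℕ}
    (h : TV a b c) (he : ({a, b, c} : Finset ℕ) ∈ F) (I : InL) (hI : SatI F I) :
    ∀ p, SatP F p → SatP F (forbAll cf (tV a) (tV b) (tV c) (Nat.pow 2 (tPos a b c)) (mD0 a b c)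
      (mD1 a b c) I p) := by
  induction I with
  | nil => intro p hp; exact hp
  | cons eb d0 d1 tl ih =>
    intro p hp
    obtain ⟨⟨a', b', c', h', he', rfl, rfl, rfl⟩, htl⟩ := hI
    change SatP F (force _ _)
    rw [force_eq]
    exact ih htl _ (tStep_sound hF h h' he he' hp)

/-- semantics of a stack: some state on it is compatible with `F` -/
def SatS (F : Finset (Finset ℕ)) : Stk → Prop
  | Stk.nil => False
  | Stk.cons I p tl => (SatI F I ∧ SatP F p) ∨ SatS F tl

theorem addE_sound {F : Finset (Finset ℕ)} {cf pf : ℕ} (hF : Hyp F cf pf) {a b c : ℕ}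
    (h : TV a b c) (he : ({a, b, c} : Finset ℕ) ∈ F) {I : InL} (hI : SatI F I) {p : ℕ}
    (hp : SatP F p) : ∃ I' p', SatI F I' ∧ SatP F p' ∧
      ∀ (α : Type) (k : InL → ℕ → α), addE cf pf a b c I p k = k I' p' := by
  refine ⟨InL.cons (Nat.pow 2 (tPos a b c)) (mD0 a b c) (mD1 a b c) I,
    forbAll cf (tV a) (tV b) (tV c) (Nat.pow 2 (tPos a b c)) (mD0 a b c)
      (mD1 a b c) I (tDel p (Nat.land (mD1 a b c) pf)), ?_, ?_, ?_⟩
  · exact ⟨⟨a, b, c, h, he, rfl, rfl, rfl⟩, hI⟩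
  · apply forbAll_sound hF h he I hI
    intro x y z hx hg
    rw [tb_del, tb_land, hp x y z hx hg, mD1_spec h hx]
    rcases hF.noP2 with h0 | h0
    · subst h0; simp
    · have := h0 _ he _ hg
      simp [this]
  · intro α k
    unfold addE
    simp only [force_eq]
    rfl

theorem addE_eq {α : Type} (cf pf a b c : ℕ) (I : InL) (p : ℕ) : ∃ I' p',
      ∀ (k : InL → ℕ → α), addE cf pf a b c I p k = k I' p' := by
  refine ⟨InL.cons (Nat.pow 2 (tPos a b c)) (mD0 a b c) (mD1 a b c) I,
    forbAll cf (tV a) (tV b) (tV c) (Nat.pow 2 (tPos a b c)) (mD0 a b c)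
      (mD1 a b c) I (tDel p (Nat.land (mD1 a b c) pf)), ?_⟩
  intro k
  unfold addE
  simp only [force_eq]
  rfl

theorem clear_low (m : ℕ) : ∃ k, ∀ i, (m + 1).testBit i = true → i ≠ k →
    (Nat.land (m + 1) m).testBit i = true := by
  induction m using Nat.strong_induction_on with
  | _ m ih =>
    rcases Nat.even_or_odd' m with ⟨q, hq | hq⟩
    · refine ⟨0, fun i hi hk => ?_⟩
      obtain ⟨j, rfl⟩ := Nat.exists_eq_succ_of_ne_zero hk
      rw [tb_land, hi, Bool.true_and]
      rw [Nat.testBit_succ] at hi ⊢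
      have : (m + 1) / 2 = m / 2 := by omega
      rwa [this] at hi
    · obtain ⟨k, hk⟩ := ih q (by omega)
      refine ⟨k + 1, fun i hi hik => ?_⟩
      rw [tb_land, hi, Bool.true_and]
      cases i with
      | zero => subst hq; simp [Nat.testBit_zero]
      | succ j =>
        rw [Nat.testBit_succ] at hi ⊢
        have e1 : (m + 1) / 2 = q + 1 := by omega
        have e2 : m / 2 = q := by omega
        rw [e1] at hi
        rw [e2]
        have := hk j hi (by omega)
        rw [tb_land, hi, Bool.true_and] at this
        exact this

theorem few_sound (n : ℕ) : ∀ p, few n p = true → ∀ S : Finset ℕ,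
    (∀ i ∈ S, p.testBit i = true) → S.card ≤ n := by
  have key : ∀ S : Finset ℕ, (∀ i ∈ S, (0 : ℕ).testBit i = true) → S.card = 0 := by
    intro S hS
    rw [Finset.card_eq_zero, Finset.eq_empty_iff_forall_notMem]
    intro i hi
    simpa using hS i hi
  induction n with
  | zero =>
    intro p hp S hS
    have : p = 0 := Nat.eq_of_beq_eq_true hp
    subst this
    exact (key S hS).le
  | succ n ih =>
    intro p hp S hS
    cases p with
    | zero => rw [key S hS]; omega
    | succ m =>
      have hp' : few n (Nat.land (m + 1) m) = true := hp
      obtain ⟨k, hk⟩ := clear_low m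
      have := ih _ hp' (S.erase k) (by
        intro i hi
        rw [Finset.mem_erase] at hi
        exact hk i (hS i hi.2) hi.1)
      have := Finset.pred_card_le_card_erase (s := S) (a := k)
      omega

theorem trips_mem {x y z : ℕ} : (x, y, z) ∈ trips ↔ TV x y z := by
  unfold trips TV
  simp only [List.mem_flatMap, List.mem_range, List.mem_map, Prod.mk.injEq]
  constructor
  · rintro ⟨c, hc, b, hb, a, ha, rfl, rfl, rfl⟩; exact ⟨ha, hb, hc⟩
  · rintro ⟨h1, h2, h3⟩; exact ⟨z, h3, y, h2, x, h1, rfl, rfl, rfl⟩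

theorem trips_nodup : (trips.map fun e => tPos e.1 e.2.1 e.2.2).Nodup := by
  have : (trips.map fun e => tPos e.1 e.2.1 e.2.2) = List.range 165 := by decide +kernel
  rw [this]; exact List.nodup_range

theorem exists_triple {e : Finset ℕ} (h : e.card = 3) (h' : e ⊆ Finset.range 11) :
    ∃ x y z, TV x y z ∧ e = {x, y, z} := by
  obtain ⟨a, b, c, hab, hac, hbc, rfl⟩ := Finset.card_eq_three.1 h
  have ha : a < 11 := by simpa using h' (by simp : a ∈ ({a, b, c} : Finset ℕ))
  have hb : b < 11 := by simpa using h' (by simp : b ∈ ({a, b, c} : Finset ℕ))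
  have hc : c < 11 := by simpa using h' (by simp : c ∈ ({a, b, c} : Finset ℕ))
  rcases lt_or_gt_of_ne hab with h1 | h1 <;> rcases lt_or_gt_of_ne hac with h2 | h2 <;>
    rcases lt_or_gt_of_ne hbc with h3 | h3
  · exact ⟨a, b, c, ⟨h1, h3, hc⟩, rfl⟩
  · exact ⟨a, c, b, ⟨h2, h3, hb⟩, by ext; simp; tauto⟩
  · omega
  · exact ⟨c, a, b, ⟨h2, h1, hb⟩, by ext; simp; tauto⟩
  · exact ⟨b, a, c, ⟨h1, h2, hc⟩, by ext; simp; tauto⟩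
  · omega
  · exact ⟨b, c, a, ⟨h3, h2, ha⟩, by ext; simp; tauto⟩
  · exact ⟨c, b, a, ⟨h3, h1, ha⟩, by ext; simp; tauto⟩

theorem few_false {F : Finset (Finset ℕ)} {cf pf : ℕ} (hF : Hyp F cf pf) {p : ℕ}
    (h : few 18 p = true) (hp : SatP F p) : False := by
  set T := trips.toFinset.filter (fun e => ({e.1, e.2.1, e.2.2} : Finset ℕ) ∈ F) with hT
  have h1 : F ⊆ T.image (fun e => ({e.1, e.2.1, e.2.2} : Finset ℕ)) := by
    intro e he
    obtain ⟨x, y, z, hx, rfl⟩ := exists_triple (hF.uni e he).1 (hF.uni e he).2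
    rw [Finset.mem_image]
    refine ⟨(x, y, z), ?_, rfl⟩
    rw [hT, Finset.mem_filter, List.mem_toFinset, trips_mem]
    exact ⟨hx, he⟩
  have h2 := (Finset.card_le_card h1).trans Finset.card_image_le
  have h3 : (T.image fun e => tPos e.1 e.2.1 e.2.2).card = T.card := by
    apply Finset.card_image_of_injOn
    intro e he f hf hef
    rw [Finset.mem_coe, hT, Finset.mem_filter, List.mem_toFinset] at he hf
    exact List.inj_on_of_nodup_map trips_nodup he.1 hf.1 hef
  have h4 := few_sound 18 p h (T.image fun e => tPos e.1 e.2.1 e.2.2) (by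
    intro i hi
    rw [Finset.mem_image] at hi
    obtain ⟨⟨x, y, z⟩, he, rfl⟩ := hi
    rw [hT, Finset.mem_filter, List.mem_toFinset, trips_mem] at he
    exact hp x y z he.1 he.2)
  have := hF.big
  omega

theorem getT_mem (l : List ℕ) : ∀ n, getT l n = 0 ∨ getT l n ∈ l := by
  induction l with
  | nil => intro n; left; rfl
  | cons t l ih =>
    intro n
    cases n with
    | zero => right; exact List.mem_cons_self
    | succ m =>
      rcases ih m with h | h
      · left; exact h
      · right; exact List.mem_cons_of_mem _ h

theorem step_sound {F : Finset (Finset ℕ)} {cf pf : ℕ} (hF : Hyp F cf pf) {ts : List ℕ}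
    (hts : ∀ t ∈ ts, ¬ SatP F t) (code : ℕ) (st : Stk) (h : SatS F st) :
    SatS F (step cf pf ts code st) := by
  cases st with
  | nil => exact h
  | cons I p tl =>
    unfold step
    simp only [force_eq]
    cases h1 : Nat.beq (Nat.div code 256) 0
    · rw [cond_false]
      generalize hc : Nat.div code 256 = c
      generalize Nat.mod code 16 = a
      generalize Nat.mod (Nat.div code 16) 16 = b
      cases hv : tVal a b c
      · exact h
      · rw [cond_true]
        have hT := tVal_spec hv
        rcases h with ⟨hI, hp⟩ | h
        · by_cases he : ({a, b, c} : Finset ℕ) ∈ F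
          · obtain ⟨I', p', hI', hp', hk⟩ := addE_sound hF hT he hI hp
            rw [hk]
            exact Or.inl ⟨hI', hp'⟩
          · obtain ⟨I', p', hk⟩ := addE_eq (α := Stk) cf pf a b c I p
            rw [hk]
            refine Or.inr (Or.inl ⟨hI, ?_⟩)
            intro x y z hx hg
            rw [tb_del, hp x y z hx hg, Bool.true_and]
            change (!(2 ^ (tPos a b c)).testBit (tPos x y z)) = true
            rw [Nat.testBit_two_pow]
            simp only [Bool.not_eq_true', decide_eq_false_iff_not]
            intro heq
            have := List.inj_on_of_nodup_map trips_nodup (trips_mem.2 hT) (trips_mem.2 hx) heq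
            simp only [Prod.mk.injEq] at this
            obtain ⟨rfl, rfl, rfl⟩ := this
            exact he hg
        · obtain ⟨I', p', hk⟩ := addE_eq (α := Stk) cf pf a b c I p
          rw [hk]
          exact Or.inr (Or.inr h)
    · rw [cond_true]
      cases h2 : Nat.beq code 0
      · rw [cond_false]
        cases h3 : Nat.beq (Nat.lor p (getT ts (Nat.pred code))) (getT ts (Nat.pred code))
        · exact h
        · rw [cond_true]
          rcases h with ⟨hI, hp⟩ | h
          · exfalso
            have h3 := Nat.eq_of_beq_eq_true h3
            have hq : SatP F (getT ts (Nat.pred code)) := by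
              intro x y z hx hg
              rw [← h3, tb_lor, hp x y z hx hg, Bool.true_or]
            rcases getT_mem ts (Nat.pred code) with h4 | h4
            · rw [h4] at hq
              exact few_false hF (p := 0) rfl hq
            · exact hts _ h4 hq
          · exact h
      · rw [cond_true]
        cases h3 : few 18 p
        · exact h
        · rcases h with ⟨hI, hp⟩ | h
          · exact (few_false hF h3 hp).elim
          · exact h

theorem runChunk_sound {F : Finset (Finset ℕ)} {cf pf : ℕ} (hF : Hyp F cf pf) {ts : List ℕ}
    (hts : ∀ t ∈ ts, ¬ SatP F t) (n : ℕ) : ∀ (ch : ℕ) (st : Stk), SatS F st →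
    SatS F (runChunk cf pf ts n ch st) := by
  induction n with
  | zero => intro ch st h; exact h
  | succ n ih =>
    intro ch st h
    change SatS F (force (Nat.div ch 4096) fun ch' =>
      forceS (step cf pf ts (Nat.mod ch 4096) st) (runChunk cf pf ts n ch'))
    rw [force_eq, forceS_eq]
    exact ih _ _ (step_sound hF hts _ _ h)

theorem run_sound {F : Finset (Finset ℕ)} {cf pf : ℕ} (hF : Hyp F cf pf) {ts : List ℕ}
    (hts : ∀ t ∈ ts, ¬ SatP F t) (l : List ℕ) : ∀ (st : Stk), SatS F st →
    SatS F (run cf pf ts l st) := by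
  induction l with
  | nil => intro st h; exact h
  | cons ch l ih =>
    intro st h
    change SatS F (forceS _ _)
    rw [forceS_eq]
    exact ih _ (runChunk_sound hF hts _ _ _ h)

theorem not_isNil {F : Finset (Finset ℕ)} {st : Stk} (h : SatS F st) (h' : st.isNil = true) :
    False := by
  cases st with
  | nil => exact h
  | cons I p tl => exact Bool.false_ne_true h'

theorem satP_all (F : Finset (Finset ℕ)) : SatP F tAll := by
  intro x y z hx _
  exact tAll_spec z hx.2.2 y hx.2.1 x hx.1

theorem start2_sound {F : Finset (Finset ℕ)} {cf pf : ℕ} (hF : Hyp F cf pf) {a b c : ℕ}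
    (h0 : ({0, 1, 2} : Finset ℕ) ∈ F) (h : TV a b c) (h1 : ({a, b, c} : Finset ℕ) ∈ F) :
    SatS F (start2 cf pf a b c) := by
  obtain ⟨I, p, hI, hp, hk⟩ := addE_sound hF (a := 0) (b := 1) (c := 2)
    ⟨by norm_num, by norm_num, by norm_num⟩ h0 (I := InL.nil) trivial (satP_all F)
  obtain ⟨I', p', hI', hp', hk'⟩ := addE_sound hF h h1 hI hp
  unfold start2
  rw [hk, hk']
  exact Or.inl ⟨hI', hp'⟩

theorem start3_sound {F : Finset (Finset ℕ)} {cf pf : ℕ} (hF : Hyp F cf pf) {a b c a' b' c' : ℕ}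
    (h0 : ({0, 1, 2} : Finset ℕ) ∈ F) (h : TV a b c) (h1 : ({a, b, c} : Finset ℕ) ∈ F)
    (h' : TV a' b' c') (h1' : ({a', b', c'} : Finset ℕ) ∈ F) :
    SatS F (start3 cf pf a b c a' b' c') := by
  obtain ⟨I, p, hI, hp, hk⟩ := addE_sound hF (a := 0) (b := 1) (c := 2)
    ⟨by norm_num, by norm_num, by norm_num⟩ h0 (I := InL.nil) trivial (satP_all F)
  obtain ⟨I', p', hI', hp', hk'⟩ := addE_sound hF h h1 hI hp
  obtain ⟨I'', p'', hI'', hp'', hk''⟩ := addE_sound hF h' h1' hI' hp'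
  unfold start3
  rw [hk, hk', hk'']
  exact Or.inl ⟨hI'', hp''⟩

set_option maxRecDepth 100000

def dsA : List ℕ := [
  29242122580496,
  99610866758160,
  99610863420240,
  99610800690000,
  46834308485187,
  99609542398800,
  99585383207760,
  99134411641680,
  90888074433360,
  99610866491715,
  99610800444435,
  99610863359025,
  46834308563472,
  99609542153235,
  99585382962195,
  99134411396115,
  90888074187795,
  99610865569875,
  99610795466835,
  99610865651745,
  46834305291072,
  99609537175635,
  99585377984595,
  99134406418515,
  90888069210195,
  99610866754320,
  99610863604560,
  99610863620115,
  99610863603795,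
  64426494542128,
  99610866492435,
  99610863358995]
def tsA : List ℕ := [
  40990732140477755546124382954060730541381304451071,
  95704415697906625398458310394153870263,
  13292279958042586860896987554743691943,
  87729047723081073281920117861584538293,
  98362871689515142770637707905102588599,
  87729047723081073281920126932278643381,
  87729047723081073300943322687320689333,
  87729047728187575943972311495266601653,
  438645238610298863728525181775318682293,
  255211775194417667729222161051076985843,
  425352958657362779548703601751931290353,
  510423550388835335458444322102154040177,
  595494142120307891368185042452512965617,
  425352958657362779548703606218560963313,
  425352958657362779558071088976725607153,
  425352958659877345253502030435183821553,
  598152598109401843026198519588239770353,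
  5447176326805852095595585499933920573989,
  342940822917498741011142278916746840677,
  5784800237740133801862368983824407698017,
  5787458693731742319234548381335356283493,
  342940822917498741011142421848896375397,
  342940822917498741310901870110164978277,
  342940822997964843564691996780827839077,
  5872529285382748772290979649678618200677,
  87729047723081073281920117861307714295,
  87729047723081073281920117861307984565,
  342940822917498741011142278912384768629,
  342940822917498741011142278912384797413,
  428011414648971296920882999262743694069,
  425352958657362779548703601751794975733,
  425352958657362779548703601751795108593]
def ctA : List ℕ := [
  1210967269260383431915633080310980700128316037616876896477369091968224035999065432840008704876572021379835152,
  226494200413701133230051861275500655337030293570774858500856961381460047950920392535999417940079650537472,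
  45475435961466412117007401623187038537061286666755404940413968567235755728261412642168211099093042992,
  1554992061654635091906800323391135707237540454509301134611085694568951036690263738145954064847482912583453232,
  1064756732493015081200236521091474266823409479810905965360277285731539554592330991941023989506693145158485041,
  762951211785513879757008683634119179491840775252961190660635020373686807936666552920557452128528047271839570,
  762588569800294143906839182233215069276387478027255946372371744573755943254777325947788010479717193892233216,
  255330913695529161648785324112174030607609957587897979100429135282950649365421189589598474213752146233154,
  1535497323422991458129950165943766517041259732545917088761451507369401868806226392000278363739865180266301728,
  223974494130672830015358101655780851829494015503294969780398100252796202177668088058242488915598759691313,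
  150202897258205912741786656486220994573226053766476101262431988149103297052977078800575038884452530915136,
  369927562007619904126694066433954062112954219223669706590564578736064249551929353977239780232733890473984,
  339041378422327181958805111069265063911610406206680612016776683591747029206818304220958694386748184593984,
  331622223518938805161533517039252339762522446782844308310735394948341120182927686127676228578526789372294,
  219494984736619275274157454488745568578163935504255045563526353417254163860651887905003491264563289333760,
  752842460534209692262484611111009048178966872955755849293179468723965875986101585292698570591645181293889856,
  1397887406461167494347633284856687376941153291024067584311624514906738884619018060142915268267004085678428172,
  255330911565143974662778952782982113239889552587535849588485114188169890191308925362140150705609409430288,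
  109747507869306738823011199319400375952294525937624848188969105790524163233624231678991395433114219188234,
  291166827439988842031705617822437464640526466110236292429073589788399489265511445754141483423964864710688,
  327002738899420763590558095507881410768526634188283153939761212878392530654827746345049680171224228040704,
  7456190081365777016805774700230723914573080194828963940453144388296480153660474681575930677448834082693120,
  1241929500578965663779179499719144667329699949870290778046198599708076186091171807255093395436783955009018433,
  45407084376316942995852899759169618667929183490172757038713160318429466709261015593046291966228171072,
  1554992061652490761305797628643281308771814266770619324507339349161290840588341281972562997407205658112035394,
  224254455398997683165528016941926996593266198418614437800699342515172953968280333329839317277263037203760,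
  259810401178578404760290683799347585836812801067767513378137819197087112824077247966885360876661568963888,
  1554418687004892860701026682999223899432121515999592900643924075948353700852200409910030668454385830662963200,
  295692272408484224125270698514449245272943574383946999037310469113152209767857049878648721085305131632160,
  188278553475244227245997678230132157084795605227126843361680408688867597767279710035335493252347238547456,
  771188909647003486021058510948891511390058082071317991798996324839892815059285800961343087681080883376488448,
  26815720214820637066922791439393007140294951581650747719837268729810654823627280003355904287489132662,
  185898833091639452538225109346376102088732295967610206697911218032869527060903132988880963498367940299330,
  761442241326325570245679694213876809441362590370887674762074658092265848037195265535948584141076586442616832,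
  449893130192353474292144776220397981992614493556337167280430679963453418622668095782707152847012343333258529,
  185898820147738414479976310910018093501018053313167513831238415544349354412541042959038042638840770854912,
  260090373676824926309422645283569406208087029704026672677215759753048633013567389020214483478635691902241,
  295646327861337934428168696771956803068087475828390313692598099430983205229987647842738179777742915240720,
  17201285073729661251423296212976290984257567014075449084660009985140468280366471888378455518535305866469376,
  185898820147707858940315642230807351565395464854925574035674116011127158548063398676510250887828143040800,
  183825868353274499966437100043888468828221634168662859924399811265892971540439416324317344103397377181248,
  303250898276445854444889276658195555793787933416220944305652693270424897915195866493282981910098487543090,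
  341466474588269625584978341974104218762484699735378428576705319331032322473247885524634692889456274311542,
  379663543106448913553493779176833375787749713782235409402950758257678038522486533072878786951089680812679,
  7458394830342320735512946581862556048314251439001015139884204277958398600949699394963041995008793167006086,
  449857210955899003890084379594965368386988689861904266868858277531795775882637086624834611933755504709404736,
  1397887489219718203512821907760593291624380710911908157587686345827587594331994074685674623341344802809578529,
  367681426392229836463737598991041097741291455770199779539497842977221234672675186960574860460831092011008,
  139984048505936149366525530046990301573670722486124023236114897237267446905903967527211145548335177728]

theorem okTA : okTs dsA tsA = true := by decide +kernel

theorem okRA : (run 0 0 tsA ctA (start3 0 0 2 3 4 0 4 5)).isNil = true := by decide +kernel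

def dsZ : List ℕ := [
  23378212722806]
def tsZ : List ℕ := [
  39523476932663619484620309926976579370619941945359]
def ctZ : List ℕ := [
  70538839730361465540142576646715185841502592702429535497655081468140423572591409172030851909943850580,
  83354763054034563411462455291546805528122812701079319634023523306693222853691733209341735797967648868,
  73956420615426763967944874044889065381525445977126191845154125522118593227115234889112758658025211749,
  377117020969436401101697364850087104642263109287392836769682839086340449147589853995603870003747233417829,
  6278065531462166183354734124625663339280251895493150378646]

theorem okTZ : okTs dsZ tsZ = true := by decide +kernel

theorem okRZ : (run 0 tAll tsZ ctZ (start2 0 tAll 0 1 3)).isNil = true := by decide +kernel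

def dsB1 : List ℕ := [
  29242122580496,
  29242106851856,
  29241603535376,
  29229523939856,
  28971825902096,
  23817865146896,
  23378061334646]
def tsB1 : List ℕ := [
  40990732140477755546124382954060730541381304451071,
  38056221681293340456602288274105179380510108943359,
  32187291359701880626571240551669279468885488174079,
  20461291925371602044998285937475768865361038935039,
  80194873530491029000711069374022929091129246719,
  1360967228689348826809512405925474862079,
  43925243993458745564092833659208243921434758349823]
def ctB1 : List ℕ := [
  374957657686147103673646845187169787732931856260559073943273657924944124994813573894626534870660319216944,
  18076171055507672397008275294674443545331525852931545479443370446522839838930367206189785231327232,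
  379356788050793676258964400049961837439701038669249435675939580402120631624339568184963155269745884790784,
  1201793274801267055670011842813662377511008474034282667786644546681386274382557093088244916957768150944976896,
  379636756418906776380508868676758569754472910657929560925627946450881253285585931770860484574852172221077,
  109818612191061777680115542013768471308120311995498211902195752886274455826366737208105951473076837422656,
  1202050845492499505794458208178608965062182154805716626109232568147666511871672085900352807720395764903445280,
  379636756410563077019500115132402435489135849196286845782772372508950526867851295110136264387490144586389,
  111987243654589579902491698118866183499635299876127035374922417277752159254189034423083327969457298609984,
  372577946385981806166999314135939838006025379992922712089407719287229175995459956915935261902507358554469,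
  3856889531759278354471977130545810754096193856974612849599438334404993409093485548889146851328,
  1339976566414802363545709254477905659583549408366394661639259015682170757355234217051570712621532498123427840,
  1232182196153513716795033789108994755832278026598524747778093411462334593335086233021100379668052246221816592,
  374737292179481052786923785138255954632064135783846037482536970479275549003640262190045110450973636034560,
  109836110196860016412001276624848702539526459688818084846641903007891117142896546668792275003512694246021,
  1085617891131787773620810865567061647568178607898769095526223682527558344722264393459366417107990362556728096,
  336661649489211515890980138875356026927502908364689260567344724244233647935689333357236769966026953588736,
  1555251872038036070037909798401273441966647464591658648986765818887326020301215744760795521838597243670628741,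
  367318157475040370658451179216523433897868995582988398216246644753255701325444684634389714256221360357376,
  379636756418908116403683736973920980694629789966533823684432513944998047071329216292885400206065001562112,
  303205453283267285677884779864977692813375099667870169042096443879574355022476464123991056431517009055744,
  367318157475040370658451179216523433897868995582988398216246644753255701452209751608535747894822016520192,
  379636756418908116403683736966683975117297527752168318262927852156428936190776201889412903990291428802560,
  303065469236881172914724939722440398198822406148294862961966533614563290886236920267436546243208460505088,
  109837169646429814782409997840576639741027588695728337013563757585843716558797260434017916808998521278464,
  379216804129563061341651519745371593845807800481392745312417382459563024792986176489535157747331299803936,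
  109828438265428535213984940319519701426991756664042103560472352921908186572820121122458242656698397495296,
  145637030060108380456316431718008338678728925629687986046738928443543402241829898444468553023535966061344,
  145672026071704501836649979395682628739334677245987820667479638538823189677669323232268471876695755850784,
  145637030060108372499144174877024548145476498726861904594779673150160640389493360013450177161005822379040,
  145672026071704501836649979395682518311393128596967125930414537988362303063236571536201749379194420200480,
  338901394364888637161350568908680548576201238987942879807563761757846763555921356393269908520054441378848,
  919308129073558008143593514868362195912737165024741127975066321961784802360182219478807535607870869496400261,
  109819774168009276382715250814793280321974205122089046915791449973547322457071334337199097997844843332368,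
  377257025360857167603065074114566262195125714336183372661909687190810178080860336699290815620990009082656,
  150291499602445815713194605322310986051849678934024721064466893410333046719540237728926145130631092243095,
  111987243655180320335626179447425034241610345527415007090660255956628527411386459612596334019658630828032,
  376977057251397543358613285663457527579221810900960419384159655164636269362397219719053528095456596331075,
  367738109639229807025128864697192263830989877952987887321131575816593688123398673515035339514363389284352,
  150256503590850101143267445727072553617346025981806456354276057356803571913350217165078966935945934548992,
  109828540817837357494867582999517441658774648703198703755559653817114547078251452440649871090124152898610,
  338901385261912645065251701076117972067498338695827161912728958447748810655720698138058516708038142853920,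
  752840920705415933563725252467457625421561008975439887508220325800574026293555329435560670288064416187419253,
  1193192654986765314372287710720031612779986481217774270131560862384020220253317795565052713368041905352344625,
  303065469387067777696332624586542281188972341928337428380469768370533225586225421354177012871490577630257,
  379216804129563061571501151291547101883279024910319377228384208262569495677807127993255796002799925332341,
  1525749954309881344211073173855194067143868135283454853928443920296326449423502478295249840488408117906770584,
  145583414786213680969807830545283868805417432862632615070884793907637938641186185867922587406834918754421,
  1193192654989176643487057800100602073691018392920333548648281227955064817488727967735944844130107843684598833,
  145583414788299605480687500765046469768034655300659183357085168490008733100226782854366143553116296971024,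
  1378966042886650266657725686321744228938388584608856699817751658637409330676533521420353398612934634030236721,
  109809863193681664714683956047789293397273185514745017835198767045052471094527188734325204660433130097013,
  109827361193960095112302793281994073276993192815597961363556252149639137587339950925010198752827763852304,
  379636756001723004226706128014371086770579284485997594490437678172412060796742549206156378158020591354896,
  1554418779091036924234948048699254112740860929281740510843270973695552388612653926089331130487858107307741184,
  109836110196859218208174439364865077456600051396029840391759772970989661603730550375157480136249811537920,
  1241929592594033128493791421363963637154753423271668219517113877480443891574972443689049535238995031328031760,
  150202890449746718515456805291322433675561973036127240772730503650858613137153209438114287033554377924608,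
  1554992154291847123308607620354105434913272578171023548899423115305861578651523477607095718200159937704756000,
  1545244785139714046253697150188879993740038419587028397916982203079410248007617083560395010003973387489251328,
  33063483095482389590016]

theorem okTB1 : okTs dsB1 tsB1 = true := by decide +kernel

theorem okRB1 : (run tAll 0 tsB1 ctB1 (start3 tAll 0 0 3 4 1 2 3)).isNil = true := by decide +kernel

def dsB2 : List ℕ := [
  29242122580496,
  82018678686224]
def tsB2 : List ℕ := [
  40990732140477755546124382954060730541381304451071,
  91703495501360353759420709934318103520824269953]
def ctB2 : List ℕ := [
  181490956577640124484547181229059252287611144730863670655690187300211395948085334131662909701686475031312,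
  1339976637512027346271901076051413417120280640889258335263399799595554741899159509580669484928537455988049184,
  150274001596648357281483054638427079443660482708234945884933443861543707937301193318825468337087836196864,
  899775035038058987181638982676328904004477764291833843856779525440094355892205838706756757134424249250876054,
  1486760477837203830392849696576539721521091329978111546938757651405253141574347851769681251621902421408188193,
  4413144612217265857903202580248518464697073359086578277222816903334204084986683483677811552256,
  379356788050793676258972018243126990013142565715046091627141899694399907133182304776337891801066991779840,
  377257025360857285966001950092546036741981076783693544337482639481720458724994267005490953150217573380096,
  181508454583437701279195607889509455448930892168662699109898653150141927583661990507335369297723461208727,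
  341281127717456112717573027509018716321194921420284122032947355226962159281862562098825833623480168484864,
  291306815759948634003323877266195124531931113487784626633842340446424724702302714689030009280609057378304,
  379496772239021473872405976641804549775559822095715421411874131884586960663333759484920045219372773411105,
  147963143718254189571829543019707272261877503246201360517540982094574702404043170776979645078365930523288,
  1201793274796285866593160725037895160766854921730402843392836377203917185706196959971868117700261045277296758,
  1046556734068524034012806075924313248400167305245656580193921549148590300355673040584324496169492428682691856,
  303285313299568747420064717260704926768021101430622019215087606200326599275883850978166262362266679642230,
  181491503390321030795371306091814050463936358640496074067061978290712302197858066336825470660731432077942,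
  1193192654991446130518387451026522101695266358025545813142941614887134783732902775116925083036102286165148960,
  188650375012536109811511065516389469805695865374102729765049035825538329358458639566128879597281131628918,
  367318159477529167716388525108253125480925202109373165636370507922726057358894458000376182337681217292952,
  293406572468101312168390829110166604526021001489034098676938407781329289553637750622838351421599969202176,
  374877294294464097947340912443395486055822050631256484146014327728724031369315597096164509935553336052016,
  1348577186221786431024662290368171129349780404564611416236726114857891923509483149626773945970285840865439744,
  303298026694406277635712267306754317835537444779025792942627935934578591329021043696518305587700325943360,
  379496760996636216507206047899346062657016964815212563830943963674395782544173396996567452533194143828064,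
  329242492456911444766817661504029701516341244078001088164897510225661761921943607318926320841146165627459,
  377117041309913671235729535522281386412331110359175275596140430424128982012320854136074620457490117308416,
  335961733220539047054883918710598598823508996943860227542218790529323201541930241129546145364919199490048,
  188650375012535990453935335020885266301726866860788464782438325668421764152960881287098757536342737946736,
  1506255216068967860022375229617099405245154843769953292505480308626439116785808117317511759634883921978591879,
  1397887489219723166590577254698040036490664082694903870383742429628163598814050119967258370201844622907411094,
  331902185224836395822918936844848793039285789952495518359707085689952320012026552893990716650852975915008,
  257661416255526904028999396164554246007718488665453653784689825164883825136043418433125072478210696939911,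
  1535497415987580447717255549352964480851093579834432032144339732535474632536882095670789119133952196334323760,
  1522883081039167852944497568325416731521452576432846088174086968760792645759548388324887619911687062212337664,
  224394448275838188871003108001966228108805928913342151201692011295445314925588456167051320002976992462147,
  92103765957240707630400362627545124247378343226288132773304085802521115105111054123624324432333647872,
  377190293863469346186443255671674958808327359688717125088247314478968719297078542619342458830130927655285,
  1397314031809444807487897030882339561611755925779897024986628216111030798090408917712137995163884868629170755,
  341354377988624341058987693671679973351514158424216002679591517940844420392604219247902139273696104636416,
  374932060017508627775018322629339502335858786689568714611638528369107060793494379353978025800406463940931,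
  1082531346763069401757684376376359940079298769726245803366837891598663481360857387304490698517591436573560832,
  919119653712784214349660430351044573203332573440622397764510502247551960638529993788714861862926153007762038,
  1388713411995368768683394900216682436717762597517707050985033258793125648580848262412095190865572780464943104,
  296130782003010532044729971596830751607960214311436390530213831813814720260739576151347251877089304905283,
  1554418779603673152856210695719123327142724312949342950432082921485450303867429746638445871270080458281453686,
  1359471304647614114944381175422197056394481163235162792251904440234972092271130656917975319478501070335901696,
  1554992153164041001360326466123611184198423209382329730233618770153244068906680128624786877549880630153579160,
  379577780556947717461799411014987552013530406838917602863649454267144270697433388197043608733166740836352,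
  379580070335050066031304556108110250134910033822853279178775974552233488082718291068863625561917513271920,
  302365562685624634618182384253320922944414747655997572845416283629493743871292108344605786738966519111680,
  1046408832163305763271439792887504758221148088255422236013615920720945685870583224922085747908598334478092848,
  341502119939924926524747325266238068865571991837867495277071334716617390442127531976729467228451216953344,
  329242499716392294320913774056456945114354231937822324192614793782605031205158084981714986413178657136640,
  1506255216073910074216569483418562448412152664554536945491220125669517443924653807079615495565319602086096896,
  1212687439261837278693362598805760588189366803384947451292022148907257692248498964244157156920783147450239622,
  919119660137830997202679533366189403536124378944688645587368070517372153278086317060065213526602562962196870,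
  1388713475514789962080859486300355255302190324100640208163571448866783988588266121144726382149488381796551286,
  899624924806860535514335673818101438247132558495086966708538782083738837396854665798929859876933522218835968,
  62370826973332471386040830008228078074705499203281989352422091636521249971038195977999092267287052288,
  1193192691092647456579762453274009134371108483329907894534106702187757194314094089019405153380119748535400240,
  1486760513939378241858982003343760112057584905627412480740737314103187777763137508819818082644912233083318272,
  36123814384210595032691228426633918281781740072281778987702310884151275121049136708040692962154524672,
  224394446704332979092967486604666860634796671849963489115733484253331805361581571264751545101252499216704,
  1388713412001771212385221645395630210563494815348831074822186051725231230498624137351716612247148668388925440,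
  377340325592872151414988662723119612851568813058656682232774629062250758441841502161647533166064966830727,
  1553845404402864101923143123906114838300739649033713138619660664048789756127613384451529443940135271641145344,
  606057036667833173450294840795333983296788936837561524617147641272439077170611978850030864601607413609033728,
  4364550696403694767099112750103860369383424]

theorem okTB2 : okTs dsB2 tsB2 = true := by decide +kernel

theorem okRB2 : (run tAll 0 tsB2 ctB2 (start3 tAll 0 0 3 4 1 2 5)).isNil = true := by decide +kernel

def dsB3 : List ℕ := [
  23378061334646,
  23817865146896,
  28971825902096,
  29229523939856,
  82017535878464,
  109578054825556,
  116793599882836,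
  117180146939476]
def tsB3 : List ℕ := [
  43925243993458745564092833659208243921434758349823,
  1360967228689348826809512405925474862079,
  80194873530491029000711069374022929091129246719,
  20461291925371602044998285937475768865361038935039,
  91700664356055214340172809821523186974810177719,
  269002738962467939954020418270254716506079415,
  356812022872504159186766737980073474483290295,
  91343852432873532073064286163825903520607895735]
def ctB3 : List ℕ := [
  374922149037661887325797719508433872524653175731088490521967649862377874645540003787098361919414126119301,
  1554992201647233770491050559630195390931090308533150892662985584942817935880156454918404089086712021977664152,
  772335658954280963631984256139268861490544988176793003196927897343338830924825203438639836137349580589107745,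
  327235401162153086147370573193729236862303065973124334002286525680904113587689176014369200866404308355736,
  1550405064431849706264733703550217642832475590495863097642623900714329676533252276104523081387121266680400195,
  367738101100235989963216725123996231636430919039962030377627215351558984445112676494323115897753624905761,
  331902191633921947444569143478280439551551256030591201528312762630084368327737571794242991232048707930776,
  339122391151361139849717462978436691967493332873249890239171288399016454333656560352663059093083647246336,
  331553854309006849147727811590156509785508725855849942497606725916901419290425871976376858698942188096067,
  374737314378209210194358466122059279345042841730596730260300824357206537712350142883258480147429737892416,
  327142734481037411108442400156469408477225092928312440557054981716368458262756026383887136535054280818688,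
  374877296434862047324849426036652470284885921202343457520080867714101043411036637899417642540971690297889,
  79834655691614766077003004931613820342976597067896228841678024572503016189157140462235077645918756864,
  303205466391219810326191179001279470682393447616267801567345434995489791501804274639578890463130270439264,
  1394788439797937240031980304357390301849278258191138674802739407706681281912393436619486390150992741880049664,
  365078415603096079632811114352195622358363470707420535406932764901862673141912237516954267395798782183969,
  367738111497055108944400927949628195459683808765613156962626009606095592218998538067000531462171404536384,
  338901398932087770844030496490977438118904835918356127666386839287833818186079474979497748838964030087169,
  1073736709151595555624743558620014067622945529118398781117594252175611043681294710870932579988117020246804784,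
  1232182131458312844792596198357390132772557176171740969716727250320902548592164395173643031938603899475199521,
  379728598329580023567489715465012849200006551102688754926169747236398941484533392108613311180987882233857,
  1212687393224816909791717676872754091056948201352520738514903482036777239066495811355955745565699431079085635,
  1534924031490949183782197258567059075159138276453644983885723841800877028265323917179347560414015996628568181,
  327142739037933741996153576506332751219477921175038032568215773876950801880712002952501859114922029547520,
  303065482061147774602640971016826692508275053291355246266944402711325456912206561225454704263184586964992,
  71085653802852562641416242138864599273490316635817208352129809163499266435053418239944116509662646272,
  1525750885714450873245804763755941787475873512320304960781560412154628077120521363579824691053093395768678784,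
  1388713504085754119002520407887178917641341705032166686642094248055080902322966659880478997114663305629140560,
  226287662809363144965004653434224350819170846894759614959090003764334982049162062330171670985537037422599,
  338975366897054593732937105352009786210862443917087796311668184138883409340720301110316287418446597541888,
  336661645047509171606459660564812831036277492253561013656131911717848703979649015626641023055118776881152,
  367738109639230478170948070449680708497402733195017121381447204302166834844226452535955548789507341945136,
  291399500789900449086373930244512380171767042777965972229334322042926988082023943830745329288760561774592,
  300896835508105504442569556038868177219029814914463693737526193507177803118802053525419663680280241113377,
  88036846398439695121261394002280599527989854937196708531354749690741508762559221440915128866945632545,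
  1146889313960321374723531214827058685715028982230624698803689783633876473855867891465228122474827192011143,
  1486760557707019223329776910002493090311163595252795115867259386005753068882316111317708205483017573065099911,
  1232182221220477843253162794858065750177967288130172059613852558615785114263794954967274302551152692044107776,
  1201793274796869925972512094818072645584553022552925549043739699202123603956968762822612036524711604998113637,
  150273420608174409568070674137585004237846572848684629353596554365343698898187886527493538565986543732803,
  1339403191758410203832397014728049076479311970953656494779954740755748731033580909700694725417195516637218883,
  150273420612996948197092258943081949160381619726489422040829839088004874366326243980676419388641667713091,
  327231846871381758617665954182088184221589485669470690539530078540583561851899612049447027076138476243011,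
  336661651345718107062379392857903150071600949143448959469927674586584044888591719944066706946674005117507,
  1504535092111126427444443301278630834150119294980882447679896791374755431516503509042412521588725825407221760,
  1193192726601300177594251474015652456587121122256503860121354352634661547132489655966304293319862886238060544,
  1210967340328410518020910696612629108393716714167803868963413232504426582713364115190384361373599638516400912,
  367738109927745000669368174294913084779247919149890745510940017874733994910357354770249535190922271264768,
  1506255216071684391211005501516829823849886759913484599753307315310673960358716686747874362184416911306272768,
  1201793357552572019755568444594024300594260560117933931159130175230201818163037028946779354581538223899545600,
  1183445368624651447662681878439454712563054983152689476999820746680366298181437849502804873494377341481385984,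
  1496577687864330342498383564096505570601545104490496]

theorem okTB3 : okTs dsB3 tsB3 = true := by decide +kernel

theorem okRB3 : (run tAll 0 tsB3 ctB3 (start3 tAll 0 0 3 4 5 6 7)).isNil = true := by decide +kernel

/-! ### The targets -/

/-- `K_4 ∪ S_7` -/
def XX : ThreeGraph := (KK 4).dUnion (SS 7)

/-- the targets -/
def tgt : ℕ → ThreeGraph
  | 0 => SS 11
  | 1 => (KK 6).dUnion (KK 5)
  | 2 => G1 11
  | 3 => G2 11
  | 4 => comet 11
  | 5 => G3 11
  | _ => XX

theorem tgt_mem (k : ℕ) : tgt k = XX ∨ tgt k ∈ L11 := by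
  unfold tgt L11
  split <;> simp

theorem verts_range (G : ThreeGraph) (h : G = XX ∨ G ∈ L11) : G.verts = Finset.range 11 := by
  rcases h with rfl | h
  · decide +kernel
  · simp only [L11, List.mem_cons, List.not_mem_nil, or_false] at h
    rcases h with rfl | rfl | rfl | rfl | rfl | rfl
    · rfl
    · decide +kernel
    · rfl
    · rfl
    · rfl
    · rfl

theorem supKK6 : (KK 6).verts.sup id + 1 = 6 := by decide +kernel
theorem supKK4 : (KK 4).verts.sup id + 1 = 4 := by decide +kernel

theorem card_three {x y z : ℕ} (hxy : x ≠ y) (hxz : x ≠ z) (hyz : y ≠ z) :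
    ({x, y, z} : Finset ℕ).card = 3 := Finset.card_eq_three.2 ⟨x, y, z, hxy, hxz, hyz, rfl⟩

theorem shift_three {x y z k : ℕ} (hx : k ≤ x) (hy : k ≤ y) (hz : k ≤ z) :
    ({x - k, y - k, z - k} : Finset ℕ).image (· + k) = {x, y, z} := by
  simp only [Finset.image_insert, Finset.image_singleton]
  rw [Nat.sub_add_cancel hx, Nat.sub_add_cancel hy, Nat.sub_add_cancel hz]

theorem gB_sound {k x y z : ℕ} (hx : x < 11) (hy : y < 11) (hz : z < 11) (hxy : x ≠ y) (hxz : x ≠ z)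
    (hyz : y ≠ z) (h : gB k x y z = true) : ({x, y, z} : Finset ℕ) ∈ (tgt k).edges := by
  have c3 := card_three hxy hxz hyz
  have sub11 : ({x, y, z} : Finset ℕ) ⊆ Finset.range 11 := by
    intro w; simp only [Finset.mem_insert, Finset.mem_singleton, Finset.mem_range]; omega
  unfold gB at h
  split at h
  · simp only [Bool.or_eq_true, beq_iff_eq] at h
    change _ ∈ Finset.filter _ _
    rw [Finset.mem_filter, Finset.mem_powersetCard]
    refine ⟨⟨sub11, c3⟩, ?_⟩
    simp only [Finset.mem_insert, Finset.mem_singleton]; omega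
  · simp only [Bool.or_eq_true, Bool.and_eq_true, decide_eq_true_eq] at h
    change _ ∈ _ ∪ Finset.image (Finset.image (· + ((KK 6).verts.sup id + 1))) _
    rw [supKK6, Finset.mem_union]
    rcases h with h | h
    · left
      change _ ∈ Finset.powersetCard _ _
      rw [Finset.mem_powersetCard]
      refine ⟨?_, c3⟩
      intro w; simp only [Finset.mem_insert, Finset.mem_singleton, Finset.mem_range]; omega
    · right
      rw [Finset.mem_image]
      refine ⟨{x - 6, y - 6, z - 6}, ?_, shift_three h.1.1 h.1.2 h.2⟩
      change _ ∈ Finset.powersetCard _ _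
      rw [Finset.mem_powersetCard]
      refine ⟨?_, card_three (by omega) (by omega) (by omega)⟩
      intro w; simp only [Finset.mem_insert, Finset.mem_singleton, Finset.mem_range]; omega
  · simp only [Bool.or_eq_true, Bool.and_eq_true, decide_eq_true_eq, beq_iff_eq] at h
    change _ ∈ insert _ (Finset.filter _ _)
    rw [Finset.mem_insert, Finset.mem_filter, Finset.mem_powersetCard]
    rcases h with h | h
    · left; ext w; simp only [Finset.mem_insert, Finset.mem_singleton]; omega
    · right
      refine ⟨⟨sub11, c3⟩, ?_, ?_⟩
      · simp only [Finset.mem_insert, Finset.mem_singleton]; omega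
      · rcases h.2 with (h | h) | h
        · refine ⟨x, Finset.mem_inter.2 ⟨by simp, ?_⟩⟩
          simp only [Finset.mem_insert, Finset.mem_singleton]; omega
        · refine ⟨y, Finset.mem_inter.2 ⟨by simp, ?_⟩⟩
          simp only [Finset.mem_insert, Finset.mem_singleton]; omega
        · refine ⟨z, Finset.mem_inter.2 ⟨by simp, ?_⟩⟩
          simp only [Finset.mem_insert, Finset.mem_singleton]; omega
  · simp only [Bool.or_eq_true, Bool.and_eq_true, decide_eq_true_eq] at h
    change _ ∈ insert _ (Finset.filter _ _)
    rw [Finset.mem_insert, Finset.mem_filter, Finset.mem_powersetCard]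
    by_cases h3 : x < 3 ∧ y < 3 ∧ z < 3
    · left; ext w; simp only [Finset.mem_insert, Finset.mem_singleton]; omega
    · right
      refine ⟨⟨sub11, c3⟩, ?_⟩
      rw [card_three_inter hxy hxz hyz]
      simp only [Finset.mem_insert, Finset.mem_singleton]
      split_ifs <;> omega
  · simp only [Bool.or_eq_true, Bool.and_eq_true, decide_eq_true_eq, beq_iff_eq] at h
    change _ ∈ Finset.powersetCard _ _ ∪ (Finset.filter _ _)
    rw [Finset.mem_union, Finset.mem_filter, Finset.mem_powersetCard, Finset.mem_powersetCard]
    rcases h with h | h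
    · left; refine ⟨?_, c3⟩
      intro w; simp only [Finset.mem_insert, Finset.mem_singleton]; omega
    · right; refine ⟨⟨?_, c3⟩, ?_⟩
      · intro w; simp only [Finset.mem_insert, Finset.mem_singleton, Finset.mem_Ico]; omega
      · simp only [Finset.mem_insert, Finset.mem_singleton]; omega
  · simp only [Bool.or_eq_true, Bool.and_eq_true, decide_eq_true_eq, beq_iff_eq] at h
    change _ ∈ (_ \ _) ∪ Finset.biUnion _ _
    rw [Finset.mem_union]
    by_cases h5 : x < 5 ∧ y < 5 ∧ z < 5
    · left
      rw [Finset.mem_sdiff, Finset.mem_powersetCard]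
      refine ⟨⟨?_, c3⟩, ?_⟩
      · intro w; simp only [Finset.mem_insert, Finset.mem_singleton]; omega
      · rw [Finset.mem_insert, Finset.mem_singleton]
        rintro (h' | h')
        · have h0 := Finset.ext_iff.1 h' 0
          have h4 := Finset.ext_iff.1 h' 4
          simp only [Finset.mem_insert, Finset.mem_singleton] at h0 h4
          omega
        · have h0 := Finset.ext_iff.1 h' 0
          have h4 := Finset.ext_iff.1 h' 3
          simp only [Finset.mem_insert, Finset.mem_singleton] at h0 h4
          omega
    · right
      rw [Finset.mem_biUnion]
      have h0 : (x = 0 ∨ y = 0 ∨ z = 0) ∧ (x = 3 ∨ y = 3 ∨ z = 3 ∨ x = 4 ∨ y = 4 ∨ z = 4) := by omega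
      have hw : ∃ w, (w = x ∨ w = y ∨ w = z) ∧ 5 ≤ w := by
        by_cases hx5 : 5 ≤ x
        · exact ⟨x, by simp, hx5⟩
        · by_cases hy5 : 5 ≤ y
          · exact ⟨y, by simp, hy5⟩
          · exact ⟨z, by simp, by omega⟩
      obtain ⟨w, hw1, hw2⟩ := hw
      refine ⟨w, ?_, ?_⟩
      · simp only [Finset.mem_insert, Finset.mem_singleton, Finset.mem_sdiff, Finset.mem_range]; omega
      · rw [Finset.mem_insert, Finset.mem_singleton]
        by_cases h3 : x = 3 ∨ y = 3 ∨ z = 3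
        · left; ext u; simp only [Finset.mem_insert, Finset.mem_singleton]; omega
        · right; ext u; simp only [Finset.mem_insert, Finset.mem_singleton]; omega
  · simp only [Bool.or_eq_true, Bool.and_eq_true, decide_eq_true_eq, beq_iff_eq] at h
    change _ ∈ _ ∪ Finset.image (Finset.image (· + ((KK 4).verts.sup id + 1))) _
    rw [supKK4, Finset.mem_union]
    rcases h with h | h
    · left
      change _ ∈ Finset.powersetCard _ _
      rw [Finset.mem_powersetCard]
      refine ⟨?_, c3⟩
      intro w; simp only [Finset.mem_insert, Finset.mem_singleton, Finset.mem_range]; omega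
    · right
      rw [Finset.mem_image]
      refine ⟨{x - 4, y - 4, z - 4}, ?_, shift_three h.1.1.2 h.1.2 h.2⟩
      change _ ∈ Finset.filter _ _
      rw [Finset.mem_filter, Finset.mem_powersetCard]
      refine ⟨⟨?_, card_three (by omega) (by omega) (by omega)⟩, ?_⟩
      · intro w; simp only [Finset.mem_insert, Finset.mem_singleton, Finset.mem_range]; omega
      · simp only [Finset.mem_insert, Finset.mem_singleton]; omega
  · simp at h

/-- the edge set embeds into a target -/
def Goal (F : Finset (Finset ℕ)) : Prop :=
  ∃ G : ThreeGraph, (G = XX ∨ G ∈ L11) ∧ ∃ f : ℕ → ℕ, Set.InjOn f (Finset.range 11) ∧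
    (∀ i < 11, f i < 11) ∧ ∀ e ∈ F, e.image f ∈ G.edges

theorem okT_sound {F : Finset (Finset ℕ)} {cf pf : ℕ} (hF : Hyp F cf pf) {d t : ℕ}
    (h : okT d t = true) (ht : SatP F t) : Goal F := by
  unfold okT at h
  simp only [force_eq, Bool.and_eq_true, List.all_eq_true, List.mem_range] at h
  obtain ⟨⟨h1, h2⟩, h3⟩ := h
  have hlt : ∀ i < 11, pdig d i < 11 := fun i hi => Nat.lt_succ_of_le (Nat.le_of_ble_eq_true (h2 i hi))
  have hne : ∀ i < 11, ∀ j < i, pdig d i ≠ pdig d j := by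
    intro i hi j hj heq
    have := h1 i hi j hj
    rw [heq] at this
    simp at this
  refine ⟨tgt (Nat.div d (Nat.pow 16 11)), tgt_mem _, pdig d, ?_, hlt, ?_⟩
  · intro i hi j hj hij
    simp only [Finset.coe_range, Set.mem_Iio] at hi hj
    rcases lt_trichotomy i j with h | h | h
    · exact (hne j hj i h hij.symm).elim
    · exact h
    · exact (hne i hi j h hij).elim
  · intro e he
    obtain ⟨x, y, z, hx, rfl⟩ := exists_triple (hF.uni e he).1 (hF.uni e he).2
    have hb := ht x y z hx he
    have h4 := h3 (x, y, z) (trips_mem.2 hx)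
    rw [beq_land_pow] at h4
    simp only at h4
    rw [hb] at h4
    obtain ⟨hxy, hyz, hz⟩ := hx
    simp only [Finset.image_insert, Finset.image_singleton]
    exact gB_sound (hlt _ (by omega)) (hlt _ (by omega)) (hlt _ hz) (hne y (by omega) x hxy).symm
      (hne z hz x (by omega)).symm (hne z hz y hyz).symm h4

theorem okTs_sound {F : Finset (Finset ℕ)} {cf pf : ℕ} (hF : Hyp F cf pf) (ds : List ℕ) :
    ∀ ts : List ℕ, okTs ds ts = true → ∀ t ∈ ts, SatP F t → Goal F := by
  induction ds with
  | nil =>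
    intro ts h t ht
    cases ts with
    | nil => simp at ht
    | cons s tl => exact (Bool.false_ne_true h).elim
  | cons d ds ih =>
    intro ts h t ht hs
    cases ts with
    | nil => simp at ht
    | cons s tl =>
      change cond (okT d s) (okTs ds tl) false = true at h
      cases h1 : okT d s
      · rw [h1] at h; exact (Bool.false_ne_true h).elim
      · rw [h1] at h
        rcases List.mem_cons.1 ht with rfl | ht
        · exact okT_sound hF h1 hs
        · exact ih tl h t ht hs

theorem goal_of_run {F : Finset (Finset ℕ)} {cf pf : ℕ} (hF : Hyp F cf pf) {ds ts ct : List ℕ}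
    {st : Stk} (h1 : okTs ds ts = true) (h2 : (run cf pf ts ct st).isNil = true) (h3 : SatS F st) :
    Goal F := by
  by_contra hG
  exact not_isNil (run_sound hF (fun t ht hs => hG (okTs_sound hF ds ts h1 t ht hs)) ct st h3) h2

theorem tv_of {a b c : ℕ} (h : a < b ∧ b < c ∧ c < 11) : TV a b c := h

theorem goalA {F : Finset (Finset ℕ)} (hF : Hyp F 0 0) (h0 : ({0, 1, 2} : Finset ℕ) ∈ F)
    (h1 : ({2, 3, 4} : Finset ℕ) ∈ F) (h2 : ({0, 4, 5} : Finset ℕ) ∈ F) : Goal F :=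
  goal_of_run hF okTA okRA (start3_sound hF h0 (tv_of (by norm_num)) h1 (tv_of (by norm_num)) h2)

theorem goalZ {F : Finset (Finset ℕ)} (hF : Hyp F 0 tAll) (h0 : ({0, 1, 2} : Finset ℕ) ∈ F)
    (h1 : ({0, 1, 3} : Finset ℕ) ∈ F) : Goal F :=
  goal_of_run hF okTZ okRZ (start2_sound hF h0 (tv_of (by norm_num)) h1)

theorem goalB1 {F : Finset (Finset ℕ)} (hF : Hyp F tAll 0) (h0 : ({0, 1, 2} : Finset ℕ) ∈ F)
    (h1 : ({0, 3, 4} : Finset ℕ) ∈ F) (h2 : ({1, 2, 3} : Finset ℕ) ∈ F) : Goal F :=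
  goal_of_run hF okTB1 okRB1 (start3_sound hF h0 (tv_of (by norm_num)) h1 (tv_of (by norm_num)) h2)

theorem goalB2 {F : Finset (Finset ℕ)} (hF : Hyp F tAll 0) (h0 : ({0, 1, 2} : Finset ℕ) ∈ F)
    (h1 : ({0, 3, 4} : Finset ℕ) ∈ F) (h2 : ({1, 2, 5} : Finset ℕ) ∈ F) : Goal F :=
  goal_of_run hF okTB2 okRB2 (start3_sound hF h0 (tv_of (by norm_num)) h1 (tv_of (by norm_num)) h2)

theorem goalB3 {F : Finset (Finset ℕ)} (hF : Hyp F tAll 0) (h0 : ({0, 1, 2} : Finset ℕ) ∈ F)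
    (h1 : ({0, 3, 4} : Finset ℕ) ∈ F) (h2 : ({5, 6, 7} : Finset ℕ) ∈ F) : Goal F :=
  goal_of_run hF okTB3 okRB3 (start3_sound hF h0 (tv_of (by norm_num)) h1 (tv_of (by norm_num)) h2)

/-! ### Relabelling -/

theorem image_left_inv {V e : Finset ℕ} {f : ℕ → ℕ} (hf : Set.InjOn f V) (he : e ⊆ V) :
    (e.image f).image (Function.invFunOn f V) = e := by
  rw [Finset.image_image]
  have : e.image (Function.invFunOn f V ∘ f) = e.image id := by
    apply Finset.image_congr
    intro x hx
    exact hf.leftInvOn_invFunOn (Finset.mem_coe.2 (he hx))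
  rw [this, Finset.image_id]

theorem edges_image_card {H : ThreeGraph} (hv : H.IsValid) {f : ℕ → ℕ}
    (hf : Set.InjOn f H.verts) : (H.edges.image (Finset.image f)).card = H.edges.card := by
  apply Finset.card_image_of_injOn
  intro e he e' he' h
  have h' : e.image f = e'.image f := h
  rw [← image_left_inv hf (hv e he).2, h', image_left_inv hf (hv e' he').2]

theorem inter_image_card {V e e' : Finset ℕ} {f : ℕ → ℕ} (hf : Set.InjOn f V) (he : e ⊆ V)
    (he' : e' ⊆ V) : (e.image f ∩ e'.image f).card = (e ∩ e').card := by
  rw [← Finset.image_inter_of_injOn]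
  · apply Finset.card_image_of_injOn
    apply hf.mono
    exact_mod_cast Finset.inter_subset_left.trans he
  · apply hf.mono
    exact_mod_cast Finset.union_subset he he'

theorem relabel {V : Finset ℕ} (hV : V.card = 11) (l : List ℕ) (hl : l.Nodup)
    (hs : ∀ v ∈ l, v ∈ V) : ∃ ψ : ℕ → ℕ, Set.InjOn ψ V ∧ (∀ v ∈ V, ψ v < 11) ∧
      ∀ (i : ℕ) (h : i < l.length), ψ l[i] = i := by
  have hsub : l.toFinset ⊆ V := by
    intro v hv; exact hs v (List.mem_toFinset.1 hv)
  have hmem : ∀ v ∈ V, v ∈ l ++ (V \ l.toFinset).toList := by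
    intro v hv
    by_cases h : v ∈ l <;> simp [h, hv]
  have hlen : (l ++ (V \ l.toFinset).toList).length = 11 := by
    rw [List.length_append, Finset.length_toList, Finset.card_sdiff_of_subset hsub,
      List.toFinset_card_of_nodup hl, hV]
    have := Finset.card_le_card hsub
    rw [List.toFinset_card_of_nodup hl, hV] at this
    omega
  refine ⟨fun v => (l ++ (V \ l.toFinset).toList).idxOf v, ?_, ?_, ?_⟩
  · intro v hv w hw h
    exact (List.idxOf_inj (hmem v hv)).1 h
  · intro v hv
    have := List.idxOf_lt_length_of_mem (hmem v hv)
    rwa [hlen] at this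
  · intro i h
    change List.idxOf _ _ = _
    rw [List.idxOf_append_of_mem (List.getElem_mem h)]
    exact hl.idxOf_getElem i h

/-- hypotheses on a 3-graph in terms of intersections of edges -/
structure HypH (H : ThreeGraph) (cf pf : ℕ) : Prop where
  valid : H.IsValid
  card : H.verts.card = 11
  big : 19 ≤ H.edges.card
  noP : ∀ e ∈ H.edges, ∀ f ∈ H.edges, ∀ g ∈ H.edges,
    (e ∩ f).card = 1 → (f ∩ g).card = 1 → (e ∩ g).card = 0 → False
  noC : cf = 0 ∨ ∀ e ∈ H.edges, ∀ f ∈ H.edges, ∀ g ∈ H.edges, (e ∩ f).card = 1 →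
    (f ∩ g).card = 1 → (e ∩ g).card = 1 → ∃ v, v ∈ e ∧ v ∈ f ∧ v ∈ g
  noP2 : pf = 0 ∨ ∀ e ∈ H.edges, ∀ f ∈ H.edges, (e ∩ f).card ≠ 1

/-- the 3-graph is contained in a target -/
def Res (H : ThreeGraph) : Prop := ∃ G : ThreeGraph, (G = XX ∨ G ∈ L11) ∧ G.ContainsCopy H

theorem transfer {H : ThreeGraph} {cf pf : ℕ} (hH : HypH H cf pf) {ψ : ℕ → ℕ}
    (hψ : Set.InjOn ψ H.verts) (hlt : ∀ v ∈ H.verts, ψ v < 11) :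
    Hyp (H.edges.image (Finset.image ψ)) cf pf := by
  have sub : ∀ e ∈ H.edges, e ⊆ H.verts := fun e he => (hH.valid e he).2
  have ic : ∀ e ∈ H.edges, ∀ f ∈ H.edges, (e.image ψ ∩ f.image ψ).card = (e ∩ f).card :=
    fun e he f hf => inter_image_card hψ (sub e he) (sub f hf)
  refine ⟨?_, ?_, ?_, ?_, ?_⟩
  · intro e ke
    obtain ⟨e, he, rfl⟩ := Finset.mem_image.1 ke
    constructor
    · rw [Finset.card_image_of_injOn (hψ.mono (by exact_mod_cast sub e he))]
      exact (hH.valid e he).1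
    · intro x hx
      obtain ⟨v, hv, rfl⟩ := Finset.mem_image.1 hx
      exact Finset.mem_range.2 (hlt v (sub e he hv))
  · rw [edges_image_card hH.valid hψ]; exact hH.big
  · intro e ke f kf g kg
    obtain ⟨e, he, rfl⟩ := Finset.mem_image.1 ke
    obtain ⟨f, hf, rfl⟩ := Finset.mem_image.1 kf
    obtain ⟨g, hg, rfl⟩ := Finset.mem_image.1 kg
    rw [ic e he f hf, ic f hf g hg, ic e he g hg]
    exact hH.noP e he f hf g hg
  · rcases hH.noC with h | h
    · exact Or.inl h
    · right
      intro e ke f kf g kg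
      obtain ⟨e, he, rfl⟩ := Finset.mem_image.1 ke
      obtain ⟨f, hf, rfl⟩ := Finset.mem_image.1 kf
      obtain ⟨g, hg, rfl⟩ := Finset.mem_image.1 kg
      rw [ic e he f hf, ic f hf g hg, ic e he g hg]
      intro h1 h2 h3
      obtain ⟨v, hv1, hv2, hv3⟩ := h e he f hf g hg h1 h2 h3
      exact ⟨ψ v, Finset.mem_image_of_mem _ hv1, Finset.mem_image_of_mem _ hv2,
        Finset.mem_image_of_mem _ hv3⟩
  · rcases hH.noP2 with h | h
    · exact Or.inl h
    · right
      intro e ke f kf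
      obtain ⟨e, he, rfl⟩ := Finset.mem_image.1 ke
      obtain ⟨f, hf, rfl⟩ := Finset.mem_image.1 kf
      rw [ic e he f hf]
      exact h e he f hf

theorem res_of_goal {H : ThreeGraph} {ψ : ℕ → ℕ}
    (hψ : Set.InjOn ψ H.verts) (hlt : ∀ v ∈ H.verts, ψ v < 11)
    (h : Goal (H.edges.image (Finset.image ψ))) : Res H := by
  obtain ⟨G, hG, f, hf1, hf2, hf3⟩ := h
  refine ⟨G, hG, f ∘ ψ, ?_, ?_, ?_⟩
  · refine hf1.comp hψ ?_
    intro v hv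
    simpa using hlt v hv
  · intro v hv
    rw [verts_range G hG, Finset.mem_range]
    exact hf2 _ (hlt v hv)
  · intro e he
    rw [← Finset.image_image]
    exact hf3 _ (Finset.mem_image_of_mem _ he)

theorem mem_img {H : ThreeGraph} {ψ : ℕ → ℕ} {a b c x y z : ℕ}
    (h : ({a, b, c} : Finset ℕ) ∈ H.edges) (ha : ψ a = x) (hb : ψ b = y) (hc : ψ c = z) :
    ({x, y, z} : Finset ℕ) ∈ H.edges.image (Finset.image ψ) := by
  rw [Finset.mem_image]
  refine ⟨_, h, ?_⟩
  rw [Finset.image_insert, Finset.image_insert, Finset.image_singleton, ha, hb, hc]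

theorem mem_v {H : ThreeGraph} (hv : H.IsValid) {a b c : ℕ}
    (h : ({a, b, c} : Finset ℕ) ∈ H.edges) : a ∈ H.verts ∧ b ∈ H.verts ∧ c ∈ H.verts :=
  ⟨(hv _ h).2 (by simp), (hv _ h).2 (by simp), (hv _ h).2 (by simp)⟩

theorem resA {H : ThreeGraph} (hH : HypH H 0 0) {r a p b q c : ℕ} (hn : [r, a, p, b, q, c].Nodup)
    (h0 : ({r, a, p} : Finset ℕ) ∈ H.edges) (h1 : ({p, b, q} : Finset ℕ) ∈ H.edges)
    (h2 : ({r, q, c} : Finset ℕ) ∈ H.edges) : Res H := by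
  have m0 := mem_v hH.valid h0
  have m1 := mem_v hH.valid h1
  have m2 := mem_v hH.valid h2
  obtain ⟨ψ, i, lt, hi⟩ := relabel hH.card _ hn (by
    intro v hv
    simp only [List.mem_cons, List.not_mem_nil, or_false] at hv
    rcases hv with rfl | rfl | rfl | rfl | rfl | rfl <;> tauto)
  have e0 : ψ r = 0 := hi 0 (by simp)
  have e1 : ψ a = 1 := hi 1 (by simp)
  have e2 : ψ p = 2 := hi 2 (by simp)
  have e3 : ψ b = 3 := hi 3 (by simp)
  have e4 : ψ q = 4 := hi 4 (by simp)
  have e5 : ψ c = 5 := hi 5 (by simp)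
  exact res_of_goal i lt (goalA (transfer hH i lt) (mem_img h0 e0 e1 e2)
    (mem_img h1 e2 e3 e4) (mem_img h2 e0 e4 e5))

theorem resZ {H : ThreeGraph} (hH : HypH H 0 tAll) {p q a b : ℕ} (hn : [p, q, a, b].Nodup)
    (h0 : ({p, q, a} : Finset ℕ) ∈ H.edges) (h1 : ({p, q, b} : Finset ℕ) ∈ H.edges) : Res H := by
  have m0 := mem_v hH.valid h0
  have m1 := mem_v hH.valid h1
  obtain ⟨ψ, i, lt, hi⟩ := relabel hH.card _ hn (by
    intro v hv
    simp only [List.mem_cons, List.not_mem_nil, or_false] at hv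
    rcases hv with rfl | rfl | rfl | rfl <;> tauto)
  have e0 : ψ p = 0 := hi 0 (by simp)
  have e1 : ψ q = 1 := hi 1 (by simp)
  have e2 : ψ a = 2 := hi 2 (by simp)
  have e3 : ψ b = 3 := hi 3 (by simp)
  exact res_of_goal i lt (goalZ (transfer hH i lt) (mem_img h0 e0 e1 e2)
    (mem_img h1 e0 e1 e3))

theorem resB1 {H : ThreeGraph} (hH : HypH H tAll 0) {c a b d g : ℕ} (hn : [c, a, b, d, g].Nodup)
    (h0 : ({c, a, b} : Finset ℕ) ∈ H.edges) (h1 : ({c, d, g} : Finset ℕ) ∈ H.edges)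
    (h2 : ({a, b, d} : Finset ℕ) ∈ H.edges) : Res H := by
  have m0 := mem_v hH.valid h0
  have m1 := mem_v hH.valid h1
  obtain ⟨ψ, i, lt, hi⟩ := relabel hH.card _ hn (by
    intro v hv
    simp only [List.mem_cons, List.not_mem_nil, or_false] at hv
    rcases hv with rfl | rfl | rfl | rfl | rfl <;> tauto)
  have e0 : ψ c = 0 := hi 0 (by simp)
  have e1 : ψ a = 1 := hi 1 (by simp)
  have e2 : ψ b = 2 := hi 2 (by simp)
  have e3 : ψ d = 3 := hi 3 (by simp)
  have e4 : ψ g = 4 := hi 4 (by simp)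
  exact res_of_goal i lt (goalB1 (transfer hH i lt) (mem_img h0 e0 e1 e2)
    (mem_img h1 e0 e3 e4) (mem_img h2 e1 e2 e3))

theorem resB2 {H : ThreeGraph} (hH : HypH H tAll 0) {c a b d g x : ℕ}
    (hn : [c, a, b, d, g, x].Nodup)
    (h0 : ({c, a, b} : Finset ℕ) ∈ H.edges) (h1 : ({c, d, g} : Finset ℕ) ∈ H.edges)
    (h2 : ({a, b, x} : Finset ℕ) ∈ H.edges) : Res H := by
  have m0 := mem_v hH.valid h0
  have m1 := mem_v hH.valid h1
  have m2 := mem_v hH.valid h2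
  obtain ⟨ψ, i, lt, hi⟩ := relabel hH.card _ hn (by
    intro v hv
    simp only [List.mem_cons, List.not_mem_nil, or_false] at hv
    rcases hv with rfl | rfl | rfl | rfl | rfl | rfl <;> tauto)
  have e0 : ψ c = 0 := hi 0 (by simp)
  have e1 : ψ a = 1 := hi 1 (by simp)
  have e2 : ψ b = 2 := hi 2 (by simp)
  have e3 : ψ d = 3 := hi 3 (by simp)
  have e4 : ψ g = 4 := hi 4 (by simp)
  have e5 : ψ x = 5 := hi 5 (by simp)
  exact res_of_goal i lt (goalB2 (transfer hH i lt) (mem_img h0 e0 e1 e2)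
    (mem_img h1 e0 e3 e4) (mem_img h2 e1 e2 e5))

theorem resB3 {H : ThreeGraph} (hH : HypH H tAll 0) {c a b d g x y z : ℕ}
    (hn : [c, a, b, d, g, x, y, z].Nodup)
    (h0 : ({c, a, b} : Finset ℕ) ∈ H.edges) (h1 : ({c, d, g} : Finset ℕ) ∈ H.edges)
    (h2 : ({x, y, z} : Finset ℕ) ∈ H.edges) : Res H := by
  have m0 := mem_v hH.valid h0
  have m1 := mem_v hH.valid h1
  have m2 := mem_v hH.valid h2
  obtain ⟨ψ, i, lt, hi⟩ := relabel hH.card _ hn (by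
    intro v hv
    simp only [List.mem_cons, List.not_mem_nil, or_false] at hv
    rcases hv with rfl | rfl | rfl | rfl | rfl | rfl | rfl | rfl <;> tauto)
  have e0 : ψ c = 0 := hi 0 (by simp)
  have e1 : ψ a = 1 := hi 1 (by simp)
  have e2 : ψ b = 2 := hi 2 (by simp)
  have e3 : ψ d = 3 := hi 3 (by simp)
  have e4 : ψ g = 4 := hi 4 (by simp)
  have e5 : ψ x = 5 := hi 5 (by simp)
  have e6 : ψ y = 6 := hi 6 (by simp)
  have e7 : ψ z = 7 := hi 7 (by simp)
  exact res_of_goal i lt (goalB3 (transfer hH i lt) (mem_img h0 e0 e1 e2)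
    (mem_img h1 e0 e3 e4) (mem_img h2 e5 e6 e7))

/-! ### The case distinction -/

theorem third {e : Finset ℕ} (h : e.card = 3) {p q : ℕ} (hp : p ∈ e) (hq : q ∈ e) (hpq : p ≠ q) :
    ∃ a, a ≠ p ∧ a ≠ q ∧ a ∈ e ∧ e = {p, q, a} := by
  have h1 : ((e.erase p).erase q).card = 1 := by
    rw [Finset.card_erase_of_mem (Finset.mem_erase.2 ⟨hpq.symm, hq⟩), Finset.card_erase_of_mem hp, h]
  obtain ⟨a, ha⟩ := Finset.card_eq_one.1 h1
  have h2 : a ∈ (e.erase p).erase q := by rw [ha]; simp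
  rw [Finset.mem_erase, Finset.mem_erase] at h2
  refine ⟨a, h2.2.1, h2.1, h2.2.2, ?_⟩
  rw [← ha, Finset.insert_erase (Finset.mem_erase.2 ⟨hpq.symm, hq⟩), Finset.insert_erase hp]

theorem two_more {e : Finset ℕ} (h : e.card = 3) {p : ℕ} (hp : p ∈ e) :
    ∃ a b, a ≠ p ∧ b ≠ p ∧ a ≠ b ∧ a ∈ e ∧ b ∈ e ∧ e = {p, a, b} := by
  have : 1 < e.card := by omega
  obtain ⟨a, ha, hap⟩ := Finset.exists_mem_ne this p
  obtain ⟨b, h1, h2, h3, h4⟩ := third h hp ha hap.symm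
  exact ⟨a, b, hap, h1, h2.symm, ha, h3, h4⟩

theorem one_spec {e f : Finset ℕ} (h : (e ∩ f).card = 1) : ∃ v, v ∈ e ∧ v ∈ f ∧
    ∀ w, w ∈ e → w ∈ f → w = v := by
  obtain ⟨v, hv⟩ := Finset.card_eq_one.1 h
  have h1 : ∀ w, w ∈ e ∧ w ∈ f ↔ w = v := by
    intro w; rw [← Finset.mem_inter, hv, Finset.mem_singleton]
  exact ⟨v, ((h1 v).2 rfl).1, ((h1 v).2 rfl).2, fun w a b => (h1 w).1 ⟨a, b⟩⟩

theorem caseA {H : ThreeGraph} (hH : HypH H 0 0) {e f g : Finset ℕ} (he : e ∈ H.edges)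
    (hf : f ∈ H.edges) (hg : g ∈ H.edges) (h1 : (e ∩ f).card = 1) (h2 : (f ∩ g).card = 1)
    (h3 : (e ∩ g).card = 1) (h4 : ¬ ∃ v, v ∈ e ∧ v ∈ f ∧ v ∈ g) : Res H := by
  obtain ⟨p, p1, p2, p3⟩ := one_spec h1
  obtain ⟨q, q1, q2, q3⟩ := one_spec h2
  obtain ⟨r, r1, r2, r3⟩ := one_spec h3
  have hpq : p ≠ q := by rintro rfl; exact h4 ⟨p, p1, p2, q2⟩
  have hpr : p ≠ r := by rintro rfl; exact h4 ⟨p, p1, p2, r2⟩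
  have hqr : q ≠ r := by rintro rfl; exact h4 ⟨q, r1, q1, q2⟩
  obtain ⟨a, a1, a2, a3, a4⟩ := third (hH.valid e he).1 r1 p1 hpr.symm
  obtain ⟨b, b1, b2, b3, b4⟩ := third (hH.valid f hf).1 p2 q1 hpq
  obtain ⟨c, c1, c2, c3, c4⟩ := third (hH.valid g hg).1 r2 q2 hqr.symm
  have n1 : a ∉ f := fun h => a2 (p3 a a3 h)
  have n2 : a ∉ g := fun h => a1 (r3 a a3 h)
  have n3 : b ∉ e := fun h => b1 (p3 b h b3)
  have n4 : b ∉ g := fun h => b2 (q3 b b3 h)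
  have n5 : c ∉ e := fun h => c1 (r3 c h c3)
  have n6 : c ∉ f := fun h => c2 (q3 c h c3)
  have k1 : ({r, a, p} : Finset ℕ) ∈ H.edges := by
    have : ({r, a, p} : Finset ℕ) = e := by rw [a4]; ext; simp; tauto
    rwa [this]
  have k2 : ({p, b, q} : Finset ℕ) ∈ H.edges := by
    have : ({p, b, q} : Finset ℕ) = f := by rw [b4]; ext; simp; tauto
    rwa [this]
  have k3 : ({r, q, c} : Finset ℕ) ∈ H.edges := by rwa [← c4]
  refine resA hH ?_ k1 k2 k3
  simp only [List.nodup_cons, List.mem_cons, List.not_mem_nil, or_false, not_or, not_false_eq_true,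
    List.nodup_nil, and_true]
  clear h4 k1 k2 k3 a4 b4 c4
  refine ⟨⟨?_, ?_, ?_, ?_, ?_⟩, ⟨?_, ?_, ?_, ?_⟩, ⟨?_, ?_, ?_⟩, ⟨?_, ?_⟩, ?_⟩ <;> grind

theorem caseB0 {H : ThreeGraph} (hH : HypH H tAll 0) {c a b d g : ℕ} (hn : [c, a, b, d, g].Nodup)
    (h0 : ({c, a, b} : Finset ℕ) ∈ H.edges) (h1 : ({c, d, g} : Finset ℕ) ∈ H.edges)
    {h : Finset ℕ} (hh : h ∈ H.edges) (hc : c ∉ h) (ha : a ∈ h) (hb : b ∈ h) : Res H := by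
  have hn' := hn
  simp only [List.nodup_cons, List.mem_cons, List.not_mem_nil, or_false, not_or, not_false_eq_true,
    List.nodup_nil, and_true] at hn'
  obtain ⟨x, x1, x2, x3, rfl⟩ := third (hH.valid h hh).1 ha hb (by tauto)
  by_cases hd : x = d
  · subst hd; exact resB1 hH hn h0 h1 hh
  by_cases hg : x = g
  · subst hg
    refine resB1 hH (d := x) (g := d) ?_ h0 (by rwa [Finset.pair_comm x d]) hh
    simp only [List.nodup_cons, List.mem_cons, List.not_mem_nil, or_false, not_or,
      not_false_eq_true, List.nodup_nil, and_true]
    grind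
  · refine resB2 hH ?_ h0 h1 hh
    simp only [List.nodup_cons, List.mem_cons, List.not_mem_nil, or_false, not_or,
      not_false_eq_true, List.nodup_nil, and_true]
    have : c ≠ x := by rintro rfl; exact hc x3
    grind

theorem caseB {H : ThreeGraph} (hH : HypH H tAll 0) {c a b d g : ℕ} (hn : [c, a, b, d, g].Nodup)
    (h0 : ({c, a, b} : Finset ℕ) ∈ H.edges) (h1 : ({c, d, g} : Finset ℕ) ∈ H.edges)
    {h : Finset ℕ} (hh : h ∈ H.edges) (hc : c ∉ h) : Res H := by
  have hn' := hn
  simp only [List.nodup_cons, List.mem_cons, List.not_mem_nil, or_false, not_or, not_false_eq_true,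
    List.nodup_nil, and_true] at hn'
  obtain ⟨⟨n1, n2, n3, n4⟩, ⟨n5, n6, n7⟩, ⟨n8, n9⟩, n10⟩ := hn'
  have ce := card_three_inter n1 n2 n5 h
  have cf := card_three_inter n3 n4 n10 h
  have ef : (({c, a, b} : Finset ℕ) ∩ {c, d, g}).card = 1 := by
    rw [card_three_inter n1 n2 n5]
    simp [Ne.symm n1, Ne.symm n2, n6, n7, n8, n9]
  have fe : (({c, d, g} : Finset ℕ) ∩ {c, a, b}).card = 1 := by rwa [Finset.inter_comm]
  have hn2 : [c, d, g, a, b].Nodup := by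
    simp only [List.nodup_cons, List.mem_cons, List.not_mem_nil, or_false, not_or,
      not_false_eq_true, List.nodup_nil, and_true]
    grind
  have P1 := hH.noP _ h1 _ h0 _ hh fe
  have P2 := hH.noP _ h0 _ h1 _ hh ef
  have C1 : (({c, a, b} : Finset ℕ) ∩ h).card = 1 → (({c, d, g} : Finset ℕ) ∩ h).card = 1 →
      False := by
    intro k1 k2
    rcases hH.noC with h' | h'
    · exact absurd h' (by decide +kernel)
    · obtain ⟨v, v1, v2, v3⟩ := h' _ h0 _ h1 _ hh ef k2 k1
      obtain ⟨w, w1, w2, w3⟩ := one_spec ef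
      have := w3 v v1 v2
      have := w3 c (by simp) (by simp)
      apply hc
      have hcv : c = v := by omega
      rwa [hcv]
  rw [ce] at P1 C1 P2
  rw [cf] at P1 P2 C1
  by_cases hab : a ∈ h ∧ b ∈ h
  · exact caseB0 hH hn h0 h1 hh hc hab.1 hab.2
  by_cases hdg : d ∈ h ∧ g ∈ h
  · exact caseB0 hH hn2 h1 h0 hh hc hdg.1 hdg.2
  have hN : a ∉ h ∧ b ∉ h ∧ d ∉ h ∧ g ∉ h := by
    clear ce cf ef fe h0 h1 hh hn hn2 n1 n2 n3 n4 n5 n6 n7 n8 n9 n10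
    grind
  obtain ⟨ha, hb, hd, hg⟩ := hN
  obtain ⟨x, y, z, x1, x2, x3, rfl⟩ := Finset.card_eq_three.1 (hH.valid h hh).1
  refine resB3 hH ?_ h0 h1 hh
  simp only [Finset.mem_insert, Finset.mem_singleton, not_or] at ha hb hc hd hg
  simp only [List.nodup_cons, List.mem_cons, List.not_mem_nil, or_false, not_or,
      not_false_eq_true, List.nodup_nil, and_true]
  clear P1 P2 C1 ce cf ef fe hn hn2 hab hdg
  tauto

theorem star_res {H : ThreeGraph} (hv : H.IsValid) (hc : H.verts.card = 11) {c : ℕ}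
    (hcv : c ∈ H.verts) (h : ∀ e ∈ H.edges, c ∈ e) : Res H := by
  obtain ⟨ψ, i, lt, hi⟩ := relabel hc [c] (by simp) (by simpa using hcv)
  have e0 : ψ c = 0 := hi 0 (by simp)
  refine ⟨SS 11, Or.inr (by simp [L11]), ψ, i, ?_, ?_⟩
  · intro v hv; exact Finset.mem_range.2 (lt v hv)
  · intro e he
    change _ ∈ Finset.filter _ _
    rw [Finset.mem_filter, Finset.mem_powersetCard]
    refine ⟨⟨?_, ?_⟩, ?_⟩
    · intro x hx
      obtain ⟨v, hv', rfl⟩ := Finset.mem_image.1 hx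
      exact Finset.mem_range.2 (lt v ((hv e he).2 hv'))
    · rw [Finset.card_image_of_injOn (i.mono (by exact_mod_cast (hv e he).2))]
      exact (hv e he).1
    · rw [← e0]; exact Finset.mem_image_of_mem _ (h e he)

theorem res_main {H : ThreeGraph} (hH : HypH H 0 0) : Res H := by
  by_cases hA : ∀ e ∈ H.edges, ∀ f ∈ H.edges, ∀ g ∈ H.edges, (e ∩ f).card = 1 →
    (f ∩ g).card = 1 → (e ∩ g).card = 1 → ∃ v, v ∈ e ∧ v ∈ f ∧ v ∈ g
  swap
  · push Not at hA
    obtain ⟨e, he, f, hf, g, hg, h1, h2, h3, h4⟩ := hA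
    exact caseA hH he hf hg h1 h2 h3 (by rintro ⟨v, v1, v2, v3⟩; exact h4 v v1 v2 v3)
  by_cases hP : ∀ e ∈ H.edges, ∀ f ∈ H.edges, (e ∩ f).card ≠ 1
  swap
  · push Not at hP
    obtain ⟨e, he, f, hf, h1⟩ := hP
    have hH' : HypH H tAll 0 := ⟨hH.valid, hH.card, hH.big, hH.noP, Or.inr hA, Or.inl rfl⟩
    obtain ⟨c, c1, c2, c3⟩ := one_spec h1
    by_cases hs : ∀ h ∈ H.edges, c ∈ h
    · exact star_res hH.valid hH.card ((hH.valid e he).2 c1) hs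
    push Not at hs
    obtain ⟨h, hh, hc⟩ := hs
    obtain ⟨a, b, a1, a2, a3, a4, a5, rfl⟩ := two_more (hH.valid e he).1 c1
    obtain ⟨d, g, d1, d2, d3, d4, d5, rfl⟩ := two_more (hH.valid f hf).1 c2
    refine caseB hH' ?_ he hf hh hc
    have k1 : a ∉ ({c, d, g} : Finset ℕ) := fun h => a1 (c3 a a4 h)
    have k2 : b ∉ ({c, d, g} : Finset ℕ) := fun h => a2 (c3 b a5 h)
    simp only [Finset.mem_insert, Finset.mem_singleton, not_or] at k1 k2
    simp only [List.nodup_cons, List.mem_cons, List.not_mem_nil, or_false, not_or,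
      not_false_eq_true, List.nodup_nil, and_true]
    exact ⟨⟨a1.symm, a2.symm, d1.symm, d2.symm⟩, ⟨a3, k1.2⟩, k2.2, d3⟩
  have hH' : HypH H 0 tAll := ⟨hH.valid, hH.card, hH.big, hH.noP, Or.inl rfl, Or.inr hP⟩
  by_cases hZ : ∃ e ∈ H.edges, ∃ f ∈ H.edges, (e ∩ f).card = 2
  · obtain ⟨e, he, f, hf, h2⟩ := hZ
    obtain ⟨p, q, hpq, hef⟩ := Finset.card_eq_two.1 h2
    have hp : p ∈ e ∩ f := by rw [hef]; simp
    have hq : q ∈ e ∩ f := by rw [hef]; simp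
    have hp' := Finset.mem_inter.1 hp
    have hq' := Finset.mem_inter.1 hq
    obtain ⟨a, a1, a2, a3, a4⟩ := third (hH.valid e he).1 hp'.1 hq'.1 hpq
    obtain ⟨b, b1, b2, b3, b4⟩ := third (hH.valid f hf).1 hp'.2 hq'.2 hpq
    have hab : a ≠ b := by
      rintro rfl
      have : a ∈ e ∩ f := Finset.mem_inter.2 ⟨a3, b3⟩
      rw [hef] at this
      simp only [Finset.mem_insert, Finset.mem_singleton] at this
      tauto
    refine resZ hH' (p := p) (q := q) (a := a) (b := b) ?_ (by rwa [← a4]) (by rwa [← b4])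
    simp only [List.nodup_cons, List.mem_cons, List.not_mem_nil, or_false, not_or,
      not_false_eq_true, List.nodup_nil, and_true]
    exact ⟨⟨hpq, a1.symm, b1.symm⟩, ⟨a2.symm, b2.symm⟩, hab⟩
  exfalso
  push Not at hZ
  have hd : ∀ e ∈ H.edges, ∀ f ∈ H.edges, e ≠ f → Disjoint (id e) (id f) := by
    intro e he f hf hne
    rw [id, id, Finset.disjoint_iff_inter_eq_empty, ← Finset.card_eq_zero]
    have h1 := hP e he f hf
    have h2 := hZ e he f hf
    have ce := (hH.valid e he).1
    have cf := (hH.valid f hf).1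
    have h3 : (e ∩ f).card ≤ 3 := ce ▸ Finset.card_le_card Finset.inter_subset_left
    have h4 : (e ∩ f).card ≠ 3 := by
      intro h
      have k1 : e ∩ f = e := Finset.eq_of_subset_of_card_le Finset.inter_subset_left (by omega)
      have k2 : e ∩ f = f := Finset.eq_of_subset_of_card_le Finset.inter_subset_right (by omega)
      exact hne (k1.symm.trans k2)
    omega
  have h1 := Finset.card_biUnion hd
  have h2 : H.edges.biUnion id ⊆ H.verts := by
    intro v hv
    obtain ⟨e, he, hv⟩ := Finset.mem_biUnion.1 hv
    exact (hH.valid e he).2 hv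
  have h3 := Finset.card_le_card h2
  have h4 : ∑ e ∈ H.edges, (id e).card = ∑ e ∈ H.edges, 3 :=
    Finset.sum_congr rfl fun e he => (hH.valid e he).1
  rw [h1, h4, Finset.sum_const, smul_eq_mul, hH.card] at h3
  have := hH.big
  omega

theorem noP_of_free {H : ThreeGraph} (hv : H.IsValid) (h : H.Free pathP) :
    ∀ e ∈ H.edges, ∀ f ∈ H.edges, ∀ g ∈ H.edges,
    (e ∩ f).card = 1 → (f ∩ g).card = 1 → (e ∩ g).card = 0 → False := by
  intro e he f hf g hg h1 h2 h3
  apply h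
  have h3' : ∀ v, v ∈ e → v ∉ g := by
    intro v v1 v2
    have : v ∈ e ∩ g := Finset.mem_inter.2 ⟨v1, v2⟩
    rw [Finset.card_eq_zero.1 h3] at this
    simp at this
  obtain ⟨p, p1, p2, p3⟩ := one_spec h1
  obtain ⟨q, q1, q2, q3⟩ := one_spec h2
  have hpq : p ≠ q := by rintro rfl; exact h3' p p1 q2
  obtain ⟨m, m1, m2, m3, m4⟩ := third (hv f hf).1 p2 q1 hpq
  obtain ⟨a, b, a1, b1, ab, a2, b2, a4⟩ := two_more (hv e he).1 p1
  obtain ⟨c, d, c1, d1, cd, c2, d2, c4⟩ := two_more (hv g hg).1 q2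
  have k1 : ({a, b, p} : Finset ℕ) ∈ H.edges := by
    have : ({a, b, p} : Finset ℕ) = e := by rw [a4]; ext; simp; tauto
    rwa [this]
  have k2 : ({p, m, q} : Finset ℕ) ∈ H.edges := by
    have : ({p, m, q} : Finset ℕ) = f := by rw [m4]; ext; simp; tauto
    rwa [this]
  have k3 : ({q, c, d} : Finset ℕ) ∈ H.edges := by rwa [← c4]
  have hn : [a, b, p, m, q, c, d].Nodup := by
    simp only [List.nodup_cons, List.mem_cons, List.not_mem_nil, or_false, not_or,
      not_false_eq_true, List.nodup_nil, and_true]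
    clear a4 c4 m4 h k1 k2 k3
    refine ⟨⟨?_, ?_, ?_, ?_, ?_, ?_⟩, ⟨?_, ?_, ?_, ?_, ?_⟩, ⟨?_, ?_, ?_, ?_⟩, ⟨?_, ?_, ?_⟩,
      ⟨?_, ?_⟩, ?_⟩ <;> grind
  have hpv : pathP.verts = Finset.range 7 := by decide +kernel
  have v1 := mem_v hv k1
  have v2 := mem_v hv k2
  have v3 := mem_v hv k3
  refine ⟨fun i => [a, b, p, m, q, c, d].getD i 0, ?_, ?_, ?_⟩
  · rw [hpv]
    intro i hi j hj hij
    simp only [Finset.coe_range, Set.mem_Iio] at hi hj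
    have hi' : i < [a, b, p, m, q, c, d].length := hi
    have hj' : j < [a, b, p, m, q, c, d].length := hj
    simp only at hij
    rw [List.getD_eq_getElem _ _ hi', List.getD_eq_getElem _ _ hj'] at hij
    exact (hn.getElem_inj_iff).1 hij
  · intro i hi
    rw [hpv, Finset.mem_range] at hi
    interval_cases i <;> simp <;> tauto
  · intro e he
    change e ∈ ({{0,1,2},{2,3,4},{4,5,6}} : Finset (Finset ℕ)) at he
    simp only [Finset.mem_insert, Finset.mem_singleton] at he
    rcases he with rfl | rfl | rfl
    · simpa using k1
    · simpa using k2
    · simpa using k3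

/-! ### The extremal 3-graph -/

theorem XX_card : XX.edges.card = 19 := by decide +kernel
theorem XX_valid : XX.IsValid := by unfold ThreeGraph.IsValid; decide +kernel
theorem XX_verts : XX.verts = Finset.range 11 := verts_range _ (Or.inl rfl)

theorem iso_of_copy {H : ThreeGraph} (hv : H.IsValid) (hc : H.verts.card = 11)
    (hb : 19 ≤ H.edges.card) (h : XX.ContainsCopy H) :
    H.edges.card = 19 ∧ ThreeGraph.IsoCopy XX H := by
  obtain ⟨f, f1, f2, f3⟩ := h
  have e1 : H.edges.image (Finset.image f) ⊆ XX.edges := by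
    intro e ke
    obtain ⟨e, he, rfl⟩ := Finset.mem_image.1 ke
    exact f3 e he
  have c1 := edges_image_card hv f1
  have e2 : H.edges.image (Finset.image f) = XX.edges :=
    Finset.eq_of_subset_of_card_le e1 (by rw [XX_card, c1]; exact hb)
  have e3 : H.verts.image f = XX.verts := by
    apply Finset.eq_of_subset_of_card_le
    · intro x hx
      obtain ⟨v, hv, rfl⟩ := Finset.mem_image.1 hx
      exact f2 v hv
    · rw [Finset.card_image_of_injOn f1, hc, XX_verts, Finset.card_range]
  refine ⟨by rw [← c1, e2, XX_card], Function.invFunOn f H.verts, ?_, ?_, ?_⟩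
  · rw [← e3, Finset.coe_image]
    exact Function.invFunOn_injOn_image f _
  · rw [← e3, image_left_inv f1 (Finset.Subset.refl _)]
  · rw [← e2, Finset.image_image]
    have : H.edges.image (Finset.image (Function.invFunOn f H.verts) ∘ Finset.image f) =
        H.edges.image id := by
      apply Finset.image_congr
      intro e he
      exact image_left_inv f1 (hv e he).2
    rw [this, Finset.image_id]

theorem card_of_iso {H : ThreeGraph} (h : ThreeGraph.IsoCopy XX H) : H.edges.card = 19 := by
  obtain ⟨f, f1, _, f3⟩ := h
  rw [← f3, edges_image_card XX_valid f1, XX_card]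

theorem XX_noP : ∀ e ∈ XX.edges, ∀ f ∈ XX.edges, ∀ g ∈ XX.edges,
    (e ∩ f).card = 1 → (f ∩ g).card = 1 → (e ∩ g).card ≠ 0 := by decide +kernel

theorem XX_free : XX.Free pathP := by
  rintro ⟨f, f1, f2, f3⟩
  have s1 : ({0, 1, 2} : Finset ℕ) ⊆ pathP.verts := by decide
  have s2 : ({2, 3, 4} : Finset ℕ) ⊆ pathP.verts := by decide
  have s3 : ({4, 5, 6} : Finset ℕ) ⊆ pathP.verts := by decide
  refine XX_noP _ (f3 {0, 1, 2} (by decide)) _ (f3 {2, 3, 4} (by decide)) _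
    (f3 {4, 5, 6} (by decide)) ?_ ?_ ?_
  · rw [inter_image_card f1 s1 s2]; decide
  · rw [inter_image_card f1 s2 s3]; decide
  · rw [inter_image_card f1 s1 s3]; decide

theorem XX_not_inter {G : ThreeGraph} (h : ∀ e ∈ G.edges, ∀ f ∈ G.edges, (e ∩ f).card ≠ 0) :
    ¬ G.ContainsCopy XX := by
  rintro ⟨f, f1, f2, f3⟩
  rw [XX_verts] at f1
  refine h _ (f3 {0, 1, 2} (by decide +kernel)) _ (f3 {4, 5, 6} (by decide +kernel)) ?_
  rw [inter_image_card f1 (by decide) (by decide)]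
  decide

theorem inter_SS : ∀ e ∈ (SS 11).edges, ∀ f ∈ (SS 11).edges, (e ∩ f).card ≠ 0 := by decide +kernel
theorem inter_G1 : ∀ e ∈ (G1 11).edges, ∀ f ∈ (G1 11).edges, (e ∩ f).card ≠ 0 := by decide +kernel
theorem inter_G2 : ∀ e ∈ (G2 11).edges, ∀ f ∈ (G2 11).edges, (e ∩ f).card ≠ 0 := by decide +kernel
theorem inter_G3 : ∀ e ∈ (G3 11).edges, ∀ f ∈ (G3 11).edges, (e ∩ f).card ≠ 0 := by decide +kernel

theorem KU_edges : ∀ e ∈ ((KK 6).dUnion (KK 5)).edges,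
    e ⊆ Finset.range 6 ∨ e ⊆ Finset.Ico 6 11 := by decide +kernel

theorem comet_edges : ∀ e ∈ (comet 11).edges, 0 ∈ e ∨ e = {1, 2, 3} := by decide +kernel

theorem XX_not_KU : ¬ ((KK 6).dUnion (KK 5)).ContainsCopy XX := by
  rintro ⟨f, f1, f2, f3⟩
  rw [XX_verts] at f1
  have k1 := KU_edges _ (f3 {4, 5, 6} (by decide +kernel))
  have k2 := KU_edges _ (f3 {4, 7, 8} (by decide +kernel))
  have k3 := KU_edges _ (f3 {4, 9, 10} (by decide +kernel))
  have hcard : (({4, 5, 6, 7, 8, 9, 10} : Finset ℕ).image f).card = 7 := by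
    rw [Finset.card_image_of_injOn (f1.mono (by
      exact_mod_cast (by decide : ({4, 5, 6, 7, 8, 9, 10} : Finset ℕ) ⊆ Finset.range 11)))]
    rfl
  simp only [Finset.subset_iff, Finset.image_insert, Finset.image_singleton, Finset.mem_insert,
    Finset.mem_singleton, forall_eq_or_imp, forall_eq, Finset.mem_range, Finset.mem_Ico] at k1 k2 k3
  by_cases h4 : f 4 < 6
  · have : ({4, 5, 6, 7, 8, 9, 10} : Finset ℕ).image f ⊆ Finset.range 6 := by
      intro x hx
      simp only [Finset.image_insert, Finset.image_singleton, Finset.mem_insert,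
        Finset.mem_singleton] at hx
      rw [Finset.mem_range]
      omega
    have := Finset.card_le_card this
    rw [hcard, Finset.card_range] at this
    omega
  · have : ({4, 5, 6, 7, 8, 9, 10} : Finset ℕ).image f ⊆ Finset.Ico 6 11 := by
      intro x hx
      simp only [Finset.image_insert, Finset.image_singleton, Finset.mem_insert,
        Finset.mem_singleton] at hx
      rw [Finset.mem_Ico]
      omega
    have := Finset.card_le_card this
    rw [hcard, Nat.card_Ico] at this
    omega

theorem XX_not_comet : ¬ (comet 11).ContainsCopy XX := by
  rintro ⟨f, f1, f2, f3⟩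
  rw [XX_verts] at f1
  have key : ∀ d e : Finset ℕ, d ∈ XX.edges → e ∈ XX.edges → d ≠ e → d ⊆ Finset.range 11 →
      e ⊆ Finset.range 11 → 0 ∈ d.image f ∨ 0 ∈ e.image f := by
    intro d e hd he hne h1 h2
    rcases comet_edges _ (f3 d hd) with h | h
    · exact Or.inl h
    rcases comet_edges _ (f3 e he) with h' | h'
    · exact Or.inr h'
    exfalso
    apply hne
    rw [← image_left_inv f1 h1, h, ← h', image_left_inv f1 h2]
  have k1 := key {0, 1, 2} {0, 1, 3} (by decide +kernel) (by decide +kernel) (by decide) (by decide)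
    (by decide)
  have k2 := key {4, 5, 6} {4, 7, 8} (by decide +kernel) (by decide +kernel) (by decide) (by decide)
    (by decide)
  have m1 : ∃ v < 4, f v = 0 := by
    simp only [Finset.image_insert, Finset.image_singleton, Finset.mem_insert,
        Finset.mem_singleton] at k1
    rcases k1 with (h | h | h) | (h | h | h)
    all_goals exact ⟨_, by norm_num, h.symm⟩
  have m2 : ∃ v, (4 ≤ v ∧ v < 11) ∧ f v = 0 := by
    simp only [Finset.image_insert, Finset.image_singleton, Finset.mem_insert,
        Finset.mem_singleton] at k2
    rcases k2 with (h | h | h) | (h | h | h)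
    all_goals exact ⟨_, by norm_num, h.symm⟩
  obtain ⟨v, v1, v2⟩ := m1
  obtain ⟨w, w1, w2⟩ := m2
  have : v = w := f1 (by simp; omega) (by simp; omega) (v2.trans w2.symm)
  omega

theorem XX_L11 : ∀ G ∈ L11, ¬ G.ContainsCopy XX := by
  intro G h
  simp only [L11, List.mem_cons, List.not_mem_nil, or_false] at h
  rcases h with rfl | rfl | rfl | rfl | rfl | rfl
  · exact XX_not_inter inter_SS
  · exact XX_not_KU
  · exact XX_not_inter inter_G1
  · exact XX_not_inter inter_G2
  · exact XX_not_comet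
  · exact XX_not_inter inter_G3

theorem upper {H : ThreeGraph} (hv : H.IsValid) (hc : H.verts.card = 11) (hP : H.Free pathP)
    (hL : ∀ G ∈ L11, ¬ G.ContainsCopy H) (hb : 19 ≤ H.edges.card) :
    H.edges.card = 19 ∧ ThreeGraph.IsoCopy XX H := by
  obtain ⟨G, hG | hG, h⟩ := res_main (H := H) ⟨hv, hc, hb, noP_of_free hv hP, Or.inl rfl, Or.inl rfl⟩
  · subst hG; exact iso_of_copy hv hc hb h
  · exact (hL G hG h).elim

/-- The maximum number of edges of a `P`-free 3-graph on 11 vertices not contained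
in any member of `L₁₁` equals 19, attained exactly by `K_4 ∪ S_7`. -/
theorem fifth_order_turan_eleven :
    IsGreatest {m : ℕ | ∃ H : ThreeGraph, H.IsValid ∧ H.verts.card = 11 ∧
      H.Free pathP ∧ (∀ G ∈ L11, ¬ G.ContainsCopy H) ∧ H.edges.card = m} 19 ∧
    ∀ H : ThreeGraph, H.IsValid → H.verts.card = 11 → H.Free pathP →
      (∀ G ∈ L11, ¬ G.ContainsCopy H) →
      (H.edges.card = 19 ↔ ThreeGraph.IsoCopy ((KK 4).dUnion (SS 7)) H) := by
  refine ⟨⟨?_, ?_⟩, ?_⟩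
  · exact ⟨XX, XX_valid, by rw [XX_verts, Finset.card_range], XX_free, XX_L11, XX_card⟩
  · rintro m ⟨H, hv, hc, hP, hL, rfl⟩
    by_contra hlt
    have := (upper hv hc hP hL (by omega)).1
    omega
  · intro H hv hc hP hL
    constructor
    · intro h
      exact (upper hv hc hP hL h.ge).2
    · intro h
      exact card_of_iso h
end
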